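/- Periodic cell formula (Lemma 3.2 / Lemma 'Whomper' of the paper): assume Assumption H and Assumption A:2T. Then for every F ∈ ℝ^{n×d}: W₀(F) = lim_{k→∞} E[W^{(k)}(·;F)], where W^{(k)} is the periodic cell minimization. -/

import Mathlib

open MeasureTheory Filter Metric Set
open scoped Classical
open scoped ENNReal Topology Pointwise

noncomputable section

namespace StochHom

/-- `ℝ^d` with the Euclidean norm. -/
abbrev Rd (d : ℕ) : Type := EuclideanSpace ℝ (Fin d)

/-- `ℝ^n` with the Euclidean norm. -/
abbrev Rn (n : ℕ) : Type := EuclideanSpace ℝ (Fin n)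

/-- The lattice `ℤ^d`. -/
abbrev Zd (d : ℕ) : Type := Fin d → ℤ

variable {d n : ℕ}

/-- The embedding of the lattice `ℤ^d` into `ℝ^d`. -/
def toRd (z : Zd d) : Rd d := (EuclideanSpace.equiv (Fin d) ℝ).symm fun i => (z i : ℝ)

/-- The standard basis vectors `eᵢ` of `ℤ^d`. -/
def stdb (i : Fin d) : Zd d := fun j => if j = i then 1 else 0

/-- The interaction range `R = max {4√d, max_{b ∈ ℰ₀} |b|}`. -/
def irange (d : ℕ) (E0 : Finset (Zd d)) : ℝ :=
  max (4 * Real.sqrt d) (sSup ((fun b : Zd d => ‖toRd b‖) '' (E0 : Set (Zd d))))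

variable {Ω : Type*} [MeasurableSpace Ω]

/-- The energy `E₁(ω; u, ℤ^d ∩ A)`. -/
def energy1 (τ : Zd d → Ω → Ω) (E0 : Finset (Zd d)) (V : Zd d → Ω → Rn n → ℝ)
    (ω : Ω) (u : Zd d → Rn n) (A : Set (Rd d)) : ℝ :=
  ∑' z : Zd d, if toRd z ∈ A then
      ∑ b ∈ E0, V b (τ z ω) ((‖toRd b‖)⁻¹ • (u (z + b) - u z)) else 0

/-- The scaled energy `E_ε(ω; u, A)`, where a function `u : εℤ^d → ℝ^n` is identified with a
function on `ℤ^d` via `z ↦ u(εz)`, so that `∂_b^ε u (z) = (u (z+b) - u z)/(ε |b|)`. -/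
def energyE (τ : Zd d → Ω → Ω) (E0 : Finset (Zd d)) (V : Zd d → Ω → Rn n → ℝ)
    (ε : ℝ) (ω : Ω) (u : Zd d → Rn n) (A : Set (Rd d)) : ℝ :=
  ε ^ d * ∑' z : Zd d, if ε • toRd z ∈ A then
      ∑ b ∈ E0, V b (τ z ω) ((ε * ‖toRd b‖)⁻¹ • (u (z + b) - u z)) else 0

/-- The localized minimal energy `m_F(ω; A)`. -/
def mF (τ : Zd d → Ω → Ω) (E0 : Finset (Zd d)) (V : Zd d → Ω → Rn n → ℝ)
    (ω : Ω) (F : Rd d →L[ℝ] Rn n) (A : Set (Rd d)) : ℝ :=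
  ⨅ φ : {φ : Zd d → Rn n // ∀ z : Zd d, infDist (toRd z) Aᶜ ≤ irange d E0 → φ z = 0},
    energy1 τ E0 V ω (fun z => F (toRd z) + φ.1 z) A

/-- The half-open cube `[0,k)^d ⊂ ℝ^d`. -/
def cube (d k : ℕ) : Set (Rd d) := {x | ∀ i, 0 ≤ x i ∧ x i < (k : ℝ)}

/-- The homogenized energy density `W₀(F) = inf_{k ≥ 1} k⁻ᵈ E[m_F(·, [0,k)^d)]`. -/
def W0 (P : Measure Ω) (τ : Zd d → Ω → Ω) (E0 : Finset (Zd d))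
    (V : Zd d → Ω → Rn n → ℝ) (F : Rd d →L[ℝ] Rn n) : ℝ :=
  ⨅ k : {k : ℕ // 0 < k}, (((k : ℕ) : ℝ) ^ d)⁻¹ * ∫ ω, mF τ E0 V ω F (cube d k) ∂P

/-- Half-open axis-parallel box `Π_i [aᵢ, bᵢ)`. -/
def halfBox (a b : Fin d → ℝ) : Set (Rd d) := {x | ∀ i, a i ≤ x i ∧ x i < b i}

/-- Open axis-parallel box `Π_i (aᵢ, bᵢ)`. -/
def openBox (a b : Fin d → ℝ) : Set (Rd d) := {x | ∀ i, a i < x i ∧ x i < b i}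

/-- Closed axis-parallel box `Π_i [aᵢ, bᵢ]`. -/
def closedBox (a b : Fin d → ℝ) : Set (Rd d) := {x | ∀ i, a i ≤ x i ∧ x i ≤ b i}

/-- Half-open axis-parallel box with integer corners. -/
def intBox (a b : Zd d) : Set (Rd d) := {x | ∀ i, (a i : ℝ) ≤ x i ∧ x i < (b i : ℝ)}

/-- The periodic cell minimization `W^{(k)}(ω; F)`. -/
def Wper (τ : Zd d → Ω → Ω) (E0 : Finset (Zd d)) (V : Zd d → Ω → Rn n → ℝ)
    (k : ℕ) (ω : Ω) (F : Rd d →L[ℝ] Rn n) : ℝ :=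
  ⨅ φ : {φ : Zd d → Rn n // ∀ z z' : Zd d, φ (z + k • z') = φ z},
    ((k : ℝ) ^ d)⁻¹ * energy1 τ E0 V ω (fun z => F (toRd z) + φ.1 z) (cube d k)

/-- The lattice box `[0,r)^d ∩ ℤ^d` as a finite set. -/
def bx (d r : ℕ) : Finset (Zd d) := Fintype.piFinset fun _ => Finset.Ico (0:ℤ) (r:ℤ)

lemma mem_bx {r : ℕ} {z : Zd d} : z ∈ bx d r ↔ ∀ j, 0 ≤ z j ∧ z j < r := by
  simp [bx, Fintype.mem_piFinset]

lemma card_bx (d r : ℕ) : (bx d r).card = r ^ d := by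
  simp [bx, Fintype.card_piFinset]

@[simp] lemma toRd_apply (z : Zd d) (j : Fin d) : toRd z j = (z j : ℝ) := rfl

lemma toRd_add (x y : Zd d) : toRd (x + y) = toRd x + toRd y := by
  ext j; simp

lemma toRd_sub (x y : Zd d) : toRd (x - y) = toRd x - toRd y := by
  ext j; simp

@[simp] lemma toRd_zero : toRd (0 : Zd d) = 0 := by
  ext j; simp

lemma toRd_neg (x : Zd d) : toRd (-x) = -toRd x := by
  ext j; simp

lemma toRd_mem_cube {k : ℕ} {z : Zd d} : toRd z ∈ cube d k ↔ z ∈ bx d k := by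
  rw [mem_bx]
  simp only [cube, mem_ofPred_eq, toRd_apply]
  refine forall_congr' fun j => ?_
  constructor
  · rintro ⟨h1, h2⟩; exact ⟨by exact_mod_cast h1, by exact_mod_cast h2⟩
  · rintro ⟨h1, h2⟩; exact ⟨by exact_mod_cast h1, by exact_mod_cast h2⟩

lemma abs_coord_le (x : Rd d) (j : Fin d) : |x j| ≤ ‖x‖ := by
  simpa using PiLp.norm_apply_le x j

lemma one_le_norm_toRd {b : Zd d} (hb : b ≠ 0) : 1 ≤ ‖toRd b‖ := by
  obtain ⟨j, hj⟩ : ∃ j, b j ≠ 0 := by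
    by_contra h; push Not at h; exact hb (funext h)
  have h1 : |toRd b j| ≤ ‖toRd b‖ := abs_coord_le _ _
  have h2 : (1:ℝ) ≤ |toRd b j| := by
    rw [toRd_apply]
    have : (1:ℤ) ≤ |b j| := Int.one_le_abs hj
    rw [← Int.cast_abs]; exact_mod_cast this
  linarith

/-- the energy of `G x + φ` in a box -/
def en (τ : Zd d → Ω → Ω) (E0 : Finset (Zd d)) (V : Zd d → Ω → Rn n → ℝ)
    (ω : Ω) (G : Rd d →L[ℝ] Rn n) (φ : Zd d → Rn n) (r : ℕ) : ℝ :=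
  ∑ z ∈ bx d r, ∑ b ∈ E0, V b (τ z ω) ((‖toRd b‖)⁻¹ • (G (toRd b) + (φ (z + b) - φ z)))

lemma energy1_cube (τ : Zd d → Ω → Ω) (E0 : Finset (Zd d)) (V : Zd d → Ω → Rn n → ℝ)
    (ω : Ω) (G : Rd d →L[ℝ] Rn n) (φ : Zd d → Rn n) (r : ℕ) :
    energy1 τ E0 V ω (fun z => G (toRd z) + φ z) (cube d r) = en τ E0 V ω G φ r := by
  unfold energy1 en
  rw [tsum_eq_sum (s := bx d r)]
  · refine Finset.sum_congr rfl fun z hz => ?_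
    rw [if_pos (toRd_mem_cube.2 hz)]
    refine Finset.sum_congr rfl fun b _ => ?_
    congr 2
    beta_reduce
    rw [toRd_add, map_add]; abel
  · intro z hz
    rw [if_neg (fun h => hz (toRd_mem_cube.1 h))]

/-- points of the box at distance more than `R` from the complement -/
def Deep (E0 : Finset (Zd d)) (r : ℕ) (z : Zd d) : Prop :=
  ∀ j, irange d E0 < (z j : ℝ) ∧ irange d E0 < (r : ℝ) - z j

lemma irange_nonneg (E0 : Finset (Zd d)) : 0 ≤ irange d E0 :=
  le_trans (by positivity) (le_max_left _ _)

lemma norm_le_irange {E0 : Finset (Zd d)} {b : Zd d} (hb : b ∈ E0) : ‖toRd b‖ ≤ irange d E0 := by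
  refine le_trans (le_csSup ?_ ?_) (le_max_right _ _)
  · exact (E0.finite_toSet.image _).bddAbove
  · exact ⟨b, hb, rfl⟩

lemma Deep.mem_bx {E0 : Finset (Zd d)} {r : ℕ} {z : Zd d} (h : Deep E0 r z) : z ∈ bx d r := by
  rw [StochHom.mem_bx]
  intro j
  have h0 := irange_nonneg E0
  obtain ⟨h1, h2⟩ := h j
  constructor
  · have : (0:ℝ) < z j := by linarith
    exact le_of_lt (by exact_mod_cast this)
  · have : (z j : ℝ) < r := by linarith
    exact_mod_cast this

lemma Deep.sub_mem {E0 : Finset (Zd d)} {r : ℕ} {z b : Zd d} (hb : b ∈ E0)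
    (h : Deep E0 r (z + b)) : z ∈ bx d r := by
  rw [StochHom.mem_bx]
  intro j
  obtain ⟨h1, h2⟩ := h j
  have h3 : |toRd b j| ≤ irange d E0 := (abs_coord_le _ _).trans (norm_le_irange hb)
  rw [toRd_apply] at h3
  have h4 := abs_le.1 h3
  simp only [Pi.add_apply, Int.cast_add] at h1 h2
  constructor
  · have : (0:ℝ) < z j := by linarith [h4.2]
    exact le_of_lt (by exact_mod_cast this)
  · have : (z j : ℝ) < r := by linarith [h4.1]
    exact_mod_cast this

lemma infDist_le_iff (hd : 0 < d) (E0 : Finset (Zd d)) (r : ℕ) (z : Zd d) :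
    infDist (toRd z) (cube d r)ᶜ ≤ irange d E0 ↔ ¬ Deep E0 r z := by
  set R := irange d E0 with hR
  have hR0 : 0 ≤ R := irange_nonneg E0
  constructor
  · intro h hdeep
    have hz := hdeep.mem_bx
    -- minimal distance
    obtain ⟨j0, -, hj0⟩ := Finset.exists_min_image (Finset.univ : Finset (Fin d))
      (fun j => min (z j : ℝ) ((r:ℝ) - z j)) ⟨⟨0, hd⟩, Finset.mem_univ _⟩
    have hne : ((cube d r)ᶜ).Nonempty := by
      refine ⟨toRd (fun _ => -1), fun hh => ?_⟩
      have := (hh ⟨0, hd⟩).1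
      simp at this
      linarith
    have hlow : min (z j0 : ℝ) ((r:ℝ) - z j0) ≤ infDist (toRd z) (cube d r)ᶜ := by
      rw [le_infDist hne]
      intro y hy
      have : ∃ j, ¬ (0 ≤ y j ∧ y j < r) := by
        by_contra hcon; push Not at hcon
        exact hy (fun j => hcon j)
      obtain ⟨j, hj⟩ := this
      have h1 : |(toRd z - y) j| ≤ dist (toRd z) y := by
        rw [dist_eq_norm]; exact abs_coord_le _ _
      have h2 := hj0 j (Finset.mem_univ _)
      have h3 : (toRd z - y) j = (z j : ℝ) - y j := by simp
      rw [h3] at h1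
      have h4 := abs_le.1 h1
      by_cases h0 : 0 ≤ y j
      · have h5 : (r:ℝ) ≤ y j := by
          by_contra hc; exact hj ⟨h0, not_le.1 hc⟩
        have := min_le_right (z j : ℝ) ((r:ℝ) - z j)
        linarith [h4.1]
      · push Not at h0
        have := min_le_left (z j : ℝ) ((r:ℝ) - z j)
        linarith [h4.2]
    have := lt_min (hdeep j0).1 (hdeep j0).2
    linarith
  · intro h
    unfold Deep at h
    push Not at h
    obtain ⟨j, hj⟩ := h
    by_cases hzj : (z j : ℝ) ≤ R
    · refine le_of_forall_pos_le_add fun ε hε => ?_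
      set t : ℝ := max (z j : ℝ) 0 + ε with ht
      set y : Rd d := toRd z - EuclideanSpace.single j t with hy
      have hyc : y ∈ (cube d r)ᶜ := by
        intro hh
        have := (hh j).1
        simp [hy] at this
        have h2 := le_max_left (z j : ℝ) 0
        linarith
      refine (infDist_le_dist_of_mem hyc).trans ?_
      rw [dist_eq_norm, hy]
      simp only [sub_sub_cancel, EuclideanSpace.norm_single, Real.norm_eq_abs]
      have h2 := le_max_right (z j : ℝ) 0
      rw [abs_of_nonneg (by linarith)]
      have : max (z j : ℝ) 0 ≤ R := max_le hzj hR0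
      linarith
    · push Not at hzj
      have h2 := hj hzj
      set t : ℝ := max ((r:ℝ) - z j) 0 with ht
      set y : Rd d := toRd z + EuclideanSpace.single j t with hy
      have hyc : y ∈ (cube d r)ᶜ := by
        intro hh
        have := (hh j).2
        simp [hy] at this
        have h2 := le_max_left ((r:ℝ) - z j) 0
        linarith
      refine (infDist_le_dist_of_mem hyc).trans ?_
      rw [dist_eq_norm, hy]
      simp only [sub_add_cancel_left, norm_neg, EuclideanSpace.norm_single, Real.norm_eq_abs]
      rw [abs_of_nonneg (le_max_right _ _)]
      exact max_le h2 hR0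

/-- All hypotheses which are used, bundled. -/
structure Hyp (P : Measure Ω) (τ : Zd d → Ω → Ω) (E0 : Finset (Zd d)) (p c₁ : ℝ)
    (V : Zd d → Ω → Rn n → ℝ) (lam : Zd d → Ω → ℝ) : Prop where
  hd : 0 < d
  prob : IsProbabilityMeasure P
  τ0 : τ 0 = id
  τadd : ∀ x y : Zd d, τ (x + y) = τ x ∘ τ y
  τmp : ∀ z : Zd d, MeasurePreserving (τ z) P P
  erg : ∀ B : Set Ω, MeasurableSet B → (∀ z : Zd d, τ z ⁻¹' B = B) → P B = 0 ∨ P B = 1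
  E00 : (0 : Zd d) ∉ E0
  E0b : ∀ i : Fin d, stdb i ∈ E0
  hp : 1 < p
  hc₁ : 0 < c₁
  Vmeas : ∀ b ∈ E0, Measurable fun q : Ω × Rn n => V b q.1 q.2
  Vcont : ∀ b ∈ E0, ∀ ω : Ω, Continuous (V b ω)
  Vnn : ∀ b ∈ E0, ∀ (ω : Ω) (r : Rn n), 0 ≤ V b ω r
  lammeas : ∀ b ∈ E0, Measurable (lam b)
  lamnn : ∀ b ∈ E0, ∀ ω : Ω, 0 ≤ lam b ω
  lo : ∀ b ∈ E0, ∀ (ω : Ω) (r : Rn n), lam b ω * (‖r‖ ^ p / c₁ - c₁) ≤ V b ω r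
  hi : ∀ b ∈ E0, ∀ (ω : Ω) (r : Rn n), V b ω r ≤ c₁ * (1 + lam b ω * (‖r‖ ^ p + 1))
  lamint : ∀ b ∈ E0, Integrable (lam b) P
  muint : ∀ i : Fin d, Integrable (fun ω => (lam (stdb i) ω) ^ (-(1 / (p - 1)))) P
  lampos : ∀ i : Fin d, ∀ᵐ ω ∂P, 0 < lam (stdb i) ω

section
variable {P : Measure Ω} {τ : Zd d → Ω → Ω} {E0 : Finset (Zd d)} {p c₁ : ℝ}
    {V : Zd d → Ω → Rn n → ℝ} {lam : Zd d → Ω → ℝ}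

lemma Hyp.τadd' (H : Hyp P τ E0 p c₁ V lam) (x y : Zd d) (ω : Ω) :
    τ (x + y) ω = τ x (τ y ω) := by rw [H.τadd]; rfl

lemma Hyp.one_le_norm (H : Hyp P τ E0 p c₁ V lam) {b : Zd d} (hb : b ∈ E0) : 1 ≤ ‖toRd b‖ :=
  one_le_norm_toRd (fun h => H.E00 (h ▸ hb))

lemma Hyp.en_nonneg (H : Hyp P τ E0 p c₁ V lam) (ω : Ω) (G : Rd d →L[ℝ] Rn n) (φ : Zd d → Rn n)
    (r : ℕ) : 0 ≤ en τ E0 V ω G φ r :=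
  Finset.sum_nonneg fun _ _ => Finset.sum_nonneg fun b hb => H.Vnn b hb _ _

lemma Hyp.mF_eq (H : Hyp P τ E0 p c₁ V lam) (ω : Ω) (G : Rd d →L[ℝ] Rn n) (r : ℕ) :
    mF τ E0 V ω G (cube d r) =
      ⨅ φ : {φ : Zd d → Rn n // ∀ z : Zd d, infDist (toRd z) (cube d r)ᶜ ≤ irange d E0 → φ z = 0},
        en τ E0 V ω G φ.1 r := by
  unfold mF
  simp_rw [energy1_cube]

lemma Hyp.bdd (H : Hyp P τ E0 p c₁ V lam) {ι : Type*} (f : ι → Zd d → Rn n)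
    (ω : Ω) (G : Rd d →L[ℝ] Rn n) (r : ℕ) :
    BddBelow (range fun i => en τ E0 V ω G (f i) r) :=
  ⟨0, by rintro _ ⟨φ, rfl⟩; exact H.en_nonneg _ _ _ _⟩

lemma Hyp.mF_le (H : Hyp P τ E0 p c₁ V lam) (ω : Ω) (G : Rd d →L[ℝ] Rn n) (r : ℕ)
    (φ : Zd d → Rn n) (hφ : ∀ z, ¬ Deep E0 r z → φ z = 0) :
    mF τ E0 V ω G (cube d r) ≤ en τ E0 V ω G φ r := by
  rw [H.mF_eq]
  exact ciInf_le (H.bdd (fun φ : {φ : Zd d → Rn n //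
    ∀ z : Zd d, infDist (toRd z) (cube d r)ᶜ ≤ irange d E0 → φ z = 0} => φ.1) ω G r)
    ⟨φ, fun z hz => hφ z ((infDist_le_iff H.hd E0 r z).1 hz)⟩

lemma Hyp.mF_exists (H : Hyp P τ E0 p c₁ V lam) (ω : Ω) (G : Rd d →L[ℝ] Rn n) (r : ℕ)
    {ε : ℝ} (hε : 0 < ε) :
    ∃ φ : Zd d → Rn n, (∀ z, ¬ Deep E0 r z → φ z = 0) ∧
      en τ E0 V ω G φ r < mF τ E0 V ω G (cube d r) + ε := by
  have : Nonempty {φ : Zd d → Rn n //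
    ∀ z : Zd d, infDist (toRd z) (cube d r)ᶜ ≤ irange d E0 → φ z = 0} := ⟨⟨0, fun _ _ => rfl⟩⟩
  obtain ⟨φ, hφ⟩ := exists_lt_of_ciInf_lt (lt_of_eq_of_lt (H.mF_eq ω G r).symm
    (lt_add_of_pos_right (mF τ E0 V ω G (cube d r)) hε))
  exact ⟨φ.1, fun z hz => φ.2 z ((infDist_le_iff H.hd E0 r z).2 hz), hφ⟩

lemma Hyp.mF_nonneg (H : Hyp P τ E0 p c₁ V lam) (ω : Ω) (G : Rd d →L[ℝ] Rn n) (r : ℕ) :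
    0 ≤ mF τ E0 V ω G (cube d r) := by
  rw [H.mF_eq]
  exact Real.iInf_nonneg fun φ => H.en_nonneg _ _ _ _

lemma sep_subtype (q : (Zd d → Rn n) → Prop) :
    TopologicalSpace.SeparableSpace {φ : Zd d → Rn n // q φ} := by
  have : Countable (Zd d) := inferInstance
  have h2 : SecondCountableTopology (Zd d → Rn n) := inferInstance
  have h3 : SecondCountableTopology {φ : Zd d → Rn n // q φ} :=
    TopologicalSpace.Subtype.secondCountableTopology _
  infer_instance

lemma measurable_iInf_cont {X : Type*} [TopologicalSpace X] [TopologicalSpace.SeparableSpace X]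
    [Nonempty X] (g : Ω → X → ℝ) (h0 : ∀ ω x, 0 ≤ g ω x) (hm : ∀ x, Measurable fun ω => g ω x)
    (hc : ∀ ω, Continuous (g ω)) : Measurable fun ω => ⨅ x, g ω x := by
  have hb : ∀ ω, BddBelow (range (g ω)) := fun ω => ⟨0, by rintro _ ⟨x, rfl⟩; exact h0 ω x⟩
  have : (fun ω => ⨅ x, g ω x) =
      fun ω => ⨅ i : ℕ, g ω (TopologicalSpace.denseSeq X i) := by
    funext ω
    apply le_antisymm
    · refine le_ciInf fun i => ciInf_le (hb ω) _
    · refine le_ciInf fun x => ?_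
      have hb2 : BddBelow (range fun i : ℕ => g ω (TopologicalSpace.denseSeq X i)) :=
        ⟨0, by rintro _ ⟨x, rfl⟩; exact h0 ω _⟩
      have hcl : IsClosed {x | ⨅ i : ℕ, g ω (TopologicalSpace.denseSeq X i) ≤ g ω x} :=
        isClosed_le continuous_const (hc ω)
      have : closure (range (TopologicalSpace.denseSeq X)) ⊆
          {x | ⨅ i : ℕ, g ω (TopologicalSpace.denseSeq X i) ≤ g ω x} := by
        refine closure_minimal ?_ hcl
        rintro _ ⟨i, rfl⟩
        exact ciInf_le hb2 i
      exact this ((TopologicalSpace.denseRange_denseSeq X) x)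
  rw [this]
  exact Measurable.iInf fun i => hm _

lemma Hyp.en_meas (H : Hyp P τ E0 p c₁ V lam) (G : Rd d →L[ℝ] Rn n) (φ : Zd d → Rn n) (r : ℕ) :
    Measurable fun ω => en τ E0 V ω G φ r := by
  unfold en
  refine Finset.measurable_sum _ fun z _ => Finset.measurable_sum _ fun b hb => ?_
  exact (H.Vmeas b hb).comp ((H.τmp z).measurable.prodMk measurable_const)

lemma Hyp.en_cont (H : Hyp P τ E0 p c₁ V lam) (ω : Ω) (G : Rd d →L[ℝ] Rn n) (r : ℕ) :
    Continuous fun φ : Zd d → Rn n => en τ E0 V ω G φ r := by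
  unfold en
  refine continuous_finsetSum _ fun z _ => continuous_finsetSum _ fun b hb => ?_
  exact (H.Vcont b hb _).comp (by fun_prop)

lemma Hyp.mF_meas (H : Hyp P τ E0 p c₁ V lam) (G : Rd d →L[ℝ] Rn n) (r : ℕ) :
    Measurable fun ω => mF τ E0 V ω G (cube d r) := by
  simp_rw [H.mF_eq]
  have : Nonempty {φ : Zd d → Rn n //
    ∀ z : Zd d, infDist (toRd z) (cube d r)ᶜ ≤ irange d E0 → φ z = 0} := ⟨⟨0, fun _ _ => rfl⟩⟩
  have := sep_subtype (d := d) (n := n)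
  exact measurable_iInf_cont _ (fun ω φ => H.en_nonneg _ _ _ _) (fun φ => H.en_meas _ _ _)
    (fun ω => (H.en_cont ω G r).comp continuous_subtype_val)

/-- upper bound of one interaction -/
lemma Hyp.V_le (H : Hyp P τ E0 p c₁ V lam) {b : Zd d} (hb : b ∈ E0) (ω : Ω) (x : Rn n) {t : ℝ}
    (ht : ‖x‖ ≤ t) :
    V b ω ((‖toRd b‖)⁻¹ • x) ≤ c₁ * (1 + lam b ω * (t ^ p + 1)) := by
  refine (H.hi b hb _ _).trans ?_
  have h1 := H.one_le_norm hb
  have h2 : ‖(‖toRd b‖)⁻¹ • x‖ ≤ t := by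
    rw [norm_smul, norm_inv, norm_norm]
    have : (‖toRd b‖)⁻¹ ≤ 1 := inv_le_one_of_one_le₀ h1
    nlinarith [norm_nonneg x]
  have h3 : ‖(‖toRd b‖)⁻¹ • x‖ ^ p ≤ t ^ p :=
    Real.rpow_le_rpow (norm_nonneg _) h2 (by linarith [H.hp])
  have h4 := H.lamnn b hb ω
  have h5 := H.hc₁
  gcongr

lemma Hyp.lam_int' (H : Hyp P τ E0 p c₁ V lam) {b : Zd d} (hb : b ∈ E0) (z : Zd d) :
    Integrable (fun ω => lam b (τ z ω)) P :=
  (H.τmp z).integrable_comp_of_integrable (H.lamint b hb)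

lemma Hyp.int_comp (H : Hyp P τ E0 p c₁ V lam) (g : Ω → ℝ) (hg : AEStronglyMeasurable g P)
    (z : Zd d) : ∫ ω, g (τ z ω) ∂P = ∫ ω, g ω ∂P := by
  have h := integral_map (μ := P) (H.τmp z).measurable.aemeasurable (f := g)
    (by rw [(H.τmp z).map_eq]; exact hg)
  rw [(H.τmp z).map_eq] at h
  exact h.symm

/-- A common upper bound for the means of all weights. -/
def Lbd (P : Measure Ω) (E0 : Finset (Zd d)) (lam : Zd d → Ω → ℝ) : ℝ :=
  1 + ∑ b ∈ E0, ∫ ω, lam b ω ∂P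

lemma Hyp.le_Lbd (H : Hyp P τ E0 p c₁ V lam) {b : Zd d} (hb : b ∈ E0) :
    ∫ ω, lam b ω ∂P ≤ Lbd P E0 lam := by
  unfold Lbd
  have := Finset.single_le_sum (f := fun b => ∫ ω, lam b ω ∂P)
    (fun b hb => integral_nonneg (H.lamnn b hb)) hb
  linarith

lemma Hyp.one_le_Lbd (H : Hyp P τ E0 p c₁ V lam) : 1 ≤ Lbd P E0 lam := by
  unfold Lbd
  have : 0 ≤ ∑ b ∈ E0, ∫ ω, lam b ω ∂P :=
    Finset.sum_nonneg (fun b hb => integral_nonneg (μ := P) (H.lamnn b hb))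
  linarith

lemma Hyp.V_int (H : Hyp P τ E0 p c₁ V lam) {b : Zd d} (hb : b ∈ E0) (z : Zd d) (x : Rn n) :
    Integrable (fun ω => V b (τ z ω) x) P := by
  have := H.prob
  have hi : Integrable (fun ω => c₁ * (1 + lam b (τ z ω) * (‖x‖ ^ p + 1))) P :=
    (((integrable_const 1).add ((H.lam_int' hb z).mul_const _)).const_mul _)
  refine hi.mono' ?_ ?_
  · exact ((H.Vmeas b hb).comp ((H.τmp z).measurable.prodMk measurable_const)).aestronglyMeasurable
  · refine Filter.Eventually.of_forall fun ω => ?_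
    rw [Real.norm_eq_abs, abs_of_nonneg (H.Vnn b hb _ _)]
    exact H.hi b hb _ _

lemma Hyp.EV_le (H : Hyp P τ E0 p c₁ V lam) {b : Zd d} (hb : b ∈ E0) (z : Zd d) (x : Rn n) {t : ℝ}
    (ht : ‖x‖ ≤ t) :
    ∫ ω, V b (τ z ω) ((‖toRd b‖)⁻¹ • x) ∂P ≤ c₁ * (1 + Lbd P E0 lam * (t ^ p + 1)) := by
  have := H.prob
  have hi : Integrable (fun ω => c₁ * (1 + lam b (τ z ω) * (t ^ p + 1))) P :=
    (((integrable_const 1).add ((H.lam_int' hb z).mul_const _)).const_mul _)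
  have h1 := integral_mono (H.V_int hb z _) hi (fun ω => H.V_le hb (τ z ω) x ht)
  refine h1.trans ?_
  rw [integral_const_mul, integral_add (integrable_const _) ((H.lam_int' hb z).mul_const _),
    integral_mul_const, H.int_comp (lam b) (H.lamint b hb).aestronglyMeasurable z]
  simp only [integral_const, probReal_univ, smul_eq_mul, mul_one]
  have ht0 : 0 ≤ t := (norm_nonneg x).trans ht
  have : 0 ≤ t ^ p := Real.rpow_nonneg ht0 p
  have h3 := H.le_Lbd hb
  have := H.hc₁
  gcongr

lemma Hyp.en_int (H : Hyp P τ E0 p c₁ V lam) (G : Rd d →L[ℝ] Rn n) (φ : Zd d → Rn n) (r : ℕ) :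
    Integrable (fun ω => en τ E0 V ω G φ r) P := by
  unfold en
  exact integrable_finsetSum _ fun z _ => integrable_finsetSum _ fun b hb => H.V_int hb z _

lemma Hyp.mF_int (H : Hyp P τ E0 p c₁ V lam) (G : Rd d →L[ℝ] Rn n) (r : ℕ) :
    Integrable (fun ω => mF τ E0 V ω G (cube d r)) P := by
  refine (H.en_int G 0 r).mono' (H.mF_meas G r).aestronglyMeasurable ?_
  refine Filter.Eventually.of_forall fun ω => ?_
  rw [Real.norm_eq_abs, abs_of_nonneg (H.mF_nonneg _ _ _)]
  exact H.mF_le ω G r 0 (fun _ _ => rfl)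

lemma Hyp.W0_le (H : Hyp P τ E0 p c₁ V lam) (G : Rd d →L[ℝ] Rn n) {r : ℕ} (hr : 0 < r) :
    W0 P τ E0 V G ≤ ((r:ℝ) ^ d)⁻¹ * ∫ ω, mF τ E0 V ω G (cube d r) ∂P := by
  unfold W0
  refine ciInf_le (f := fun k : {k : ℕ // 0 < k} =>
    (((k : ℕ) : ℝ) ^ d)⁻¹ * ∫ ω, mF τ E0 V ω G (cube d k) ∂P) ?_ ⟨r, hr⟩
  refine ⟨0, ?_⟩
  rintro _ ⟨k, rfl⟩
  have : 0 ≤ ∫ ω, mF τ E0 V ω G (cube d k) ∂P := integral_nonneg (fun ω => H.mF_nonneg ω G k.1)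
  beta_reduce
  positivity

lemma Hyp.W0_exists (H : Hyp P τ E0 p c₁ V lam) (G : Rd d →L[ℝ] Rn n) {ε : ℝ} (hε : 0 < ε) :
    ∃ r : ℕ, 0 < r ∧ ((r:ℝ) ^ d)⁻¹ * ∫ ω, mF τ E0 V ω G (cube d r) ∂P < W0 P τ E0 V G + ε := by
  have : Nonempty {k : ℕ // 0 < k} := ⟨⟨1, one_pos⟩⟩
  obtain ⟨k, hk⟩ := exists_lt_of_ciInf_lt (lt_add_of_pos_right (W0 P τ E0 V G) hε)
  exact ⟨k.1, k.2, hk⟩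

lemma Hyp.W0_nonneg (H : Hyp P τ E0 p c₁ V lam) (G : Rd d →L[ℝ] Rn n) : 0 ≤ W0 P τ E0 V G := by
  unfold W0
  refine Real.iInf_nonneg fun k => ?_
  have : 0 ≤ ∫ ω, mF τ E0 V ω G (cube d k) ∂P := integral_nonneg (fun ω => H.mF_nonneg ω G k.1)
  positivity

lemma Hyp.Wper_eq (H : Hyp P τ E0 p c₁ V lam) (ω : Ω) (G : Rd d →L[ℝ] Rn n) (k : ℕ) :
    Wper τ E0 V k ω G =
      ⨅ φ : {φ : Zd d → Rn n // ∀ z z' : Zd d, φ (z + k • z') = φ z},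
        ((k : ℝ) ^ d)⁻¹ * en τ E0 V ω G φ.1 k := by
  unfold Wper
  simp_rw [energy1_cube]

lemma Hyp.Wper_meas (H : Hyp P τ E0 p c₁ V lam) (G : Rd d →L[ℝ] Rn n) (k : ℕ) :
    Measurable fun ω => Wper τ E0 V k ω G := by
  simp_rw [H.Wper_eq]
  have : Nonempty {φ : Zd d → Rn n // ∀ z z' : Zd d, φ (z + k • z') = φ z} :=
    ⟨⟨0, fun _ _ => rfl⟩⟩
  have := sep_subtype (d := d) (n := n)
  exact measurable_iInf_cont _ (fun ω φ => mul_nonneg (by positivity) (H.en_nonneg _ _ _ _))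
    (fun φ => (H.en_meas _ _ _).const_mul _)
    (fun ω => continuous_const.mul ((H.en_cont ω G k).comp continuous_subtype_val))

lemma Hyp.Wper_nonneg (H : Hyp P τ E0 p c₁ V lam) (ω : Ω) (G : Rd d →L[ℝ] Rn n) (k : ℕ) :
    0 ≤ Wper τ E0 V k ω G := by
  rw [H.Wper_eq]
  exact Real.iInf_nonneg fun φ => mul_nonneg (by positivity) (H.en_nonneg _ _ _ _)

lemma Hyp.Wper_le (H : Hyp P τ E0 p c₁ V lam) (ω : Ω) (G : Rd d →L[ℝ] Rn n) (k : ℕ)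
    (φ : Zd d → Rn n) (hφ : ∀ z z' : Zd d, φ (z + k • z') = φ z) :
    Wper τ E0 V k ω G ≤ ((k : ℝ) ^ d)⁻¹ * en τ E0 V ω G φ k := by
  rw [H.Wper_eq]
  refine ciInf_le (f := fun φ : {φ : Zd d → Rn n // ∀ z z' : Zd d, φ (z + k • z') = φ z} =>
        ((k : ℝ) ^ d)⁻¹ * en τ E0 V ω G φ.1 k) ?_ ⟨φ, hφ⟩
  exact ⟨0, by rintro _ ⟨φ, rfl⟩; exact mul_nonneg (by positivity) (H.en_nonneg _ _ _ _)⟩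

lemma Hyp.le_Wper (H : Hyp P τ E0 p c₁ V lam) (ω : Ω) (G : Rd d →L[ℝ] Rn n) (k : ℕ) (t : ℝ)
    (h : ∀ φ : Zd d → Rn n, (∀ z z' : Zd d, φ (z + k • z') = φ z) →
      t ≤ ((k : ℝ) ^ d)⁻¹ * en τ E0 V ω G φ k) : t ≤ Wper τ E0 V k ω G := by
  rw [H.Wper_eq]
  have : Nonempty {φ : Zd d → Rn n // ∀ z z' : Zd d, φ (z + k • z') = φ z} :=
    ⟨⟨0, fun _ _ => rfl⟩⟩
  exact le_ciInf fun φ => h φ.1 φ.2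

lemma Hyp.Wper_int (H : Hyp P τ E0 p c₁ V lam) (G : Rd d →L[ℝ] Rn n) (k : ℕ) :
    Integrable (fun ω => Wper τ E0 V k ω G) P := by
  refine ((H.en_int G 0 k).const_mul ((k:ℝ)^d)⁻¹).mono' (H.Wper_meas G k).aestronglyMeasurable ?_
  refine Filter.Eventually.of_forall fun ω => ?_
  rw [Real.norm_eq_abs, abs_of_nonneg (H.Wper_nonneg _ _ _)]
  exact H.Wper_le ω G k 0 (fun _ _ => rfl)

end


/-- the inner box -/
def inn (d r h : ℕ) : Finset (Zd d) := Fintype.piFinset fun _ => Finset.Ico (h:ℤ) ((r:ℤ) - h)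

lemma mem_inn {r h : ℕ} {z : Zd d} : z ∈ inn d r h ↔ ∀ j, (h:ℤ) ≤ z j ∧ z j < r - h := by
  simp [inn, Fintype.mem_piFinset]

lemma card_inn (d r h : ℕ) : (inn d r h).card = (r - 2 * h) ^ d := by
  simp only [inn, Fintype.card_piFinset, Int.card_Ico, Finset.prod_const, Finset.card_univ,
    Fintype.card_fin]
  congr 1
  omega

lemma inn_subset (d r h : ℕ) : inn d r h ⊆ bx d r := by
  intro z hz
  rw [mem_inn] at hz
  rw [mem_bx]
  intro j
  have := hz j
  omega

/-- `r^d - (r - 2 h)^d` as a real number -/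
lemma card_layer (d r h : ℕ) :
    ((bx d r \ inn d r h).card : ℝ) = (r:ℝ) ^ d - ((r - 2 * h : ℕ) : ℝ) ^ d := by
  rw [Finset.card_sdiff_of_subset (inn_subset d r h), card_bx, card_inn, Nat.cast_sub]
  · push_cast; ring
  · exact Nat.pow_le_pow_left (Nat.sub_le _ _) _

lemma layer_le (d r h : ℕ) : (r:ℝ) ^ d - ((r - 2 * h : ℕ) : ℝ) ^ d ≤ d * (2 * h) * (r:ℝ) ^ (d - 1) := by
  set a : ℝ := ((r - 2 * h : ℕ) : ℝ) with ha
  have ha0 : 0 ≤ a := Nat.cast_nonneg _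
  have har : a ≤ r := by rw [ha]; exact_mod_cast Nat.sub_le _ _
  have har2 : (r:ℝ) - a ≤ 2 * h := by
    have : r ≤ (r - 2 * h) + 2 * h := by omega
    have h2 : (r:ℝ) ≤ a + 2 * h := by rw [ha]; exact_mod_cast this
    linarith
  have h1 : (r:ℝ) ^ d - a ^ d = (∑ i ∈ Finset.range d, (r:ℝ) ^ i * a ^ (d - 1 - i)) * (r - a) :=
    (geom_sum₂_mul (r:ℝ) a d).symm
  have h2 : ∑ i ∈ Finset.range d, (r:ℝ) ^ i * a ^ (d - 1 - i) ≤ d * (r:ℝ) ^ (d - 1) := by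
    calc _ ≤ ∑ i ∈ Finset.range d, (r:ℝ) ^ (d - 1) := by
          refine Finset.sum_le_sum fun i hi => ?_
          have hi' := Finset.mem_range.1 hi
          calc (r:ℝ) ^ i * a ^ (d - 1 - i) ≤ (r:ℝ) ^ i * (r:ℝ) ^ (d - 1 - i) := by gcongr
            _ = (r:ℝ) ^ (d - 1) := by rw [← pow_add]; congr 1; omega
      _ = _ := by simp
  rw [h1]
  have h3 : 0 ≤ (r:ℝ) ^ (d - 1) := by positivity
  calc _ ≤ (d * (r:ℝ) ^ (d - 1)) * (2 * h) := by
        apply mul_le_mul h2 har2 (by linarith) (by positivity)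
    _ = _ := by ring

lemma layer_tendsto (d h : ℕ) (hd : 0 < d) :
    Tendsto (fun r : ℕ => ((r:ℝ) ^ d)⁻¹ * ((bx d r \ inn d r h).card : ℝ)) atTop (𝓝 0) := by
  have h1 : Tendsto (fun r : ℕ => (d * (2 * h) : ℝ) * ((r:ℝ))⁻¹) atTop (𝓝 ((d * (2 * h)) * 0)) :=
    (tendsto_inv_atTop_zero.comp tendsto_natCast_atTop_atTop).const_mul _
  rw [mul_zero] at h1
  refine squeeze_zero' (Eventually.of_forall fun r => by positivity) ?_ h1
  filter_upwards [eventually_gt_atTop 0] with r hr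
  have hr' : (0:ℝ) < r := by exact_mod_cast hr
  rw [card_layer]
  calc ((r:ℝ) ^ d)⁻¹ * ((r:ℝ) ^ d - ((r - 2 * h : ℕ) : ℝ) ^ d)
      ≤ ((r:ℝ) ^ d)⁻¹ * (d * (2 * h) * (r:ℝ) ^ (d - 1)) := by
        gcongr; exact layer_le d r h
    _ = _ := by
        obtain ⟨e, rfl⟩ : ∃ e, d = e + 1 := ⟨d - 1, by omega⟩
        simp only [add_tsub_cancel_right]
        field_simp
        ring

lemma exists_abs_le (y : Zd d) : ∃ h : ℕ, ∀ j, |y j| ≤ h := by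
  refine ⟨∑ j, (y j).natAbs, fun j => ?_⟩
  rw [Int.abs_eq_natAbs]
  exact_mod_cast Finset.single_le_sum (f := fun j => (y j).natAbs) (fun _ _ => Nat.zero_le _)
    (Finset.mem_univ j)

/-- sums over a box and a shifted box differ only by boundary terms -/
lemma norm_sum_shift_sub_le {X : Type*} [NormedAddCommGroup X] (f : Zd d → X) {C : ℝ}
    (y : Zd d) {h : ℕ} (hy : ∀ j, |y j| ≤ h) (r : ℕ) (hf : ∀ z, ‖f z‖ ≤ C) :
    ‖∑ z ∈ bx d r, (f z - f (z + y))‖ ≤ 2 * C * ((bx d r \ inn d r h).card : ℝ) := by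
  have hC : 0 ≤ C := (norm_nonneg _).trans (hf 0)
  have e1 : ∑ z ∈ bx d r, f (z + y) = ∑ z ∈ (bx d r).map (addRightEmbedding y), f z := by
    rw [Finset.sum_map]; rfl
  rw [Finset.sum_sub_distrib, e1]
  have hsub1 : inn d r h ⊆ bx d r := inn_subset _ _ _
  have hsub2 : inn d r h ⊆ (bx d r).map (addRightEmbedding y) := by
    intro z hz
    rw [Finset.mem_map]
    refine ⟨z - y, ?_, by simp⟩
    rw [mem_inn] at hz
    rw [mem_bx]
    intro j
    have h1 := hz j
    have h2 := abs_le.1 (hy j)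
    simp only [Pi.sub_apply]
    constructor <;> linarith
  rw [← Finset.sum_sdiff hsub1, ← Finset.sum_sdiff hsub2, add_sub_add_right_eq_sub]
  have hc : (((bx d r).map (addRightEmbedding y)) \ inn d r h).card = (bx d r \ inn d r h).card := by
    rw [Finset.card_sdiff_of_subset hsub1, Finset.card_sdiff_of_subset hsub2, Finset.card_map]
  have b1 : ‖∑ z ∈ bx d r \ inn d r h, f z‖ ≤ (bx d r \ inn d r h).card * C := by
    refine (norm_sum_le _ _).trans ?_
    refine (Finset.sum_le_card_nsmul _ _ C fun z _ => hf z).trans ?_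
    simp
  have b2 : ‖∑ z ∈ ((bx d r).map (addRightEmbedding y)) \ inn d r h, f z‖
      ≤ (bx d r \ inn d r h).card * C := by
    refine (norm_sum_le _ _).trans ?_
    refine (Finset.sum_le_card_nsmul _ _ C fun z _ => hf z).trans ?_
    simp [hc]
  refine (norm_sub_le _ _).trans ?_
  linarith

section hilbert
variable {X : Type*} [NormedAddCommGroup X] [InnerProductSpace ℝ X] [CompleteSpace X]

lemma hilbert_mean (hd : 0 < d) (U : Zd d → X →ₗᵢ[ℝ] X)
    (hadd : ∀ x y f, U x (U y f) = U (x + y) f) (e : X) (he : ‖e‖ = 1) (hUe : ∀ z, U z e = e)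
    (hinv : ∀ f, (∀ z, U z f = f) → ∃ a : ℝ, f = a • e) (f : X) :
    Tendsto (fun r : ℕ => ((r:ℝ) ^ d)⁻¹ • ∑ z ∈ bx d r, U z f) atTop (𝓝 ((inner ℝ e f) • e)) := by
  set A : ℕ → X →ₗ[ℝ] X := fun r =>
    ((r:ℝ) ^ d)⁻¹ • ∑ z ∈ bx d r, (U z).toLinearMap with hA
  have hAapp : ∀ r f, A r f = ((r:ℝ) ^ d)⁻¹ • ∑ z ∈ bx d r, U z f := by
    intro r f; simp [hA, LinearMap.sum_apply]
  have hAn : ∀ r f, ‖A r f‖ ≤ ‖f‖ := by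
    intro r f
    rw [hAapp, norm_smul]
    have h1 : ‖∑ z ∈ bx d r, U z f‖ ≤ (r:ℝ) ^ d * ‖f‖ := by
      refine (norm_sum_le _ _).trans ?_
      simp [card_bx]
    rw [norm_inv, norm_pow, Real.norm_natCast]
    rcases Nat.eq_zero_or_pos r with h | h
    · subst h
      rw [CharP.cast_eq_zero, zero_pow hd.ne', inv_zero, zero_mul]; exact norm_nonneg _
    · have : (0:ℝ) < (r:ℝ) ^ d := by positivity
      rw [inv_mul_le_iff₀ this]; exact h1
  set Sm : Submodule ℝ X :=
    { carrier := {f | Tendsto (fun r => A r f) atTop (𝓝 ((inner ℝ e f) • e))}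
      add_mem' := by
        intro a b ha hb
        have := Tendsto.add ha hb
        simp only [mem_ofPred_eq, map_add, inner_add_right, add_smul]
        exact this
      zero_mem' := by simp
      smul_mem' := by
        intro c a ha
        have := Tendsto.const_smul ha c
        simp only [mem_ofPred_eq, map_smul, inner_smul_right, mul_smul]
        exact this } with hSm
  have hmem : ∀ f, f ∈ Sm ↔ Tendsto (fun r => A r f) atTop (𝓝 ((inner ℝ e f) • e)) := by
    intro f; rfl
  have hclosed : IsClosed (Sm : Set X) := by
    rw [← isSeqClosed_iff_isClosed]
    intro x f hx hxf
    change f ∈ Sm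
    rw [hmem, Metric.tendsto_atTop]
    intro ε hε
    obtain ⟨N, hN⟩ := (Metric.tendsto_atTop.1 hxf (ε / 3) (by positivity))
    have hN' := hN N le_rfl
    obtain ⟨M, hM⟩ := Metric.tendsto_atTop.1 ((hmem _).1 (hx N)) (ε / 3) (by positivity)
    refine ⟨M, fun r hr => ?_⟩
    have h1 := hM r hr
    rw [dist_eq_norm] at hN' h1 ⊢
    have e1 : A r f - (inner ℝ e f : ℝ) • e =
        -(A r (x N - f)) + (A r (x N) - (inner ℝ e (x N) : ℝ) • e)
          + (inner ℝ e (x N - f) : ℝ) • e := by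
      rw [map_sub, inner_sub_right, sub_smul]; abel
    rw [e1]
    have h2 : ‖(inner ℝ e (x N - f) : ℝ) • e‖ ≤ ‖x N - f‖ := by
      rw [norm_smul, he, mul_one]
      have := norm_inner_le_norm (𝕜 := ℝ) e (x N - f)
      rwa [he, one_mul] at this
    have h3 := hAn r (x N - f)
    have h4 := norm_add₃_le (a := -(A r (x N - f))) (b := (A r (x N) - (inner ℝ e (x N) : ℝ) • e))
      (c := (inner ℝ e (x N - f) : ℝ) • e)
    rw [norm_neg] at h4
    linarith
  have hone : e ∈ Sm := by
    rw [hmem]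
    have : (inner ℝ e e : ℝ) • e = e := by rw [real_inner_self_eq_norm_sq, he]; simp
    rw [this]
    refine tendsto_const_nhds.congr' ?_
    filter_upwards [eventually_gt_atTop 0] with r hr
    have : ((r:ℝ) ^ d) ≠ 0 := by positivity
    rw [hAapp]
    simp only [hUe, Finset.sum_const, card_bx]
    rw [← Nat.cast_smul_eq_nsmul ℝ, smul_smul]
    push_cast
    rw [inv_mul_cancel₀ this, one_smul]
  have hcob : ∀ g y, g - U y g ∈ Sm := by
    intro g y
    rw [hmem]
    have h0 : (inner ℝ e (g - U y g) : ℝ) = 0 := by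
      rw [inner_sub_right]
      conv_lhs => rw [← hUe y]
      rw [LinearIsometry.inner_map_map, hUe, sub_self]
    rw [h0, zero_smul]
    obtain ⟨h, hy⟩ := exists_abs_le y
    refine squeeze_zero_norm (a := fun r : ℕ =>
      2 * ‖g‖ * (((r:ℝ) ^ d)⁻¹ * ((bx d r \ inn d r h).card : ℝ))) ?_ ?_
    · intro r
      rw [hAapp, norm_smul, norm_inv, norm_pow, Real.norm_natCast]
      have := norm_sum_shift_sub_le (fun z => U z g) y hy r (C := ‖g‖) (fun z => by simp)
      simp only [map_sub, hadd]
      have h2 : 0 ≤ ((r:ℝ) ^ d)⁻¹ := by positivity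
      nlinarith
    · simpa using (layer_tendsto d h hd).const_mul (2 * ‖g‖)
  have htop : Sm = ⊤ := by
    have : CompleteSpace Sm := hclosed.completeSpace_coe
    rw [← Submodule.orthogonal_eq_bot_iff, Submodule.eq_bot_iff]
    intro h hh
    rw [Submodule.mem_orthogonal] at hh
    have hi : ∀ z, U z h = h := by
      intro z
      have h1 := hh _ (hcob h z)
      rw [inner_sub_left, real_inner_self_eq_norm_sq] at h1
      have h2 := norm_sub_sq_real (U z h) h
      rw [(U z).norm_map] at h2
      have h3 : ‖U z h - h‖ ^ 2 = 0 := by rw [h2]; linarith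
      rw [← sub_eq_zero, ← norm_eq_zero]
      exact pow_eq_zero_iff (two_ne_zero) |>.1 h3
    obtain ⟨a, ha⟩ := hinv h hi
    have h1 := hh h (by rw [ha]; exact Sm.smul_mem _ hone)
    exact inner_self_eq_zero.1 h1
  have := (hmem f).1 (htop ▸ Submodule.mem_top)
  simpa only [hAapp] using this
end hilbert

section
variable {P : Measure Ω} {τ : Zd d → Ω → Ω} {E0 : Finset (Zd d)} {p c₁ : ℝ}
    {V : Zd d → Ω → Rn n → ℝ} {lam : Zd d → Ω → ℝ}

lemma Hyp.ae_const (H : Hyp P τ E0 p c₁ V lam) (h : Ω → ℝ) (hm : Measurable h)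
    (hinv : ∀ z, (fun ω => h (τ z ω)) =ᵐ[P] h) : ∃ a : ℝ, h =ᵐ[P] Function.const Ω a := by
  have := H.prob
  refine exists_eventuallyEq_const_of_forall_separating (p := MeasurableSet) ?_
  intro U hU
  set B : Set Ω := ⋂ z, τ z ⁻¹' (h ⁻¹' U) with hB
  have hBm : MeasurableSet B := MeasurableSet.iInter fun z => (H.τmp z).measurable (hm hU)
  have hBi : ∀ w, τ w ⁻¹' B = B := by
    intro w
    ext ω
    simp only [hB, mem_preimage, mem_iInter]
    constructor
    · intro hx z
      have := hx (z - w)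
      rw [← H.τadd'] at this
      simpa using this
    · intro hx z
      rw [← H.τadd']
      exact hx _
  have hBe : ∀ᵐ ω ∂P, (ω ∈ B ↔ h ω ∈ U) := by
    filter_upwards [ae_all_iff.2 hinv] with ω hω
    simp only [hB, mem_preimage, mem_iInter]
    constructor
    · intro hx; have := hx 0; rwa [hω] at this
    · intro hx z; rw [hω]; exact hx
  rcases H.erg B hBm hBi with h0 | h1
  · right
    have : ∀ᵐ ω ∂P, ω ∉ B := measure_eq_zero_iff_ae_notMem.1 h0
    filter_upwards [hBe, this] with ω h1 h2
    rwa [← h1]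
  · left
    have : ∀ᵐ ω ∂P, ω ∈ B := by
      rw [← prob_compl_eq_zero_iff hBm] at h1
      exact (ae_iff).2 h1
    filter_upwards [hBe, this] with ω h1 h2
    rwa [← h1]

/-- box averages -/
def avg (τ : Zd d → Ω → Ω) (g : Ω → ℝ) (r : ℕ) (ω : Ω) : ℝ :=
  ((r:ℝ) ^ d)⁻¹ * ∑ z ∈ bx d r, g (τ z ω)

lemma Hyp.mean_L2 (H : Hyp P τ E0 p c₁ V lam) (g : Ω → ℝ) (hg : MemLp g 2 P) :
    Tendsto (fun r => eLpNorm (fun ω => avg τ g r ω - ∫ x, g x ∂P) 2 P) atTop (𝓝 0) := by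
  have := H.prob
  set U : Zd d → Lp ℝ 2 P →ₗᵢ[ℝ] Lp ℝ 2 P := fun z =>
    Lp.compMeasurePreservingₗᵢ ℝ (τ z) (H.τmp z) with hU
  have hUae : ∀ z (f : Lp ℝ 2 P), U z f =ᵐ[P] fun ω => f (τ z ω) := fun z f =>
    Lp.coeFn_compMeasurePreserving f (H.τmp z)
  set e : Lp ℝ 2 P := Lp.const 2 P (1:ℝ) with he
  have hee : e =ᵐ[P] fun _ => (1:ℝ) := Lp.coeFn_const _ _ _
  have key := hilbert_mean H.hd U ?_ e ?_ ?_ ?_ (hg.toLp g)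
  · have hin : (inner ℝ e (hg.toLp g) : ℝ) = ∫ x, g x ∂P := by
      rw [L2.inner_def]
      refine integral_congr_ae ?_
      filter_upwards [hee, hg.coeFn_toLp] with ω h1 h2
      rw [h1, h2]; simp
    rw [hin, tendsto_iff_norm_sub_tendsto_zero] at key
    have h2 : ∀ r : ℕ, eLpNorm (fun ω => avg τ g r ω - ∫ x, g x ∂P) 2 P =
        ENNReal.ofReal ‖((r:ℝ) ^ d)⁻¹ • ∑ z ∈ bx d r, U z (hg.toLp g) - (∫ x, g x ∂P) • e‖ := by
      intro r
      rw [Lp.norm_def, ENNReal.ofReal_toReal (Lp.eLpNorm_ne_top _)]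
      refine eLpNorm_congr_ae ?_
      have hz : ∀ z, U z (hg.toLp g) =ᵐ[P] fun ω => g (τ z ω) := by
        intro z
        filter_upwards [hUae z (hg.toLp g),
          (H.τmp z).quasiMeasurePreserving.ae_eq_comp hg.coeFn_toLp] with ω h1 h2
        rw [h1]; exact h2
      have hs : ((∑ z ∈ bx d r, U z (hg.toLp g) : Lp ℝ 2 P) : Ω → ℝ) =ᵐ[P]
          fun ω => ∑ z ∈ bx d r, g (τ z ω) := by
        have h3 := Lp.coeFn_finsetSum (bx d r) (fun z => U z (hg.toLp g))
        filter_upwards [h3, ae_all_iff.2 hz] with ω h4 h5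
        rw [h4, Finset.sum_apply]
        exact Finset.sum_congr rfl fun z _ => h5 z
      filter_upwards [Lp.coeFn_sub (((r:ℝ) ^ d)⁻¹ • ∑ z ∈ bx d r, U z (hg.toLp g))
        ((∫ x, g x ∂P) • e), Lp.coeFn_smul (((r:ℝ) ^ d)⁻¹) (∑ z ∈ bx d r, U z (hg.toLp g)),
        Lp.coeFn_smul (∫ x, g x ∂P) e, hs, hee] with ω h1 h2 h3 h4 h5
      rw [h1, Pi.sub_apply, h2, h3, Pi.smul_apply, Pi.smul_apply, h4, h5]
      simp [avg]
    simp_rw [h2]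
    rw [← ENNReal.ofReal_zero]
    exact (ENNReal.continuous_ofReal.tendsto 0).comp key
  · intro x y f
    apply Lp.ext
    filter_upwards [hUae x (U y f), (H.τmp x).quasiMeasurePreserving.ae_eq_comp (hUae y f),
      hUae (x + y) f] with ω h1 h2 h3
    rw [h1, h3]
    simp only [Function.comp_apply] at h2
    rw [h2, add_comm, H.τadd']
  · rw [he]
    have := Lp.norm_const (p := 2) (μ := P) (c := (1:ℝ)) (by norm_num)
    rw [this]; simp
  · intro z
    apply Lp.ext
    filter_upwards [hUae z e, (H.τmp z).quasiMeasurePreserving.ae_eq_comp hee, hee] with ω h1 h2 h3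
    rw [h1, h3]; exact h2
  · intro f hf
    obtain ⟨f', hf'm, hf'⟩ := (Lp.stronglyMeasurable f).aestronglyMeasurable (μ := P)
    obtain ⟨a, ha⟩ := H.ae_const f (Lp.stronglyMeasurable f).measurable (by
      intro z
      have h1 := hUae z f
      rw [hf z] at h1
      exact h1.symm)
    refine ⟨a, Lp.ext ?_⟩
    filter_upwards [ha, Lp.coeFn_smul a e, hee] with ω h1 h2 h3
    rw [h1, h2, Pi.smul_apply, h3]; simp

lemma Hyp.avg_norm_le (H : Hyp P τ E0 p c₁ V lam) (g : Ω → ℝ) (hg : AEStronglyMeasurable g P)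
    (r : ℕ) : eLpNorm (avg τ g r) 1 P ≤ eLpNorm g 1 P := by
  have e1 : avg τ g r = ((r:ℝ) ^ d)⁻¹ • ∑ z ∈ bx d r, (fun ω => g (τ z ω)) := by
    funext ω; simp [avg, Finset.sum_apply]
  rw [e1, eLpNorm_const_smul]
  have hm : ∀ z, AEStronglyMeasurable (fun ω => g (τ z ω)) P := fun z =>
    hg.comp_measurePreserving (H.τmp z)
  have h1 : eLpNorm (∑ z ∈ bx d r, (fun ω => g (τ z ω))) 1 P ≤ (r ^ d : ℕ) * eLpNorm g 1 P := by
    refine (eLpNorm_sum_le (fun z _ => hm z) le_rfl).trans ?_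
    have : ∀ z ∈ bx d r, eLpNorm (fun ω => g (τ z ω)) 1 P = eLpNorm g 1 P := fun z _ =>
      eLpNorm_comp_measurePreserving hg (H.τmp z)
    rw [Finset.sum_congr rfl this]
    simp [card_bx]
  rcases Nat.eq_zero_or_pos r with h | h
  · subst h
    have hd := H.hd.ne'
    simp [hd]
  · calc _ ≤ ‖((r:ℝ) ^ d)⁻¹‖ₑ * ((r ^ d : ℕ) * eLpNorm g 1 P) := by gcongr
      _ = eLpNorm g 1 P := by
        rw [← mul_assoc]
        have h0 : (0:ℝ) < (r:ℝ) ^ d := by positivity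
        have : ‖((r:ℝ) ^ d)⁻¹‖ₑ * ((r ^ d : ℕ) : ℝ≥0∞) = 1 := by
          rw [Real.enorm_eq_ofReal (by positivity), ← ENNReal.ofReal_natCast,
            ← ENNReal.ofReal_mul (by positivity)]
          push_cast
          rw [inv_mul_cancel₀ h0.ne', ENNReal.ofReal_one]
        rw [this, one_mul]

lemma Hyp.avg_meas (H : Hyp P τ E0 p c₁ V lam) (g : Ω → ℝ) (hg : AEStronglyMeasurable g P)
    (r : ℕ) : AEStronglyMeasurable (avg τ g r) P := by
  unfold avg
  refine AEStronglyMeasurable.const_mul ?_ _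
  refine Finset.aestronglyMeasurable_fun_sum _ fun z _ => ?_
  exact hg.comp_measurePreserving (H.τmp z)

lemma Hyp.mean_L1 (H : Hyp P τ E0 p c₁ V lam) (g : Ω → ℝ) (hg : Integrable g P) :
    Tendsto (fun r => eLpNorm (fun ω => avg τ g r ω - ∫ x, g x ∂P) 1 P) atTop (𝓝 0) := by
  have := H.prob
  rw [ENNReal.tendsto_nhds_zero]
  intro ε hε
  have hε3 : ε / 3 ≠ 0 := by simpa using hε.ne'
  obtain ⟨s, hs, hsm⟩ := (memLp_one_iff_integrable.2 hg).exists_simpleFunc_eLpNorm_sub_lt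
    ENNReal.one_ne_top hε3
  have hs2 : MemLp s 2 P := s.memLp_of_isFiniteMeasure 2 P
  have hsi : Integrable s P := memLp_one_iff_integrable.1 hsm
  generalize (s : Ω → ℝ) = s at *
  filter_upwards [(ENNReal.tendsto_nhds_zero.1 (H.mean_L2 s hs2)) (ε / 3)
    (pos_iff_ne_zero.2 hε3)] with r hr
  have e1 : (fun ω => avg τ g r ω - ∫ x, g x ∂P) =
      avg τ (g - s) r + (fun ω => avg τ s r ω - ∫ x, s x ∂P) + fun _ => -∫ x, (g - s) x ∂P := by
    funext ω
    have : ∫ x, (g - s) x ∂P = ∫ x, g x ∂P - ∫ x, s x ∂P := integral_sub hg hsi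
    simp only [Pi.add_apply, this]
    simp only [avg, Pi.sub_apply, Finset.sum_sub_distrib]
    ring
  have hgs : AEStronglyMeasurable (g - s) P := hg.aestronglyMeasurable.sub hsi.aestronglyMeasurable
  have m1 := H.avg_meas (g - s) hgs r
  have m2 : AEStronglyMeasurable (fun ω => avg τ s r ω - ∫ x, s x ∂P) P :=
    (H.avg_meas s hsi.aestronglyMeasurable r).sub aestronglyMeasurable_const
  have m3 : AEStronglyMeasurable (fun _ : Ω => -∫ x, (g - s) x ∂P) P := aestronglyMeasurable_const
  rw [e1]
  refine (eLpNorm_add_le (m1.add m2) m3 le_rfl).trans ?_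
  refine (add_le_add_left (eLpNorm_add_le m1 m2 le_rfl) _).trans ?_
  have b1 : eLpNorm (avg τ (g - s) r) 1 P ≤ ε / 3 := (H.avg_norm_le _ hgs r).trans hs.le
  have b2 : eLpNorm (fun ω => avg τ s r ω - ∫ x, s x ∂P) 1 P ≤ ε / 3 :=
    (eLpNorm_le_eLpNorm_of_exponent_le (by norm_num) m2).trans hr
  have b3 : eLpNorm (fun _ : Ω => -∫ x, (g - s) x ∂P) 1 P ≤ ε / 3 := by
    rw [eLpNorm_const _ one_ne_zero (NeZero.ne P)]
    simp only [enorm_neg, measure_univ, ENNReal.one_rpow, mul_one]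
    refine (enorm_integral_le_lintegral_enorm _).trans ?_
    rw [← eLpNorm_one_eq_lintegral_enorm]
    exact hs.le
  calc _ ≤ ε / 3 + ε / 3 + ε / 3 := by gcongr
    _ = ε := ENNReal.add_thirds ε

lemma Hyp.avg_int (H : Hyp P τ E0 p c₁ V lam) (g : Ω → ℝ) (hg : Integrable g P) (r : ℕ) :
    Integrable (avg τ g r) P := by
  unfold avg
  refine Integrable.const_mul ?_ _
  exact integrable_finsetSum _ fun z _ => (H.τmp z).integrable_comp_of_integrable hg

/-- mean ergodic theorem -/
lemma Hyp.mean (H : Hyp P τ E0 p c₁ V lam) (g : Ω → ℝ) (hg : Integrable g P) :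
    Tendsto (fun r => ∫ ω, |avg τ g r ω - ∫ x, g x ∂P| ∂P) atTop (𝓝 0) := by
  have := H.prob
  have h := H.mean_L1 g hg
  have h2 : ∀ r, ∫ ω, |avg τ g r ω - ∫ x, g x ∂P| ∂P =
      (eLpNorm (fun ω => avg τ g r ω - ∫ x, g x ∂P) 1 P).toReal := by
    intro r
    rw [eLpNorm_one_eq_lintegral_enorm]
    exact integral_norm_eq_lintegral_enorm
      ((H.avg_meas g hg.aestronglyMeasurable r).sub aestronglyMeasurable_const)
  simp_rw [h2]
  exact (ENNReal.tendsto_toReal_zero_iff (fun r => by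
    exact (memLp_one_iff_integrable.2 ((H.avg_int g hg r).sub (integrable_const _))).eLpNorm_ne_top)).2 h

lemma Hyp.mean_prob (H : Hyp P τ E0 p c₁ V lam) (g : Ω → ℝ) (hg : Integrable g P) {ε : ℝ}
    (hε : 0 < ε) :
    Tendsto (fun r => P {ω | ε ≤ |avg τ g r ω - ∫ x, g x ∂P|}) atTop (𝓝 0) := by
  have := H.prob
  have h := H.mean_L1 g hg
  have h2 : ∀ r, P {ω | ε ≤ |avg τ g r ω - ∫ x, g x ∂P|} ≤
      (ENNReal.ofReal ε)⁻¹ * eLpNorm (fun ω => avg τ g r ω - ∫ x, g x ∂P) 1 P := by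
    intro r
    have m := (H.avg_meas g hg.aestronglyMeasurable r).sub
      (aestronglyMeasurable_const (b := ∫ x, g x ∂P))
    have h3 := meas_ge_le_mul_pow_eLpNorm_enorm P (one_ne_zero) ENNReal.one_ne_top m
      (ε := ENNReal.ofReal ε) (by simpa using hε) (by intro h; exact absurd h ENNReal.ofReal_ne_top)
    simp only [ENNReal.toReal_one, ENNReal.rpow_one] at h3
    refine le_trans (measure_mono ?_) h3
    intro ω hω
    simp only [mem_ofPred_eq] at hω ⊢
    rw [← ofReal_norm]
    exact ENNReal.ofReal_le_ofReal hω
  refine tendsto_of_tendsto_of_tendsto_of_le_of_le tendsto_const_nhds ?_ (fun _ => zero_le) h2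
  have := ENNReal.Tendsto.const_mul (a := (ENNReal.ofReal ε)⁻¹) h (Or.inr (by simpa using hε))
  simpa using this
end


/-- the cell `c + [0,m)^d` -/
def cell (m : ℕ) (c : Zd d) : Finset (Zd d) := (bx d m).map (addLeftEmbedding c)

lemma mem_cell {m : ℕ} {c z : Zd d} : z ∈ cell m c ↔ z - c ∈ bx d m := by
  unfold cell
  rw [Finset.mem_map]
  constructor
  · rintro ⟨y, hy, rfl⟩; simpa using hy
  · intro h; exact ⟨z - c, h, by simp⟩

lemma sum_cell {X : Type*} [AddCommMonoid X] (m : ℕ) (c : Zd d) (f : Zd d → X) :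
    ∑ z ∈ cell m c, f z = ∑ z ∈ bx d m, f (c + z) := by
  unfold cell; rw [Finset.sum_map]; rfl

lemma card_cell (m : ℕ) (c : Zd d) : (cell m c).card = m ^ d := by
  unfold cell; rw [Finset.card_map, card_bx]

lemma Deep.shift {E0 : Finset (Zd d)} {m Rb : ℕ} {c y : Zd d} (hc : cell m c ⊆ bx d Rb)
    (h : Deep E0 m y) : Deep E0 Rb (c + y) := by
  have hm : 0 < m ∨ d = 0 := by
    by_contra hcon
    push Not at hcon
    have hy := StochHom.mem_bx.1 h.mem_bx ⟨0, Nat.pos_of_ne_zero hcon.2⟩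
    have h3 := hcon.1
    omega
  rcases hm with hm | hd
  · have h0 : c + 0 ∈ bx d Rb := hc (mem_cell.2 (by
      rw [add_sub_cancel_left, StochHom.mem_bx]; intro j; simp [hm]))
    have h1 : c + (fun _ => (m:ℤ) - 1) ∈ bx d Rb := hc (mem_cell.2 (by
      rw [add_sub_cancel_left, StochHom.mem_bx]; intro j; constructor <;> omega))
    intro j
    obtain ⟨h2, h3⟩ := h j
    have h4 := (StochHom.mem_bx.1 h0 j).1
    have h5 := (StochHom.mem_bx.1 h1 j).2
    simp only [Pi.add_apply, Pi.zero_apply, add_zero] at h4 h5 ⊢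
    have h6 : (0:ℝ) ≤ c j := by exact_mod_cast h4
    have h7 : (c j : ℝ) + m ≤ Rb := by
      have : c j + m ≤ Rb := by omega
      exact_mod_cast this
    push_cast
    constructor <;> linarith
  · subst hd; intro j; exact j.elim0

section
variable {P : Measure Ω} {τ : Zd d → Ω → Ω} {E0 : Finset (Zd d)} {p c₁ : ℝ}
    {V : Zd d → Ω → Rn n → ℝ} {lam : Zd d → Ω → ℝ}

lemma Hyp.glue (H : Hyp P τ E0 p c₁ V lam) (ω : Ω) (G : Rd d →L[ℝ] Rn n) (Rb m : ℕ) {ι : Type*}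
    (I : Finset ι) (c : ι → Zd d) (A : ι → Rd d →L[ℝ] Rn n) (w : Zd d → Rn n)
    (hw : ∀ z, ¬ Deep E0 Rb z → w z = 0)
    (hin : ∀ i ∈ I, cell m (c i) ⊆ bx d Rb)
    (hdisj : ∀ i ∈ I, ∀ j ∈ I, ∀ z, z ∈ cell m (c i) → z ∈ cell m (c j) → i = j)
    (haff : ∀ i ∈ I, ∀ z ∈ cell m (c i), ∀ b ∈ E0, w (z + b) - w z = A i (toRd b)) :
    mF τ E0 V ω G (cube d Rb) ≤ ∑ i ∈ I, mF τ E0 V (τ (c i) ω) (G + A i) (cube d m)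
      + ∑ z ∈ bx d Rb \ I.biUnion (fun i => cell m (c i)), ∑ b ∈ E0,
        V b (τ z ω) ((‖toRd b‖)⁻¹ • (G (toRd b) + (w (z + b) - w z))) := by
  refine le_of_forall_pos_le_add fun ε hε => ?_
  have hε' : 0 < ε / (I.card + 1) := by positivity
  choose φ hφ0 hφ using fun i => H.mF_exists (τ (c i) ω) (G + A i) m hε'
  set u : Zd d → Rn n := fun z => w z + ∑ i ∈ I, φ i (z - c i) with hu
  have hu0 : ∀ z, ¬ Deep E0 Rb z → u z = 0 := by
    intro z hz
    simp only [hu, hw z hz, zero_add]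
    refine Finset.sum_eq_zero fun i hi => hφ0 i _ fun hdeep => hz ?_
    have := hdeep.shift (hin i hi)
    simpa using this
  have hz1 : ∀ i ∈ I, ∀ z, z ∉ cell m (c i) → φ i (z - c i) = 0 := by
    intro i hi z hz
    exact hφ0 i _ fun hdeep => hz (mem_cell.2 hdeep.mem_bx)
  have hz2 : ∀ i ∈ I, ∀ z, ∀ b ∈ E0, z ∉ cell m (c i) → φ i (z + b - c i) = 0 := by
    intro i hi z b hb hz
    refine hφ0 i _ fun hdeep => hz (mem_cell.2 ?_)
    rw [add_sub_right_comm] at hdeep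
    exact hdeep.sub_mem hb
  have hΔ1 : ∀ i ∈ I, ∀ z ∈ cell m (c i), ∀ b ∈ E0,
      u (z + b) - u z = A i (toRd b) + (φ i (z - c i + b) - φ i (z - c i)) := by
    intro i hi z hz b hb
    have e1 : ∑ j ∈ I, φ j (z - c j) = φ i (z - c i) := by
      refine Finset.sum_eq_single i ?_ (fun h => absurd hi h)
      intro j hj hji
      exact hz1 j hj z fun h => hji (hdisj j hj i hi z h hz)
    have e2 : ∑ j ∈ I, φ j (z + b - c j) = φ i (z + b - c i) := by
      refine Finset.sum_eq_single i ?_ (fun h => absurd hi h)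
      intro j hj hji
      exact hz2 j hj z b hb fun h => hji (hdisj j hj i hi z h hz)
    simp only [hu]
    rw [e1, e2, ← haff i hi z hz b hb, add_sub_add_comm, add_sub_right_comm z b]
  have hΔ2 : ∀ z, z ∉ I.biUnion (fun i => cell m (c i)) → ∀ b ∈ E0,
      u (z + b) - u z = w (z + b) - w z := by
    intro z hz b hb
    rw [Finset.mem_biUnion] at hz
    push Not at hz
    have e1 : ∑ j ∈ I, φ j (z - c j) = 0 := Finset.sum_eq_zero fun j hj => hz1 j hj z (hz j hj)
    have e2 : ∑ j ∈ I, φ j (z + b - c j) = 0 :=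
      Finset.sum_eq_zero fun j hj => hz2 j hj z b hb (hz j hj)
    simp only [hu]
    rw [e1, e2]; simp
  refine (H.mF_le ω G Rb u hu0).trans ?_
  unfold en
  have hsub : I.biUnion (fun i => cell m (c i)) ⊆ bx d Rb := by
    intro z hz
    obtain ⟨i, hi, hz⟩ := Finset.mem_biUnion.1 hz
    exact hin i hi hz
  rw [← Finset.sum_sdiff hsub]
  have r1 : ∑ z ∈ bx d Rb \ I.biUnion (fun i => cell m (c i)), ∑ b ∈ E0,
        V b (τ z ω) ((‖toRd b‖)⁻¹ • (G (toRd b) + (u (z + b) - u z))) =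
      ∑ z ∈ bx d Rb \ I.biUnion (fun i => cell m (c i)), ∑ b ∈ E0,
        V b (τ z ω) ((‖toRd b‖)⁻¹ • (G (toRd b) + (w (z + b) - w z))) := by
    refine Finset.sum_congr rfl fun z hz => Finset.sum_congr rfl fun b hb => ?_
    rw [hΔ2 z (Finset.mem_sdiff.1 hz).2 b hb]
  have r2 : ∑ z ∈ I.biUnion (fun i => cell m (c i)), ∑ b ∈ E0,
        V b (τ z ω) ((‖toRd b‖)⁻¹ • (G (toRd b) + (u (z + b) - u z))) =
      ∑ i ∈ I, en τ E0 V (τ (c i) ω) (G + A i) (φ i) m := by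
    rw [Finset.sum_biUnion]
    · refine Finset.sum_congr rfl fun i hi => ?_
      rw [sum_cell]
      unfold en
      refine Finset.sum_congr rfl fun z hz => Finset.sum_congr rfl fun b hb => ?_
      have hzc : c i + z ∈ cell m (c i) := mem_cell.2 (by simpa using hz)
      rw [hΔ1 i hi _ hzc b hb, ← H.τadd', add_sub_cancel_left, add_comm z (c i)]
      congr 2
      rw [add_apply]; abel
    · intro i hi j hj hij
      rw [Function.onFun, Finset.disjoint_left]
      intro z h1 h2
      exact hij (hdisj i hi j hj z h1 h2)
  rw [r1, r2]
  have r3 : ∑ i ∈ I, en τ E0 V (τ (c i) ω) (G + A i) (φ i) m ≤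
      ∑ i ∈ I, mF τ E0 V (τ (c i) ω) (G + A i) (cube d m) + ε := by
    calc _ ≤ ∑ i ∈ I, (mF τ E0 V (τ (c i) ω) (G + A i) (cube d m) + ε / (I.card + 1)) :=
          Finset.sum_le_sum fun i _ => (hφ i).le
      _ = ∑ i ∈ I, mF τ E0 V (τ (c i) ω) (G + A i) (cube d m) + I.card * (ε / (I.card + 1)) := by
          rw [Finset.sum_add_distrib]; simp
      _ ≤ _ := by
          gcongr
          rw [mul_div_assoc', div_le_iff₀ (by positivity)]
          nlinarith
  linarith
end


lemma nsmul_app (m : ℕ) (x : Zd d) (j : Fin d) : (m • x) j = (m:ℤ) * x j := by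
  rw [Pi.smul_apply, nsmul_eq_mul]

lemma grid_unique {r m : ℕ} (hmr : m ≤ r) {s x y z : Zd d} (h1 : z ∈ cell m (s + r • x))
    (h2 : z ∈ cell m (s + r • y)) : x = y := by
  rw [mem_cell, mem_bx] at h1 h2
  funext j
  have a := h1 j
  have b := h2 j
  simp only [Pi.sub_apply, Pi.add_apply, nsmul_app] at a b
  have hm : (m:ℤ) ≤ r := by exact_mod_cast hmr
  have h3 : (r:ℤ) * x j - r * y j < r := by linarith
  have h4 : (r:ℤ) * y j - r * x j < r := by linarith
  have hr : (0:ℤ) ≤ r := Int.natCast_nonneg r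
  rcases lt_trichotomy (x j) (y j) with h | h | h
  · nlinarith
  · exact h
  · nlinarith

lemma sum_bx_mul {X : Type*} [AddCommMonoid X] (m q : ℕ) (f : Zd d → X) :
    ∑ s ∈ bx d m, ∑ x ∈ bx d q, f (s + m • x) = ∑ z ∈ bx d (m * q), f z := by
  rw [← Finset.sum_product']
  refine Finset.sum_nbij' (fun sx => sx.1 + m • sx.2) (fun z => (fun j => z j % m, fun j => z j / m))
    ?_ ?_ ?_ ?_ ?_
  · rintro ⟨s, x⟩ h
    rw [Finset.mem_product, mem_bx, mem_bx] at h
    rw [mem_bx]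
    intro j
    have h1 := h.1 j
    have h2 := h.2 j
    simp only [Pi.add_apply, nsmul_app, Nat.cast_mul] at *
    have hr : (0:ℤ) ≤ m := Int.natCast_nonneg m
    constructor <;> nlinarith
  · intro z hz
    rw [mem_bx] at hz
    rw [Finset.mem_product, mem_bx, mem_bx]
    refine ⟨fun j => ?_, fun j => ?_⟩
    · have := hz j
      have hm : (0:ℤ) < m := by
        rcases Nat.eq_zero_or_pos m with h | h
        · subst h; simp at this; omega
        · exact_mod_cast h
      exact ⟨Int.emod_nonneg _ hm.ne', Int.emod_lt_of_pos _ hm⟩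
    · have := hz j
      have hm : (0:ℤ) < m := by
        rcases Nat.eq_zero_or_pos m with h | h
        · subst h; simp at this; omega
        · exact_mod_cast h
      refine ⟨Int.ediv_nonneg this.1 hm.le, ?_⟩
      apply Int.ediv_lt_of_lt_mul hm
      have := this.2
      push_cast at this
      linarith
  · rintro ⟨s, x⟩ h
    rw [Finset.mem_product, mem_bx, mem_bx] at h
    refine Prod.ext (funext fun j => ?_) (funext fun j => ?_)
    · have h1 := h.1 j
      simp only [Pi.add_apply, nsmul_app]
      rw [Int.add_mul_emod_self_left, Int.emod_eq_of_lt h1.1 h1.2]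
    · have h1 := h.1 j
      simp only [Pi.add_apply, nsmul_app] at *
      have hm : (m:ℤ) ≠ 0 := by omega
      rw [Int.add_mul_ediv_left _ _ hm, Int.ediv_eq_zero_of_lt h1.1 h1.2, zero_add]
  · intro z hz
    funext j
    simp only [Pi.add_apply, nsmul_app]
    exact Int.emod_add_mul_ediv _ _
  · rintro ⟨s, x⟩ h
    rfl

section
variable {P : Measure Ω} {τ : Zd d → Ω → Ω} {E0 : Finset (Zd d)} {p c₁ : ℝ}
    {V : Zd d → Ω → Rn n → ℝ} {lam : Zd d → Ω → ℝ}

/-- expected bound for one interaction of increments at most `t` -/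
def Cv (P : Measure Ω) (E0 : Finset (Zd d)) (lam : Zd d → Ω → ℝ) (p c₁ t : ℝ) : ℝ :=
  c₁ * (1 + Lbd P E0 lam * (t ^ p + 1))

lemma Hyp.Cv_nonneg (H : Hyp P τ E0 p c₁ V lam) {t : ℝ} (ht : 0 ≤ t) :
    0 ≤ Cv P E0 lam p c₁ t := by
  have := H.one_le_Lbd
  have := H.hc₁
  have : 0 ≤ t ^ p := Real.rpow_nonneg ht p
  unfold Cv
  positivity

lemma norm_G_le (E0 : Finset (Zd d)) (G : Rd d →L[ℝ] Rn n) {b : Zd d} (hb : b ∈ E0) :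
    ‖G (toRd b)‖ ≤ ‖G‖ * irange d E0 :=
  (G.le_opNorm _).trans (by gcongr; exact norm_le_irange hb)

/-- the remainder of the tiling -/
def rem (τ : Zd d → Ω → Ω) (E0 : Finset (Zd d)) (V : Zd d → Ω → Rn n → ℝ)
    (G : Rd d →L[ℝ] Rn n) (S : Finset (Zd d)) (ω : Ω) : ℝ :=
  ∑ z ∈ S, ∑ b ∈ E0, V b (τ z ω) ((‖toRd b‖)⁻¹ • G (toRd b))

lemma Hyp.rem_nonneg (H : Hyp P τ E0 p c₁ V lam) (G : Rd d →L[ℝ] Rn n) (S : Finset (Zd d)) (ω : Ω) :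
    0 ≤ rem τ E0 V G S ω :=
  Finset.sum_nonneg fun _ _ => Finset.sum_nonneg fun b hb => H.Vnn b hb _ _

lemma Hyp.rem_int (H : Hyp P τ E0 p c₁ V lam) (G : Rd d →L[ℝ] Rn n) (S : Finset (Zd d)) :
    Integrable (rem τ E0 V G S) P := by
  unfold rem
  exact integrable_finsetSum _ fun z _ => integrable_finsetSum _ fun b hb => H.V_int hb z _

lemma Hyp.rem_le (H : Hyp P τ E0 p c₁ V lam) (G : Rd d →L[ℝ] Rn n) (S : Finset (Zd d)) :
    ∫ ω, rem τ E0 V G S ω ∂P ≤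
      S.card * (E0.card * Cv P E0 lam p c₁ (‖G‖ * irange d E0)) := by
  unfold rem
  rw [integral_finsetSum _ fun z _ => integrable_finsetSum _ fun b hb => H.V_int hb z _]
  rw [← nsmul_eq_mul]
  refine Finset.sum_le_card_nsmul _ _ _ fun z hz => ?_
  rw [integral_finsetSum _ fun b hb => H.V_int hb z _]
  rw [← nsmul_eq_mul]
  refine Finset.sum_le_card_nsmul _ _ _ fun b hb => ?_
  exact H.EV_le hb z _ (norm_G_le E0 G hb)

/-- tiles of side `m` -/
def tiles (d m q : ℕ) (s : Zd d) : Finset (Zd d) :=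
  (bx d q).biUnion (fun x => cell m (s + m • x))

lemma card_tiles (m q : ℕ) (s : Zd d) : (tiles d m q s).card = (m * q) ^ d := by
  unfold tiles
  rw [Finset.card_biUnion]
  · simp_rw [card_cell]
    rw [Finset.sum_const, card_bx, smul_eq_mul, ← mul_pow, mul_comm]
  · intro x _ y _ hxy
    rw [Function.onFun, Finset.disjoint_left]
    intro z h1 h2
    exact hxy (grid_unique le_rfl h1 h2)

lemma tiles_sub {m q r : ℕ} (h : m * (q + 1) ≤ r) {s : Zd d} (hs : s ∈ bx d m) {x : Zd d}
    (hx : x ∈ bx d q) : cell m (s + m • x) ⊆ bx d r := by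
  intro z hz
  rw [mem_cell] at hz
  rw [mem_bx] at *
  intro j
  have h1 := hs j
  have h2 := hx j
  have h3 := hz j
  simp only [Pi.sub_apply, Pi.add_apply, nsmul_app] at h3
  have h4 : (m:ℤ) * (q + 1) ≤ r := by exact_mod_cast h
  have hm : (0:ℤ) ≤ m := Int.natCast_nonneg m
  have h5 : (m:ℤ) * (x j + 1) ≤ m * q := mul_le_mul_of_nonneg_left (by omega) hm
  have h6 : 0 ≤ (m:ℤ) * x j := mul_nonneg hm h2.1
  have e5 : (m:ℤ) * (x j + 1) = m * x j + m := by ring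
  have e4 : (m:ℤ) * (q + 1) = m * q + m := by ring
  constructor
  · linarith
  · linarith

lemma Hyp.mF_tile (H : Hyp P τ E0 p c₁ V lam) (G : Rd d →L[ℝ] Rn n) {m q r : ℕ}
    (h : m * (q + 1) ≤ r) {s : Zd d} (hs : s ∈ bx d m) (ω : Ω) :
    mF τ E0 V ω G (cube d r) ≤ ∑ x ∈ bx d q, mF τ E0 V (τ (s + m • x) ω) G (cube d m)
      + rem τ E0 V G (bx d r \ tiles d m q s) ω := by
  have := H.glue ω G r m (bx d q) (fun x => s + m • x) (fun _ => 0) (fun _ => 0) (fun _ _ => rfl)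
    (fun x hx => tiles_sub h hs hx) (fun x _ y _ z h1 h2 => grid_unique le_rfl h1 h2)
    (fun _ _ _ _ _ _ => by simp)
  simpa [rem, tiles] using this

lemma card_rest {m q r : ℕ} (h : m * (q + 1) ≤ r) (h' : r ≤ m * q + 2 * m) {s : Zd d}
    (hs : s ∈ bx d m) :
    ((bx d r \ tiles d m q s).card : ℝ) ≤ d * (2 * m) * (r:ℝ) ^ (d - 1) := by
  have hsub : tiles d m q s ⊆ bx d r := by
    intro z hz
    obtain ⟨x, hx, hz⟩ := Finset.mem_biUnion.1 hz
    exact tiles_sub h hs hx hz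
  rw [Finset.card_sdiff_of_subset hsub, Nat.cast_sub (Finset.card_le_card hsub), card_tiles, card_bx]
  refine le_trans ?_ (layer_le d r m)
  push_cast
  have : ((r - 2 * m : ℕ) : ℝ) ≤ (m:ℝ) * q := by
    have : r - 2 * m ≤ m * q := by omega
    exact_mod_cast this
  gcongr

/-- normalized minimal energy -/
def Xr (τ : Zd d → Ω → Ω) (E0 : Finset (Zd d)) (V : Zd d → Ω → Rn n → ℝ)
    (G : Rd d →L[ℝ] Rn n) (r : ℕ) (ω : Ω) : ℝ := ((r:ℝ) ^ d)⁻¹ * mF τ E0 V ω G (cube d r)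

lemma Hyp.Xr_int (H : Hyp P τ E0 p c₁ V lam) (G : Rd d →L[ℝ] Rn n) (r : ℕ) :
    Integrable (Xr τ E0 V G r) P := (H.mF_int G r).const_mul _

lemma Hyp.Xr_nonneg (H : Hyp P τ E0 p c₁ V lam) (G : Rd d →L[ℝ] Rn n) (r : ℕ) (ω : Ω) :
    0 ≤ Xr τ E0 V G r ω := mul_nonneg (by positivity) (H.mF_nonneg _ _ _)

lemma Hyp.Xr_le (H : Hyp P τ E0 p c₁ V lam) (G : Rd d →L[ℝ] Rn n) {m q r : ℕ} (hm : 0 < m)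
    (hq : 0 < q) (h : m * (q + 1) ≤ r) (ω : Ω) :
    Xr τ E0 V G r ω ≤ avg τ (Xr τ E0 V G m) (m * q) ω
      + ((r:ℝ) ^ d)⁻¹ * (((m:ℝ) ^ d)⁻¹ * ∑ s ∈ bx d m, rem τ E0 V G (bx d r \ tiles d m q s) ω) := by
  have hr : 0 < r := by
    have : 0 < m * (q + 1) := by positivity
    omega
  have hmd : (0:ℝ) < (m:ℝ) ^ d := by positivity
  have hqd : (0:ℝ) < (q:ℝ) ^ d := by positivity
  have hrd : (0:ℝ) < (r:ℝ) ^ d := by positivity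
  have h1 : (m:ℝ) ^ d * mF τ E0 V ω G (cube d r) ≤
      ∑ z ∈ bx d (m * q), mF τ E0 V (τ z ω) G (cube d m)
      + ∑ s ∈ bx d m, rem τ E0 V G (bx d r \ tiles d m q s) ω := by
    rw [← sum_bx_mul, ← Finset.sum_add_distrib]
    have e : (m:ℝ) ^ d * mF τ E0 V ω G (cube d r) = ∑ s ∈ bx d m, mF τ E0 V ω G (cube d r) := by
      rw [Finset.sum_const, card_bx, nsmul_eq_mul]; push_cast; ring
    rw [e]
    exact Finset.sum_le_sum fun s hs => H.mF_tile G h hs ω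
  set S1 := ∑ z ∈ bx d (m * q), mF τ E0 V (τ z ω) G (cube d m) with hS1
  set S2 := ∑ s ∈ bx d m, rem τ E0 V G (bx d r \ tiles d m q s) ω with hS2
  have hS1n : 0 ≤ S1 := Finset.sum_nonneg fun z _ => H.mF_nonneg _ _ _
  have e2 : avg τ (Xr τ E0 V G m) (m * q) ω = (((m * q : ℕ):ℝ) ^ d)⁻¹ * (((m:ℝ) ^ d)⁻¹ * S1) := by
    unfold avg Xr
    rw [← Finset.mul_sum]
  have hle : ((m * q : ℕ):ℝ) ^ d ≤ (r:ℝ) ^ d := by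
    have : m * q ≤ r := by nlinarith
    have : ((m * q : ℕ):ℝ) ≤ r := by exact_mod_cast this
    gcongr
  have hmq : (0:ℝ) < ((m * q : ℕ):ℝ) ^ d := by
    have : 0 < m * q := by positivity
    positivity
  have h3 : ((r:ℝ) ^ d)⁻¹ * (((m:ℝ) ^ d)⁻¹ * S1) ≤ avg τ (Xr τ E0 V G m) (m * q) ω := by
    rw [e2]
    gcongr
  have h4 : mF τ E0 V ω G (cube d r) ≤ ((m:ℝ) ^ d)⁻¹ * (S1 + S2) := by
    rw [le_inv_mul_iff₀ hmd]; exact h1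
  unfold Xr at h3 ⊢
  calc _ ≤ ((r:ℝ) ^ d)⁻¹ * (((m:ℝ) ^ d)⁻¹ * (S1 + S2)) := by gcongr
    _ = ((r:ℝ) ^ d)⁻¹ * (((m:ℝ) ^ d)⁻¹ * S1) + ((r:ℝ) ^ d)⁻¹ * (((m:ℝ) ^ d)⁻¹ * S2) := by ring
    _ ≤ _ := by gcongr

lemma Hyp.W0_le_Xr (H : Hyp P τ E0 p c₁ V lam) (G : Rd d →L[ℝ] Rn n) {r : ℕ} (hr : 0 < r) :
    W0 P τ E0 V G ≤ ∫ ω, Xr τ E0 V G r ω ∂P := by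
  unfold Xr
  rw [integral_const_mul]
  exact H.W0_le G hr

/-- positive part of the deviation goes to zero in the mean -/
lemma Hyp.Xr_pos (H : Hyp P τ E0 p c₁ V lam) (G : Rd d →L[ℝ] Rn n) :
    Tendsto (fun r => ∫ ω, max (Xr τ E0 V G r ω - W0 P τ E0 V G) 0 ∂P) atTop (𝓝 0) := by
  have := H.prob
  have hn : ∀ r, 0 ≤ ∫ ω, max (Xr τ E0 V G r ω - W0 P τ E0 V G) 0 ∂P := fun r =>
    integral_nonneg fun ω => le_max_right _ _
  rw [Metric.tendsto_atTop]
  intro ε hε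
  obtain ⟨m, hm, hmW⟩ := H.W0_exists G (ε := ε / 3) (by positivity)
  set Y := Xr τ E0 V G m with hY
  have hYi : Integrable Y P := H.Xr_int G m
  have hEY : ∫ ω, Y ω ∂P < W0 P τ E0 V G + ε / 3 := by
    rw [hY]; unfold Xr; rw [integral_const_mul]; exact hmW
  set C := E0.card * Cv P E0 lam p c₁ (‖G‖ * irange d E0) with hC
  have hC0 : 0 ≤ C := mul_nonneg (Nat.cast_nonneg _)
    (H.Cv_nonneg (mul_nonneg (norm_nonneg _) (irange_nonneg E0)))
  have hmean := H.mean Y hYi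
  have hq : Tendsto (fun r : ℕ => m * (r / m - 1)) atTop atTop := by
    refine tendsto_atTop_mono (f := fun r => r - 2 * m) (fun r => ?_) (tendsto_sub_atTop_nat _)
    have := Nat.div_add_mod r m
    have h2 := Nat.mod_lt r hm
    rw [Nat.mul_sub]
    omega
  have hmean2 := hmean.comp hq
  have hrest : Tendsto (fun r : ℕ => (d * (2 * m) * C : ℝ) * ((r:ℝ))⁻¹) atTop (𝓝 0) := by
    have := (tendsto_inv_atTop_zero.comp (tendsto_natCast_atTop_atTop (R := ℝ))).const_mul
      (d * (2 * m) * C : ℝ)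
    rw [mul_zero] at this
    exact this
  have ev1 := (tendsto_order.1 hmean2).2 (ε / 3) (by positivity)
  have ev2 := (tendsto_order.1 hrest).2 (ε / 3) (by positivity)
  obtain ⟨N, hN⟩ := eventually_atTop.1 (ev1.and (ev2.and (eventually_ge_atTop (2 * m))))
  refine ⟨N, fun r hr => ?_⟩
  obtain ⟨h1, h2, h3⟩ := hN r hr
  rw [Real.dist_eq, sub_zero, abs_of_nonneg (hn r)]
  have hr0 : 0 < r := by omega
  have hdm : 2 ≤ r / m := (Nat.le_div_iff_mul_le hm).2 (by omega)
  set q := r / m - 1 with hqdef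
  have hq0 : 0 < q := by omega
  have hdv := Nat.div_mul_le_self r m
  have hdv2 := Nat.lt_div_mul_add (a := r) hm
  have hq1 : m * (q + 1) ≤ r := by
    have : q + 1 = r / m := by omega
    rw [this, mul_comm]; exact hdv
  have hq2 : r ≤ m * q + 2 * m := by
    have : r / m = q + 1 := by omega
    rw [this] at hdv2
    nlinarith
  set Rm : Ω → ℝ := fun ω => ((r:ℝ) ^ d)⁻¹ *
    (((m:ℝ) ^ d)⁻¹ * ∑ s ∈ bx d m, rem τ E0 V G (bx d r \ tiles d m q s) ω) with hRm
  have hRmi : Integrable Rm P := by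
    refine Integrable.const_mul (Integrable.const_mul ?_ _) _
    exact integrable_finsetSum _ fun s _ => H.rem_int G _
  have hRm0 : ∀ ω, 0 ≤ Rm ω := fun ω => mul_nonneg (by positivity)
    (mul_nonneg (by positivity) (Finset.sum_nonneg fun s _ => H.rem_nonneg _ _ _))
  have hrR : (0:ℝ) < r := by exact_mod_cast hr0
  have hmR : (0:ℝ) < m := by exact_mod_cast hm
  have hERm : ∫ ω, Rm ω ∂P ≤ d * (2 * m) * C * (r:ℝ)⁻¹ := by
    rw [hRm, integral_const_mul, integral_const_mul,
      integral_finsetSum _ fun s _ => H.rem_int G _]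
    have b1 : ∑ s ∈ bx d m, ∫ ω, rem τ E0 V G (bx d r \ tiles d m q s) ω ∂P ≤
        (m:ℝ) ^ d * (d * (2 * m) * (r:ℝ) ^ (d - 1) * C) := by
      have : (m:ℝ) ^ d * (d * (2 * m) * (r:ℝ) ^ (d - 1) * C) =
          (bx d m).card • (d * (2 * m) * (r:ℝ) ^ (d - 1) * C) := by
        rw [card_bx, nsmul_eq_mul]; push_cast; ring
      rw [this]
      refine Finset.sum_le_card_nsmul _ _ _ fun s hs => (H.rem_le G _).trans ?_
      exact mul_le_mul_of_nonneg_right (card_rest hq1 hq2 hs) hC0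
    calc _ ≤ ((r:ℝ) ^ d)⁻¹ * (((m:ℝ) ^ d)⁻¹ * ((m:ℝ) ^ d * (d * (2 * m) * (r:ℝ) ^ (d - 1) * C))) := by
          gcongr
      _ = _ := by
          obtain ⟨e, he⟩ : ∃ e, d = e + 1 := ⟨d - 1, by have := H.hd; omega⟩
          rw [← mul_assoc (((m:ℝ) ^ d)⁻¹), inv_mul_cancel₀ (by positivity), one_mul]
          have : (r:ℝ) ^ d = (r:ℝ) ^ (d - 1) * r := by
            rw [he]; simp [pow_succ]
          rw [this]
          field_simp
  have hmain : ∫ ω, max (Xr τ E0 V G r ω - W0 P τ E0 V G) 0 ∂P ≤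
      ∫ ω, (|avg τ Y (m * q) ω - ∫ x, Y x ∂P| + (Rm ω + ε / 3)) ∂P := by
    refine integral_mono (((H.Xr_int G r).sub (integrable_const _)).pos_part)
      ((((H.avg_int Y hYi _).sub (integrable_const _)).abs).add (hRmi.add (integrable_const _))) ?_
    intro ω
    have a1 := H.Xr_le G hm hq0 hq1 ω
    have a2 := le_abs_self (avg τ Y (m * q) ω - ∫ x, Y x ∂P)
    have a3 := abs_nonneg (avg τ Y (m * q) ω - ∫ x, Y x ∂P)
    have a4 := hRm0 ω
    refine max_le ?_ (by positivity)
    simp only [hRm] at *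
    linarith
  have i1 : Integrable (fun ω => |avg τ Y (m * q) ω - ∫ x, Y x ∂P|) P :=
    ((H.avg_int Y hYi _).sub (integrable_const _)).abs
  have i2 : Integrable (fun ω => Rm ω + ε / 3) P := hRmi.add (integrable_const _)
  rw [integral_add i1 i2, integral_add hRmi (integrable_const _)] at hmain
  simp only [integral_const, probReal_univ, smul_eq_mul, one_mul] at hmain
  simp only [Function.comp_apply] at h1
  linarith

lemma Hyp.EXr_tendsto (H : Hyp P τ E0 p c₁ V lam) (G : Rd d →L[ℝ] Rn n) :
    Tendsto (fun r => ∫ ω, Xr τ E0 V G r ω ∂P) atTop (𝓝 (W0 P τ E0 V G)) := by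
  have := H.prob
  have h1 : Tendsto (fun r => W0 P τ E0 V G + ∫ ω, max (Xr τ E0 V G r ω - W0 P τ E0 V G) 0 ∂P)
      atTop (𝓝 (W0 P τ E0 V G)) := by simpa using (H.Xr_pos G).const_add (W0 P τ E0 V G)
  refine tendsto_of_tendsto_of_tendsto_of_le_of_le' tendsto_const_nhds h1 ?_ ?_
  · filter_upwards [eventually_gt_atTop 0] with r hr using H.W0_le_Xr G hr
  · refine Eventually.of_forall fun r => ?_
    have h2 : ∫ ω, (Xr τ E0 V G r ω - W0 P τ E0 V G) ∂P ≤
        ∫ ω, max (Xr τ E0 V G r ω - W0 P τ E0 V G) 0 ∂P :=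
      integral_mono ((H.Xr_int G r).sub (integrable_const _))
        (((H.Xr_int G r).sub (integrable_const _)).pos_part) fun ω => le_max_left _ _
    rw [integral_sub (H.Xr_int G r) (integrable_const _)] at h2
    simp only [integral_const, probReal_univ, smul_eq_mul, one_mul] at h2
    linarith

/-- lower deviations are unlikely -/
lemma Hyp.Xr_prob (H : Hyp P τ E0 p c₁ V lam) (G : Rd d →L[ℝ] Rn n) {ε : ℝ} (hε : 0 < ε) :
    Tendsto (fun r => P {ω | Xr τ E0 V G r ω ≤ ∫ x, Xr τ E0 V G r x ∂P - ε}) atTop (𝓝 0) := by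
  have := H.prob
  have hb : ∀ᶠ r in atTop, P {ω | Xr τ E0 V G r ω ≤ ∫ x, Xr τ E0 V G r x ∂P - ε} ≤
      ENNReal.ofReal (ε⁻¹ * ∫ ω, max (Xr τ E0 V G r ω - W0 P τ E0 V G) 0 ∂P) := by
    filter_upwards [eventually_gt_atTop 0] with r hr
    set X := Xr τ E0 V G r with hX
    have hXi : Integrable X P := H.Xr_int G r
    have hW := H.W0_le_Xr G hr
    set W := W0 P τ E0 V G with hWd
    set T : Ω → ℝ := fun ω => max (X ω - W) 0 - (X ω - ∫ x, X x ∂P) with hT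
    have hpi : Integrable (fun ω => max (X ω - W) 0) P := (hXi.sub (integrable_const _)).pos_part
    have hTi : Integrable T P := hpi.sub (hXi.sub (integrable_const _))
    have hT0 : 0 ≤ᵐ[P] T := by
      refine Eventually.of_forall fun ω => ?_
      simp only [hT, Pi.zero_apply]
      have := le_max_left (X ω - W) 0
      linarith
    have hTE : ∫ ω, T ω ∂P = ∫ ω, max (X ω - W) 0 ∂P := by
      have i2 : Integrable (fun ω => X ω - ∫ x, X x ∂P) P := hXi.sub (integrable_const _)
      simp only [hT]
      rw [integral_sub hpi i2, integral_sub hXi (integrable_const _)]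
      simp
    have hmk := mul_meas_ge_le_integral_of_nonneg hT0 hTi ε
    rw [hTE] at hmk
    have h1 : P.real {ω | X ω ≤ ∫ x, X x ∂P - ε} ≤ P.real {ω | ε ≤ T ω} := by
      refine measureReal_mono ?_
      intro ω hω
      simp only [mem_ofPred_eq, hT] at *
      have := le_max_right (X ω - W) 0
      linarith
    have h2 : P.real {ω | X ω ≤ ∫ x, X x ∂P - ε} ≤ ε⁻¹ * ∫ ω, max (X ω - W) 0 ∂P := by
      rw [le_inv_mul_iff₀ hε]
      refine le_trans ?_ hmk
      gcongr
    rw [← ofReal_measureReal]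
    exact ENNReal.ofReal_le_ofReal h2
  refine tendsto_of_tendsto_of_tendsto_of_le_of_le' tendsto_const_nhds ?_
    (Eventually.of_forall fun _ => zero_le) hb
  rw [← ENNReal.ofReal_zero]
  refine (ENNReal.continuous_ofReal.tendsto 0).comp ?_
  simpa using (H.Xr_pos G).const_mul ε⁻¹
end


/-- reduction modulo `k` -/
def pm (k : ℕ) (z : Zd d) : Zd d := fun j => z j % k

/-- `k`-periodicity -/
def Per {X : Type*} (k : ℕ) (f : Zd d → X) : Prop := ∀ z z' : Zd d, f (z + k • z') = f z

lemma pm_eq (k : ℕ) (z : Zd d) : pm k z = z + k • (fun j => -(z j / k)) := by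
  funext j
  simp only [pm, Pi.add_apply, nsmul_app]
  have := Int.emod_add_mul_ediv (z j) k
  linarith

lemma Per.pm {X : Type*} {k : ℕ} {f : Zd d → X} (hf : Per k f) (z : Zd d) : f (pm k z) = f z := by
  rw [pm_eq]; exact hf _ _

lemma pm_mem {k : ℕ} (hk : 0 < k) (z : Zd d) : pm k z ∈ bx d k := by
  rw [mem_bx]
  intro j
  have : (0:ℤ) < k := by exact_mod_cast hk
  exact ⟨Int.emod_nonneg _ this.ne', Int.emod_lt_of_pos _ this⟩

lemma pm_of_mem {k : ℕ} {z : Zd d} (h : z ∈ bx d k) : pm k z = z := by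
  rw [mem_bx] at h
  funext j
  exact Int.emod_eq_of_lt (h j).1 (h j).2

lemma pm_add_smul (k : ℕ) (z z' : Zd d) : pm k (z + k • z') = pm k z := by
  funext j
  simp only [pm, Pi.add_apply, nsmul_app, Int.add_mul_emod_self_left]

lemma per_comp_pm {X : Type*} (k : ℕ) (f : Zd d → X) : Per k (fun z => f (pm k z)) := by
  intro z z'
  simp only [pm_add_smul]

lemma Per.shift {X : Type*} {k : ℕ} {f : Zd d → X} (hf : Per k f) (y : Zd d) :
    Per k (fun z => f (z + y)) := by
  intro z z'
  have : z + k • z' + y = z + y + k • z' := by abel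
  simp only [this]
  exact hf _ _

lemma sum_per {X : Type*} [AddCommMonoid X] {k : ℕ} (hk : 0 < k) {f : Zd d → X} (hf : Per k f)
    (y : Zd d) : ∑ z ∈ bx d k, f (z + y) = ∑ z ∈ bx d k, f z := by
  refine Finset.sum_nbij' (fun z => pm k (z + y)) (fun z => pm k (z - y)) (fun z _ => pm_mem hk _)
    (fun z _ => pm_mem hk _) ?_ ?_ ?_
  · intro z hz
    have : pm k (z + y) - y = z + k • (fun j => -((z + y) j / k)) := by rw [pm_eq]; abel
    rw [this, pm_add_smul, pm_of_mem hz]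
  · intro z hz
    have : pm k (z - y) + y = z + k • (fun j => -((z - y) j / k)) := by rw [pm_eq]; abel
    rw [this, pm_add_smul, pm_of_mem hz]
  · intro z _
    rw [hf.pm]

section
variable {P : Measure Ω} {τ : Zd d → Ω → Ω} {E0 : Finset (Zd d)} {p c₁ : ℝ}
    {V : Zd d → Ω → Rn n → ℝ} {lam : Zd d → Ω → ℝ}

lemma Hyp.Wper_le_Xr (H : Hyp P τ E0 p c₁ V lam) (G : Rd d →L[ℝ] Rn n) {k : ℕ} (hk : 0 < k)
    (ω : Ω) : Wper τ E0 V k ω G ≤ Xr τ E0 V G k ω := by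
  have hk' : (0:ℝ) < (k:ℝ) ^ d := by positivity
  unfold Xr
  rw [le_inv_mul_iff₀ hk']
  refine le_of_forall_pos_le_add fun ε hε => ?_
  obtain ⟨φ, hφ0, hφ⟩ := H.mF_exists ω G k hε
  refine le_trans ?_ hφ.le
  have h1 := H.Wper_le ω G k (fun z => φ (pm k z)) (per_comp_pm k φ)
  rw [le_inv_mul_iff₀ hk'] at h1
  refine h1.trans (le_of_eq ?_)
  unfold en
  refine Finset.sum_congr rfl fun z hz => Finset.sum_congr rfl fun b hb => ?_
  have h2 : φ (pm k (z + b)) = φ (z + b) := by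
    by_cases hzb : z + b ∈ bx d k
    · rw [pm_of_mem hzb]
    · rw [hφ0 (z + b) (fun h => hzb h.mem_bx)]
      apply hφ0
      intro hD
      rw [pm_eq] at hD
      have e : z + b + k • (fun j => -((z + b) j / k)) = z + k • (fun j => -((z + b) j / k)) + b := by
        abel
      rw [e] at hD
      have h3 := pm_of_mem (hD.sub_mem hb)
      rw [pm_add_smul, pm_of_mem hz] at h3
      rw [← h3] at hD
      exact hzb hD.mem_bx
  simp only [h2, pm_of_mem hz]

/-- reduction to a statement in probability -/
lemma Hyp.reduce (H : Hyp P τ E0 p c₁ V lam) (G : Rd d →L[ℝ] Rn n)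
    (h : ∀ ε : ℝ, 0 < ε → Tendsto (fun k => P {ω | Wper τ E0 V k ω G ≤ W0 P τ E0 V G - ε})
      atTop (𝓝 0)) :
    Tendsto (fun k : ℕ => ∫ ω, Wper τ E0 V k ω G ∂P) atTop (𝓝 (W0 P τ E0 V G)) := by
  have := H.prob
  set W := W0 P τ E0 V G with hW
  have hW0 : 0 ≤ W := H.W0_nonneg G
  rw [tendsto_order]
  constructor
  · intro a ha
    set ε := (W - a) / 3 with hε
    have hε0 : 0 < ε := by rw [hε]; linarith
    have hr := (ENNReal.tendsto_toReal ENNReal.zero_ne_top).comp (h ε hε0)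
    have hr2 := hr.const_mul W
    simp only [ENNReal.toReal_zero, mul_zero] at hr2
    filter_upwards [(tendsto_order.1 hr2).2 ε hε0] with k hk
    set B := {ω | Wper τ E0 V k ω G ≤ W - ε} with hB
    have hBm : MeasurableSet B := measurableSet_le (H.Wper_meas G k) measurable_const
    have hi : Integrable (fun ω => (W - ε) - B.indicator (fun _ => W) ω) P :=
      (integrable_const _).sub ((integrable_const _).indicator hBm)
    have h1 : ∫ ω, ((W - ε) - B.indicator (fun _ => W) ω) ∂P ≤ ∫ ω, Wper τ E0 V k ω G ∂P := by
      refine integral_mono hi (H.Wper_int G k) fun ω => ?_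
      by_cases hω : ω ∈ B
      · simp only [Set.indicator_of_mem hω]
        have := H.Wper_nonneg ω G k
        linarith
      · simp only [Set.indicator_of_notMem hω]
        simp only [hB, mem_ofPred_eq, not_le] at hω
        linarith
    rw [integral_sub (integrable_const _) ((integrable_const _).indicator hBm),
      integral_indicator_const _ hBm] at h1
    simp only [integral_const, probReal_univ, smul_eq_mul, one_mul] at h1
    have h2 : W * P.real B < ε := hk
    have : a = W - 3 * ε := by rw [hε]; ring
    linarith
  · intro a ha
    filter_upwards [(tendsto_order.1 (H.EXr_tendsto G)).2 a ha, eventually_gt_atTop 0] with k hk hk0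
    refine lt_of_le_of_lt ?_ hk
    exact integral_mono (H.Wper_int G k) (H.Xr_int G k) fun ω => H.Wper_le_Xr G hk0 ω
end


lemma le_of_all_inv {a b C : ℝ} (h : ∀ q : ℕ, a ≤ b + C * ((q:ℝ) + 2)⁻¹) : a ≤ b := by
  have h1 : Tendsto (fun q : ℕ => b + C * ((q:ℝ) + 2)⁻¹) atTop (𝓝 (b + C * 0)) := by
    refine Tendsto.const_add _ (Tendsto.const_mul _ ?_)
    exact tendsto_inv_atTop_zero.comp
      ((tendsto_natCast_atTop_atTop (R := ℝ)).atTop_add tendsto_const_nhds)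
  rw [mul_zero, add_zero] at h1
  exact ge_of_tendsto' h1 h

lemma coord_le_irange {E0 : Finset (Zd d)} {b : Zd d} (hb : b ∈ E0) (j : Fin d) :
    |(b j : ℝ)| ≤ irange d E0 := by
  have h3 : |toRd b j| ≤ irange d E0 := (abs_coord_le _ _).trans (norm_le_irange hb)
  rwa [toRd_apply] at h3

section
variable {P : Measure Ω} {τ : Zd d → Ω → Ω} {E0 : Finset (Zd d)} {p c₁ : ℝ}
    {V : Zd d → Ω → Rn n → ℝ} {lam : Zd d → Ω → ℝ}

lemma Hyp.up_aux (H : Hyp P τ E0 p c₁ V lam) (F : Rd d →L[ℝ] Rn n) {k m : ℕ}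
    (hkR : irange d E0 < k) (w : Zd d → Rn n) (hw : Per k w) {ι : Type*} (I : Finset ι)
    (c : ι → Zd d) (A : ι → Rd d →L[ℝ] Rn n)
    (hin : ∀ i ∈ I, cell m (c i) ⊆ bx d k)
    (hdisj : ∀ i ∈ I, ∀ j ∈ I, ∀ z, z ∈ cell m (c i) → z ∈ cell m (c j) → i = j)
    (hnb : ∀ i ∈ I, ∀ z ∈ cell m (c i), ∀ b ∈ E0, z + b ∈ bx d k)
    (haff : ∀ i ∈ I, ∀ z ∈ cell m (c i), ∀ b ∈ E0, w (z + b) - w z = A i (toRd b))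
    (T : Zd d → ℝ) (hT : ∀ z ∈ bx d k, ∀ b ∈ E0, ‖F (toRd b) + (w (z + b) - w z)‖ ≤ T z)
    (Tm : ℝ) (hTm : ∀ z, ‖w z‖ ≤ Tm) (q : ℕ) :
    ∫ ω, mF τ E0 V ω F (cube d ((q + 2) * k)) ∂P ≤
      (q:ℝ) ^ d * (∑ i ∈ I, ∫ ω, mF τ E0 V ω (F + A i) (cube d m) ∂P
        + ∑ z ∈ bx d k \ I.biUnion (fun i => cell m (c i)), E0.card * Cv P E0 lam p c₁ (T z))
      + d * (2 * (2 * k)) * ((((q + 2) * k : ℕ)):ℝ) ^ (d - 1) *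
        (E0.card * Cv P E0 lam p c₁ (‖F‖ * irange d E0 + 2 * Tm)) := by
  have := H.prob
  have hTm0 : 0 ≤ Tm := (norm_nonneg _).trans (hTm 0)
  have hR0 := irange_nonneg E0
  have hkR' : (0:ℝ) < k := lt_of_le_of_lt hR0 hkR
  have hk : 0 < k := by exact_mod_cast hkR'
  set Rb := (q + 2) * k with hRb
  set o : Zd d := fun _ => (k:ℤ) with ho
  set w' : Zd d → Rn n := fun z => if z - o ∈ bx d (q * k) then w z else 0 with hw'
  set cc : Zd d × ι → Zd d := fun Xi => o + k • Xi.1 + c Xi.2 with hcc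
  set J := bx d q ×ˢ I with hJ
  have hw'n : ∀ z, ‖w' z‖ ≤ Tm := by
    intro z
    simp only [hw']
    split_ifs
    · exact hTm z
    · simpa using hTm0
  -- points of a tile
  have htile : ∀ X ∈ bx d q, ∀ y ∈ bx d k, o + k • X + y - o ∈ bx d (q * k) := by
    intro X hX y hy
    rw [mem_bx] at *
    intro j
    have h1 := hX j
    have h2 := hy j
    simp only [Pi.sub_apply, Pi.add_apply, nsmul_app, Nat.cast_mul]
    have hk0 : (0:ℤ) ≤ k := Int.natCast_nonneg k
    constructor <;> nlinarith
  have hw't : ∀ X ∈ bx d q, ∀ y ∈ bx d k, w' (o + k • X + y) = w y := by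
    intro X hX y hy
    simp only [hw', if_pos (htile X hX y hy)]
    have : o + k • X + y = y + k • ((fun _ => 1) + X) := by
      funext j
      simp only [ho, Pi.add_apply, nsmul_app]
      ring
    rw [this, hw]
  have hcellcc : ∀ Xi ∈ J, ∀ z, z ∈ cell m (cc Xi) → ∃ y ∈ cell m (c Xi.2), z = o + k • Xi.1 + y := by
    intro Xi hXi z hz
    refine ⟨z - (o + k • Xi.1), ?_, by abel⟩
    rw [mem_cell] at hz ⊢
    have : z - (o + k • Xi.1) - c Xi.2 = z - cc Xi := by simp only [hcc]; abel
    rw [this]; exact hz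
  have hRbcast : (Rb:ℤ) = (q + 2) * k := by rw [hRb]; push_cast; ring
  have hsubRb : ∀ z, z - o ∈ bx d (q * k) → Deep E0 Rb z := by
    intro z hz j
    have h1 := mem_bx.1 hz j
    simp only [ho, Pi.sub_apply, Nat.cast_mul] at h1
    have h2 : (k:ℝ) ≤ z j := by
      have : (k:ℤ) ≤ z j := by linarith [h1.1]
      exact_mod_cast this
    have h3 : (z j : ℝ) < (q:ℝ) * k + k := by
      have : z j < q * k + k := by linarith [h1.2]
      exact_mod_cast this
    have h4 : (Rb:ℝ) = (q:ℝ) * k + k + k := by rw [hRb]; push_cast; ring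
    rw [h4]
    constructor <;> linarith
  have key : ∀ ω, mF τ E0 V ω F (cube d Rb) ≤
      ∑ Xi ∈ J, mF τ E0 V (τ (cc Xi) ω) (F + A Xi.2) (cube d m)
      + ∑ z ∈ bx d Rb \ J.biUnion (fun Xi => cell m (cc Xi)), ∑ b ∈ E0,
        V b (τ z ω) ((‖toRd b‖)⁻¹ • (F (toRd b) + (w' (z + b) - w' z))) := by
    intro ω
    refine H.glue ω F Rb m J cc (fun Xi => A Xi.2) w' ?_ ?_ ?_ ?_
    · intro z hz
      simp only [hw']
      rw [if_neg (fun h => hz (hsubRb z h))]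
    · intro Xi hXi z hz
      obtain ⟨y, hy, rfl⟩ := hcellcc Xi hXi z hz
      have hX := Finset.mem_product.1 hXi
      exact (hsubRb _ (htile _ hX.1 y (hin _ hX.2 hy))).mem_bx
    · intro Xi hXi Yj hYj z h1 h2
      obtain ⟨y, hy, rfl⟩ := hcellcc Xi hXi z h1
      obtain ⟨y', hy', e⟩ := hcellcc Yj hYj _ h2
      have hX := Finset.mem_product.1 hXi
      have hY := Finset.mem_product.1 hYj
      have hXY : Xi.1 = Yj.1 := by
        refine grid_unique (r := k) (m := k) le_rfl (s := o) (z := o + k • Xi.1 + y) ?_ ?_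
        · rw [mem_cell, add_sub_cancel_left]; exact hin _ hX.2 hy
        · rw [e, mem_cell, add_sub_cancel_left]; exact hin _ hY.2 hy'
      rw [hXY] at e
      have hyy : y = y' := add_left_cancel e
      subst hyy
      exact Prod.ext hXY (hdisj _ hX.2 _ hY.2 _ hy hy')
    · intro Xi hXi z hz b hb
      obtain ⟨y, hy, rfl⟩ := hcellcc Xi hXi z hz
      have hX := Finset.mem_product.1 hXi
      rw [add_assoc, hw't _ hX.1 _ (hnb _ hX.2 y hy b hb), hw't _ hX.1 y (hin _ hX.2 hy)]
      exact haff _ hX.2 y hy b hb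
  set U := J.biUnion (fun Xi => cell m (cc Xi)) with hU
  set C := ‖F‖ * irange d E0 + 2 * Tm with hC
  have hC0 : 0 ≤ C := by positivity
  have i1 : ∀ Xi ∈ J, Integrable (fun ω => mF τ E0 V (τ (cc Xi) ω) (F + A Xi.2) (cube d m)) P :=
    fun Xi _ => (H.τmp _).integrable_comp_of_integrable (H.mF_int (F + A Xi.2) m)
  have i2 : ∀ z, Integrable (fun ω => ∑ b ∈ E0,
        V b (τ z ω) ((‖toRd b‖)⁻¹ • (F (toRd b) + (w' (z + b) - w' z)))) P :=
    fun z => integrable_finsetSum _ fun b hb => H.V_int hb z _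
  have h1 := integral_mono (H.mF_int F Rb) ((integrable_finsetSum _ i1).add
    (integrable_finsetSum _ fun z _ => i2 z)) key
  simp only [Pi.add_apply] at h1
  rw [integral_add (integrable_finsetSum _ i1) (integrable_finsetSum _ fun z _ => i2 z),
    integral_finsetSum _ i1, integral_finsetSum _ fun z _ => i2 z] at h1
  refine h1.trans ?_
  have e1 : ∑ Xi ∈ J, ∫ ω, mF τ E0 V (τ (cc Xi) ω) (F + A Xi.2) (cube d m) ∂P =
      (q:ℝ) ^ d * ∑ i ∈ I, ∫ ω, mF τ E0 V ω (F + A i) (cube d m) ∂P := by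
    have : ∀ Xi ∈ J, ∫ ω, mF τ E0 V (τ (cc Xi) ω) (F + A Xi.2) (cube d m) ∂P =
        ∫ ω, mF τ E0 V ω (F + A Xi.2) (cube d m) ∂P := fun Xi _ =>
      H.int_comp (fun ω => mF τ E0 V ω (F + A Xi.2) (cube d m))
        (H.mF_int (F + A Xi.2) m).aestronglyMeasurable _
    rw [Finset.sum_congr rfl this, hJ, Finset.sum_product]
    simp only [Finset.sum_const, card_bx, nsmul_eq_mul, Nat.cast_pow]
  -- bounds for the remaining sites
  set e : Zd d → ℝ := fun z => ∫ ω, ∑ b ∈ E0,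
        V b (τ z ω) ((‖toRd b‖)⁻¹ • (F (toRd b) + (w' (z + b) - w' z))) ∂P with he
  have hebd : ∀ z t, (∀ b ∈ E0, ‖F (toRd b) + (w' (z + b) - w' z)‖ ≤ t) →
      e z ≤ E0.card * Cv P E0 lam p c₁ t := by
    intro z t ht
    simp only [he]
    rw [integral_finsetSum _ fun b hb => H.V_int hb z _, ← nsmul_eq_mul]
    exact Finset.sum_le_card_nsmul _ _ _ fun b hb => H.EV_le hb z _ (ht b hb)
  have he0 : ∀ z, 0 ≤ e z := fun z => integral_nonneg fun ω =>
    Finset.sum_nonneg fun b hb => H.Vnn b hb _ _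
  have hsplit : ∑ z ∈ bx d Rb \ U, e z ≤
      ∑ z ∈ (bx d Rb \ U) ∩ inn d Rb (2 * k), e z + ∑ z ∈ bx d Rb \ inn d Rb (2 * k), e z := by
    rw [← Finset.sum_inter_add_sum_sdiff (bx d Rb \ U) (inn d Rb (2 * k)) e]
    refine add_le_add le_rfl (Finset.sum_le_sum_of_subset_of_nonneg ?_ fun z _ _ => he0 z)
    exact Finset.sdiff_subset_sdiff Finset.sdiff_subset le_rfl
  have hlay : ∑ z ∈ bx d Rb \ inn d Rb (2 * k), e z ≤
      d * (2 * (2 * k)) * (Rb:ℝ) ^ (d - 1) * (E0.card * Cv P E0 lam p c₁ C) := by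
    have hb : ∀ z ∈ bx d Rb \ inn d Rb (2 * k), e z ≤ E0.card * Cv P E0 lam p c₁ C := by
      intro z _
      refine hebd z C fun b hb => ?_
      calc _ ≤ ‖F (toRd b)‖ + (‖w' (z + b)‖ + ‖w' z‖) :=
            (norm_add_le _ _).trans (add_le_add le_rfl (norm_sub_le _ _))
        _ ≤ C := by linarith [hw'n (z + b), hw'n z, norm_G_le E0 F hb]
    refine (Finset.sum_le_card_nsmul _ _ _ hb).trans ?_
    rw [nsmul_eq_mul]
    refine mul_le_mul_of_nonneg_right ?_ (mul_nonneg (Nat.cast_nonneg _) (H.Cv_nonneg hC0))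
    rw [card_layer]
    have := layer_le d Rb (2 * k)
    push_cast at this ⊢
    exact this
  have hinn : ∑ z ∈ (bx d Rb \ U) ∩ inn d Rb (2 * k), e z ≤
      (q:ℝ) ^ d * ∑ z ∈ bx d k \ I.biUnion (fun i => cell m (c i)), E0.card * Cv P E0 lam p c₁ (T z) := by
    set S := bx d k \ I.biUnion (fun i => cell m (c i)) with hS
    set f : Zd d × Zd d → Zd d := fun Xy => o + k • Xy.1 + Xy.2 with hf
    have hinj : Set.InjOn f ((bx d q ×ˢ bx d k : Finset (Zd d × Zd d)) : Set (Zd d × Zd d)) := by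
      intro a ha b hb hab
      have ha' := Finset.mem_product.1 (Finset.mem_coe.1 ha)
      have hb' := Finset.mem_product.1 (Finset.mem_coe.1 hb)
      have hXY : a.1 = b.1 := by
        refine grid_unique (r := k) (m := k) le_rfl (s := o) (z := f a) ?_ ?_
        · simp only [hf]; rw [mem_cell, add_sub_cancel_left]; exact ha'.2
        · rw [hab]; simp only [hf]; rw [mem_cell, add_sub_cancel_left]; exact hb'.2
      simp only [hf, hXY] at hab
      exact Prod.ext hXY (add_left_cancel hab)
    set g : Zd d → ℝ := fun z => E0.card * Cv P E0 lam p c₁ (T z) with hg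
    have hTn : ∀ y ∈ bx d k, 0 ≤ T y := fun y hy =>
      (norm_nonneg _).trans (hT y hy (stdb ⟨0, H.hd⟩) (H.E0b _))
    have hrepr : ∀ z ∈ inn d Rb (2 * k), ∃ X ∈ bx d q, ∃ y ∈ bx d k, z = f (X, y) ∧
        ∀ b ∈ E0, w' (z + b) - w' z = w (y + b) - w y := by
      intro z hz
      rw [mem_inn] at hz
      have hkz : (0:ℤ) < k := by exact_mod_cast hk
      refine ⟨fun j => (z j - k) / k, ?_, pm k (z - o), pm_mem hk _, ?_, ?_⟩
      · rw [mem_bx]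
        intro j
        have h2 := hz j
        rw [hRbcast] at h2
        push_cast at h2
        constructor
        · exact Int.ediv_nonneg (by linarith [h2.1]) hkz.le
        · apply Int.ediv_lt_of_lt_mul hkz
          linarith [h2.2]
      · funext j
        simp only [hf, ho, pm, Pi.add_apply, Pi.sub_apply, nsmul_app]
        have := Int.emod_add_mul_ediv (z j - k) k
        linarith
      · intro b hb
        have hz1 : z - o ∈ bx d (q * k) := by
          rw [mem_bx]
          intro j
          have h2 := hz j
          rw [hRbcast] at h2
          push_cast at h2
          simp only [ho, Pi.sub_apply, Nat.cast_mul]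
          constructor <;> linarith [h2.1, h2.2]
        have hz2 : z + b - o ∈ bx d (q * k) := by
          rw [mem_bx]
          intro j
          have h2 := hz j
          rw [hRbcast] at h2
          push_cast at h2
          have h4 := abs_le.1 (coord_le_irange hb j)
          have h5 : b j < (k:ℤ) := by
            have : (b j : ℝ) < k := by linarith [h4.2]
            exact_mod_cast this
          have h6 : -(k:ℤ) < b j := by
            have : -(k:ℝ) < b j := by linarith [h4.1]
            exact_mod_cast this
          simp only [ho, Pi.sub_apply, Pi.add_apply, Nat.cast_mul]
          constructor <;> linarith [h2.1, h2.2]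
        simp only [hw', if_pos hz1, if_pos hz2]
        have hrep : ∀ x : Zd d, w (pm k (z - o) + x) = w (z + x) := by
          intro x
          rw [pm_eq]
          have : z - o + k • (fun j => -((z - o) j / k)) + x =
              z + x + k • ((fun _ => -1) + (fun j => -((z - o) j / k))) := by
            funext j
            simp only [ho, Pi.add_apply, Pi.sub_apply, nsmul_app]
            ring
          rw [this, hw]
        have h0 := hrep 0
        rw [add_zero, add_zero] at h0
        rw [hrep b, h0]
    have hsub : (bx d Rb \ U) ∩ inn d Rb (2 * k) ⊆
        (((bx d q ×ˢ S).image f).filter (fun z => z ∈ inn d Rb (2 * k))) := by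
      intro z hz
      rw [Finset.mem_inter, Finset.mem_sdiff] at hz
      obtain ⟨X, hX, y, hy, rfl, -⟩ := hrepr z hz.2
      rw [Finset.mem_filter]
      refine ⟨Finset.mem_image.2 ⟨(X, y), Finset.mem_product.2 ⟨hX, ?_⟩, rfl⟩, hz.2⟩
      rw [hS, Finset.mem_sdiff]
      refine ⟨hy, fun hmem => hz.1.2 ?_⟩
      obtain ⟨i, hi, hyi⟩ := Finset.mem_biUnion.1 hmem
      rw [hU]
      refine Finset.mem_biUnion.2 ⟨(X, i), Finset.mem_product.2 ⟨hX, hi⟩, ?_⟩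
      rw [mem_cell] at hyi ⊢
      have : f (X, y) - cc (X, i) = y - c i := by simp only [hf, hcc]; abel
      rw [this]; exact hyi
    have hSk : S ⊆ bx d k := Finset.sdiff_subset
    calc ∑ z ∈ (bx d Rb \ U) ∩ inn d Rb (2 * k), e z
        ≤ ∑ z ∈ ((bx d q ×ˢ S).image f).filter (fun z => z ∈ inn d Rb (2 * k)), e z :=
          Finset.sum_le_sum_of_subset_of_nonneg hsub fun z _ _ => he0 z
      _ = ∑ z ∈ (bx d q ×ˢ S).image f, if z ∈ inn d Rb (2 * k) then e z else 0 := by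
          rw [Finset.sum_filter]
      _ = ∑ Xy ∈ bx d q ×ˢ S, if f Xy ∈ inn d Rb (2 * k) then e (f Xy) else 0 := by
          refine Finset.sum_image (hinj.mono ?_)
          rw [Finset.coe_subset]
          exact Finset.product_subset_product_right hSk
      _ ≤ ∑ Xy ∈ bx d q ×ˢ S, g Xy.2 := by
          refine Finset.sum_le_sum fun Xy hXy => ?_
          have hXy' := Finset.mem_product.1 hXy
          split_ifs with hmem
          · obtain ⟨X, hX, y, hy, hfe, hd⟩ := hrepr _ hmem
            have heq : Xy = (X, y) := by
              refine hinj ?_ ?_ hfe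
              · exact Finset.mem_coe.2 (Finset.mem_product.2 ⟨hXy'.1, hSk hXy'.2⟩)
              · exact Finset.mem_coe.2 (Finset.mem_product.2 ⟨hX, hy⟩)
            subst heq
            refine hebd _ _ fun b hb => ?_
            rw [hd b hb]
            exact hT y hy b hb
          · exact mul_nonneg (Nat.cast_nonneg _) (H.Cv_nonneg (hTn _ (hSk hXy'.2)))
      _ = _ := by
          rw [Finset.sum_product]
          simp only [Finset.sum_const, card_bx, nsmul_eq_mul, Nat.cast_pow]
  rw [e1]
  have : (q:ℝ) ^ d * (∑ i ∈ I, ∫ ω, mF τ E0 V ω (F + A i) (cube d m) ∂P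
        + ∑ z ∈ bx d k \ I.biUnion (fun i => cell m (c i)), E0.card * Cv P E0 lam p c₁ (T z)) =
      (q:ℝ) ^ d * ∑ i ∈ I, ∫ ω, mF τ E0 V ω (F + A i) (cube d m) ∂P + (q:ℝ) ^ d *
        ∑ z ∈ bx d k \ I.biUnion (fun i => cell m (c i)), E0.card * Cv P E0 lam p c₁ (T z) := by
    ring
  rw [this]
  linarith

/-- upper bound of the homogenized density by periodic constructions -/
lemma Hyp.up (H : Hyp P τ E0 p c₁ V lam) (F : Rd d →L[ℝ] Rn n) {k m : ℕ}
    (hkR : irange d E0 < k) (w : Zd d → Rn n) (hw : Per k w) {ι : Type*} (I : Finset ι)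
    (c : ι → Zd d) (A : ι → Rd d →L[ℝ] Rn n)
    (hin : ∀ i ∈ I, cell m (c i) ⊆ bx d k)
    (hdisj : ∀ i ∈ I, ∀ j ∈ I, ∀ z, z ∈ cell m (c i) → z ∈ cell m (c j) → i = j)
    (hnb : ∀ i ∈ I, ∀ z ∈ cell m (c i), ∀ b ∈ E0, z + b ∈ bx d k)
    (haff : ∀ i ∈ I, ∀ z ∈ cell m (c i), ∀ b ∈ E0, w (z + b) - w z = A i (toRd b))
    (T : Zd d → ℝ) (hT : ∀ z ∈ bx d k, ∀ b ∈ E0, ‖F (toRd b) + (w (z + b) - w z)‖ ≤ T z) :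
    (k:ℝ) ^ d * W0 P τ E0 V F ≤ ∑ i ∈ I, ∫ ω, mF τ E0 V ω (F + A i) (cube d m) ∂P
        + ∑ z ∈ bx d k \ I.biUnion (fun i => cell m (c i)), E0.card * Cv P E0 lam p c₁ (T z) := by
  have hkR' : (0:ℝ) < k := lt_of_le_of_lt (irange_nonneg E0) hkR
  have hk : 0 < k := by exact_mod_cast hkR'
  set Tm := ∑ z ∈ bx d k, ‖w z‖ with hTmd
  have hTm : ∀ z, ‖w z‖ ≤ Tm := by
    intro z
    rw [← hw.pm z]
    exact Finset.single_le_sum (f := fun z => ‖w z‖) (fun _ _ => norm_nonneg _) (pm_mem hk z)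
  have hTn : ∀ y ∈ bx d k, 0 ≤ T y := fun y hy =>
    (norm_nonneg _).trans (hT y hy (stdb ⟨0, H.hd⟩) (H.E0b _))
  set S := ∑ i ∈ I, ∫ ω, mF τ E0 V ω (F + A i) (cube d m) ∂P
        + ∑ z ∈ bx d k \ I.biUnion (fun i => cell m (c i)), E0.card * Cv P E0 lam p c₁ (T z) with hS
  have hS0 : 0 ≤ S := by
    refine add_nonneg (Finset.sum_nonneg fun i _ => ?_) (Finset.sum_nonneg fun z hz => ?_)
    · exact integral_nonneg (μ := P) fun ω => H.mF_nonneg ω (F + A i) m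
    · exact mul_nonneg (Nat.cast_nonneg _) (H.Cv_nonneg (hTn _ (Finset.sdiff_subset hz)))
  set K := E0.card * Cv P E0 lam p c₁ (‖F‖ * irange d E0 + 2 * Tm) with hK
  refine le_of_all_inv (C := d * (2 * (2 * k)) * (k:ℝ) ^ (d - 1) * K) fun q => ?_
  have h1 := H.up_aux F hkR w hw I c A hin hdisj hnb haff T hT Tm hTm q
  have hRb : 0 < (q + 2) * k := by positivity
  have h2 := H.W0_le F hRb
  have hRbd : (0:ℝ) < (((q + 2) * k : ℕ):ℝ) ^ d := by positivity
  rw [le_inv_mul_iff₀ hRbd] at h2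
  have h3 := h2.trans h1
  rw [← hS, ← hK] at h3
  have hq2 : (0:ℝ) < ((q:ℝ) + 2) ^ d := by positivity
  have hqq : (q:ℝ) ^ d ≤ ((q:ℝ) + 2) ^ d := by gcongr; linarith
  push_cast at h3
  rw [mul_pow, mul_pow] at h3
  have h4 : (q:ℝ) ^ d * S ≤ ((q:ℝ) + 2) ^ d * S := by gcongr
  have h5 : ((q:ℝ) + 2) ^ d = ((q:ℝ) + 2) ^ (d - 1) * ((q:ℝ) + 2) := by
    rw [← pow_succ, Nat.sub_add_cancel H.hd]
  refine le_of_mul_le_mul_left ?_ hq2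
  have h6 : ((q:ℝ) + 2) ^ d * (S + d * (2 * (2 * k)) * (k:ℝ) ^ (d - 1) * K * ((q:ℝ) + 2)⁻¹) =
      ((q:ℝ) + 2) ^ d * S + d * (2 * (2 * k)) * (((q:ℝ) + 2) ^ (d - 1) * (k:ℝ) ^ (d - 1)) * K := by
    rw [mul_add]
    congr 1
    rw [h5]
    have : ((q:ℝ) + 2) ≠ 0 := by positivity
    field_simp
  rw [h6]
  linarith
end


/-- cutoff profile -/
def eta (t : ℝ) : ℝ := max 0 (min 1 (2 - t))

lemma eta_nonneg (t : ℝ) : 0 ≤ eta t := le_max_left _ _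
lemma eta_le_one (t : ℝ) : eta t ≤ 1 := max_le zero_le_one (min_le_left _ _)
lemma eta_one {t : ℝ} (h : t ≤ 1) : eta t = 1 := by
  unfold eta; rw [min_eq_left (by linarith)]; simp
lemma eta_zero {t : ℝ} (h : 2 ≤ t) : eta t = 0 := by
  unfold eta; rw [min_eq_right (by linarith)]; exact max_eq_left (by linarith)
lemma eta_lip (t u : ℝ) : |eta t - eta u| ≤ |t - u| := by
  unfold eta
  calc |max 0 (min 1 (2 - t)) - max 0 (min 1 (2 - u))| ≤ |min 1 (2 - t) - min 1 (2 - u)| := by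
        have := abs_max_sub_max_le_max 0 (min 1 (2 - t)) 0 (min 1 (2 - u))
        simpa using this
    _ ≤ |(2 - t) - (2 - u)| := by
        have := abs_min_sub_min_le_max 1 (2 - t) 1 (2 - u)
        simpa using this
    _ = |t - u| := by rw [abs_sub_comm]; congr 1; ring

/-- truncation in a normed space -/
def tr {X : Type*} [NormedAddCommGroup X] [NormedSpace ℝ X] (s : ℝ) (x : X) : X :=
  eta (‖x‖ / s) • x

section
variable {X : Type*} [NormedAddCommGroup X] [NormedSpace ℝ X]

lemma tr_id {s : ℝ} (hs : 0 < s) {x : X} (h : ‖x‖ ≤ s) : tr s x = x := by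
  unfold tr; rw [eta_one (by rwa [div_le_one hs]), one_smul]

lemma tr_zero {s : ℝ} (hs : 0 < s) {x : X} (h : 2 * s ≤ ‖x‖) : tr s x = 0 := by
  unfold tr; rw [eta_zero (by rwa [le_div_iff₀ hs]), zero_smul]

lemma tr_norm_le {s : ℝ} (hs : 0 < s) (x : X) : ‖tr s x‖ ≤ 2 * s := by
  by_cases h : 2 * s ≤ ‖x‖
  · rw [tr_zero hs h]; simp; linarith
  · push Not at h
    unfold tr
    rw [norm_smul, Real.norm_eq_abs, abs_of_nonneg (eta_nonneg _)]
    nlinarith [eta_nonneg (‖x‖ / s), eta_le_one (‖x‖ / s), norm_nonneg x]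

lemma tr_lip {s : ℝ} (hs : 0 < s) {x y : X} (hxy : ‖x‖ ≤ ‖y‖) :
    ‖tr s x - tr s y‖ ≤ 3 * ‖x - y‖ := by
  by_cases h : 2 * s ≤ ‖x‖
  · rw [tr_zero hs h, tr_zero hs (h.trans hxy)]; simp
  · push Not at h
    have e : tr s x - tr s y = eta (‖y‖ / s) • (x - y) + (eta (‖x‖ / s) - eta (‖y‖ / s)) • x := by
      unfold tr; module
    rw [e]
    have h1 : ‖eta (‖y‖ / s) • (x - y)‖ ≤ ‖x - y‖ := by
      rw [norm_smul, Real.norm_eq_abs, abs_of_nonneg (eta_nonneg _)]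
      nlinarith [eta_le_one (‖y‖ / s), norm_nonneg (x - y)]
    have h2 : ‖(eta (‖x‖ / s) - eta (‖y‖ / s)) • x‖ ≤ 2 * ‖x - y‖ := by
      rw [norm_smul, Real.norm_eq_abs]
      have h3 : |eta (‖x‖ / s) - eta (‖y‖ / s)| ≤ ‖x - y‖ / s := by
        refine (eta_lip _ _).trans ?_
        rw [← sub_div, abs_div, abs_of_pos hs]
        exact div_le_div_of_nonneg_right (abs_norm_sub_norm_le x y) hs.le
      calc _ ≤ ‖x - y‖ / s * (2 * s) := by gcongr
        _ = _ := by field_simp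
    linarith [norm_add_le (eta (‖y‖ / s) • (x - y)) ((eta (‖x‖ / s) - eta (‖y‖ / s)) • x)]

lemma geo_sum {a Y : ℝ} (ha : 0 < a) (hY : 0 ≤ Y) (N : ℕ) :
    (∑ i ∈ Finset.range N, if a * 2 ^ i ≤ Y then a * 2 ^ i else 0) ≤ 2 * Y ∧
    (∑ i ∈ Finset.range N, if a * 2 ^ i ≤ Y then a * 2 ^ i else 0) ≤ a * 2 ^ N := by
  induction N with
  | zero => simp; constructor <;> linarith
  | succ N ih =>
    rw [Finset.sum_range_succ]
    have h0 : (0:ℝ) < a * 2 ^ N := by positivity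
    have h1 : a * 2 ^ (N + 1) = a * 2 ^ N + a * 2 ^ N := by ring
    split_ifs with h
    · constructor <;> linarith [ih.2]
    · constructor <;> linarith [ih.1, ih.2]

lemma tr_sum_aux {p s0 : ℝ} (hp : 1 ≤ p) (hs0 : 0 < s0) (N : ℕ) {x y : X} (hxy : ‖x‖ ≤ ‖y‖) :
    ∑ i ∈ Finset.range N, (if ‖x‖ ≤ s0 * 2 ^ i ∧ ‖y‖ ≤ s0 * 2 ^ i then 0 else
      ‖tr (s0 * 2 ^ i) x - tr (s0 * 2 ^ i) y‖ ^ p) ≤ 8 * 4 ^ p * ‖x - y‖ ^ p := by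
  set δ := ‖x - y‖ with hδ
  have hp0 : 0 ≤ p := by linarith
  rcases (norm_nonneg (x - y)).eq_or_lt with h0 | hδ0
  · have : x = y := by rw [← sub_eq_zero]; exact norm_eq_zero.1 h0.symm
    subst this
    have : ∀ i ∈ Finset.range N, (if ‖x‖ ≤ s0 * 2 ^ i ∧ ‖x‖ ≤ s0 * 2 ^ i then 0 else
      ‖tr (s0 * 2 ^ i) x - tr (s0 * 2 ^ i) x‖ ^ p) = 0 := by
      intro i _
      rw [sub_self, norm_zero, Real.zero_rpow (by linarith)]
      simp
    rw [Finset.sum_congr rfl this]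
    simp only [Finset.sum_const_zero]
    positivity
  rw [← hδ] at hδ0
  set Y := ‖y‖ with hY
  have hY0 : 0 ≤ Y := norm_nonneg y
  rcases hY0.eq_or_lt with hYz | hYpos
  · have : ∀ i ∈ Finset.range N, (if ‖x‖ ≤ s0 * 2 ^ i ∧ Y ≤ s0 * 2 ^ i then 0 else
      ‖tr (s0 * 2 ^ i) x - tr (s0 * 2 ^ i) y‖ ^ p) = 0 := by
      intro i _
      have : (0:ℝ) < s0 * 2 ^ i := by positivity
      rw [if_pos ⟨by linarith, by linarith⟩]
    rw [Finset.sum_congr rfl this]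
    simp only [Finset.sum_const_zero]
    positivity
  have hterm : ∀ i ∈ Finset.range N, (if ‖x‖ ≤ s0 * 2 ^ i ∧ Y ≤ s0 * 2 ^ i then 0 else
      ‖tr (s0 * 2 ^ i) x - tr (s0 * 2 ^ i) y‖ ^ p) ≤
      4 ^ p * δ ^ p * (δ⁻¹ * (if s0 * 2 ^ i ≤ δ then s0 * 2 ^ i else 0)
        + 3 * Y⁻¹ * (if s0 * 2 ^ i ≤ Y then s0 * 2 ^ i else 0)) := by
    intro i _
    have hs : (0:ℝ) < s0 * 2 ^ i := by positivity
    set s := s0 * 2 ^ i with hsd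
    have hrhs1 : 0 ≤ δ⁻¹ * (if s ≤ δ then s else 0) := by
      refine mul_nonneg (by positivity) ?_
      split_ifs <;> linarith
    have hrhs2 : 0 ≤ 3 * Y⁻¹ * (if s ≤ Y then s else 0) := by
      refine mul_nonneg (by positivity) ?_
      split_ifs <;> linarith
    have hcoef : 0 ≤ (4:ℝ) ^ p * δ ^ p := by positivity
    by_cases hb : ‖x‖ ≤ s ∧ Y ≤ s
    · rw [if_pos hb]; positivity
    rw [if_neg hb]
    have hsY : s < Y := by
      by_contra hcon
      push Not at hcon
      exact hb ⟨hxy.trans hcon, hcon⟩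
    by_cases hx2 : 2 * s ≤ ‖x‖
    · rw [tr_zero hs hx2, tr_zero hs (hx2.trans hxy), sub_self, norm_zero,
        Real.zero_rpow (by linarith)]
      positivity
    push Not at hx2
    by_cases hsδ : s ≤ δ
    · have h1 : ‖tr s x - tr s y‖ ≤ 4 * s :=
        (norm_sub_le _ _).trans (by linarith [tr_norm_le hs x, tr_norm_le hs y])
      have h2 : ‖tr s x - tr s y‖ ^ p ≤ 4 ^ p * s ^ p := by
        rw [← Real.mul_rpow (by norm_num) hs.le]
        exact Real.rpow_le_rpow (norm_nonneg _) h1 hp0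
      have h3 : s ^ p ≤ δ ^ p * (δ⁻¹ * s) := by
        have e : s ^ p = δ ^ p * (δ⁻¹ * s) ^ p := by
          rw [← Real.mul_rpow hδ0.le (by positivity)]
          congr 1; field_simp
        rw [e]
        gcongr
        refine Real.rpow_le_self_of_le_one (by positivity) ?_ hp
        rw [inv_mul_le_iff₀ hδ0]; linarith
      rw [if_pos hsδ]
      calc _ ≤ 4 ^ p * s ^ p := h2
        _ ≤ 4 ^ p * (δ ^ p * (δ⁻¹ * s)) := by gcongr
        _ = 4 ^ p * δ ^ p * (δ⁻¹ * s) := by ring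
        _ ≤ _ := mul_le_mul_of_nonneg_left (by linarith) hcoef
    · push Not at hsδ
      have h1 : ‖tr s x - tr s y‖ ≤ 4 * δ := (tr_lip hs hxy).trans (by linarith)
      have h2 : ‖tr s x - tr s y‖ ^ p ≤ 4 ^ p * δ ^ p := by
        rw [← Real.mul_rpow (by norm_num) hδ0.le]
        exact Real.rpow_le_rpow (norm_nonneg _) h1 hp0
      have h3 : Y ≤ 3 * s := by
        have : Y ≤ ‖x‖ + δ := by
          have := norm_sub_le x (x - y)
          rw [sub_sub_cancel] at this
          exact this
        linarith
      have h4 : 1 ≤ 3 * Y⁻¹ * s := by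
        rw [mul_comm 3, mul_assoc, ← div_eq_inv_mul, le_div_iff₀ hYpos]
        linarith
      rw [if_pos hsY.le]
      calc _ ≤ 4 ^ p * δ ^ p * 1 := by rw [mul_one]; exact h2
        _ ≤ _ := mul_le_mul_of_nonneg_left (by linarith) hcoef
  refine (Finset.sum_le_sum hterm).trans ?_
  rw [← Finset.mul_sum, Finset.sum_add_distrib, ← Finset.mul_sum, ← Finset.mul_sum]
  have g1 := (geo_sum hs0 hδ0.le N).1
  have g2 := (geo_sum hs0 hY0 N).1
  have h1 : δ⁻¹ * (∑ i ∈ Finset.range N, if s0 * 2 ^ i ≤ δ then s0 * 2 ^ i else 0) ≤ 2 := by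
    rw [inv_mul_le_iff₀ hδ0]; linarith
  have h2 : 3 * Y⁻¹ * (∑ i ∈ Finset.range N, if s0 * 2 ^ i ≤ Y then s0 * 2 ^ i else 0) ≤ 6 := by
    rw [mul_assoc]
    have : Y⁻¹ * (∑ i ∈ Finset.range N, if s0 * 2 ^ i ≤ Y then s0 * 2 ^ i else 0) ≤ 2 := by
      rw [inv_mul_le_iff₀ hYpos]; linarith
    linarith
  calc _ ≤ 4 ^ p * δ ^ p * (2 + 6) := by gcongr
    _ = _ := by ring

lemma tr_sum {p s0 : ℝ} (hp : 1 ≤ p) (hs0 : 0 < s0) (N : ℕ) (x y : X) :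
    ∑ i ∈ Finset.range N, (if ‖x‖ ≤ s0 * 2 ^ i ∧ ‖y‖ ≤ s0 * 2 ^ i then 0 else
      ‖tr (s0 * 2 ^ i) x - tr (s0 * 2 ^ i) y‖ ^ p) ≤ 8 * 4 ^ p * ‖x - y‖ ^ p := by
  rcases le_total ‖x‖ ‖y‖ with h | h
  · exact tr_sum_aux hp hs0 N h
  · have := tr_sum_aux hp hs0 N h
    rw [norm_sub_rev x y]
    refine le_trans (le_of_eq ?_) this
    refine Finset.sum_congr rfl fun i _ => ?_
    rw [norm_sub_rev]; simp only [and_comm]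
end


lemma add_rpow_le {p a b : ℝ} (hp : 0 ≤ p) (ha : 0 ≤ a) (hb : 0 ≤ b) :
    (a + b) ^ p ≤ 2 ^ p * (a ^ p + b ^ p) := by
  have hm : 0 ≤ max a b := le_max_of_le_left ha
  have h1 : (a + b) ^ p ≤ (2 * max a b) ^ p :=
    Real.rpow_le_rpow (by positivity) (by linarith [le_max_left a b, le_max_right a b]) hp
  rw [Real.mul_rpow (by norm_num) hm] at h1
  refine h1.trans ?_
  have h2 : (max a b) ^ p ≤ a ^ p + b ^ p := by
    have := Real.rpow_nonneg ha p
    have := Real.rpow_nonneg hb p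
    rcases max_choice a b with h | h <;> rw [h] <;> linarith
  gcongr

lemma dist_add_le {E0 : Finset (Zd d)} {b : Zd d} (hb : b ∈ E0) (z : Zd d) :
    dist (z + b) z ≤ irange d E0 := by
  rw [dist_pi_le_iff (irange_nonneg E0)]
  intro j
  rw [Int.dist_eq]
  simp only [Pi.add_apply, Int.cast_add, add_sub_cancel_left]
  exact coord_le_irange hb j

lemma infDist_inn_ge {E0 : Finset (Zd d)} {m h : ℕ} (hmh : 2 * h < m) {z : Zd d}
    (hz : ¬ Deep E0 m z) : (h:ℝ) - irange d E0 ≤ infDist z (inn d m h : Set (Zd d)) := by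
  have hne : (inn d m h : Set (Zd d)).Nonempty := by
    refine ⟨fun _ => h, ?_⟩
    rw [Finset.mem_coe, mem_inn]
    intro j
    omega
  rw [le_infDist hne]
  intro y hy
  rw [Finset.mem_coe, mem_inn] at hy
  unfold Deep at hz
  push Not at hz
  obtain ⟨j, hj⟩ := hz
  have h1 : dist (z j) (y j) ≤ dist z y := dist_le_pi_dist z y j
  refine le_trans ?_ h1
  rw [Int.dist_eq]
  obtain ⟨h2, h3⟩ := hy j
  have h4 : (h:ℝ) ≤ y j := by exact_mod_cast h2
  have h5 : (y j:ℝ) < m - h := by exact_mod_cast h3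
  by_cases h6 : irange d E0 < (z j:ℝ)
  · have := hj h6
    refine le_trans ?_ (le_abs_self _)
    linarith
  · push Not at h6
    refine le_trans ?_ (neg_le_abs _)
    linarith

section
variable {P : Measure Ω} {τ : Zd d → Ω → Ω} {E0 : Finset (Zd d)} {p c₁ : ℝ}
    {V : Zd d → Ω → Rn n → ℝ} {lam : Zd d → Ω → ℝ}

/-- pair (deviation from affine map, scaled distance to inner box) -/
def vD (φ : Zd d → Rn n) (A : Rd d →L[ℝ] Rn n) (a : Rn n) (m h : ℕ) (z : Zd d) : Rn n × ℝ :=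
  (φ z - A (toRd z) - a, (1 + ‖A‖) * infDist z (inn d m h : Set (Zd d)))

/-- the edge `(z, z+b)` is affected by the truncation -/
def touched (φ : Zd d → Rn n) (A : Rd d →L[ℝ] Rn n) (a : Rn n) (m h : ℕ) (s0 : ℝ) (z b : Zd d) :
    Prop := ¬ (‖vD φ A a m h z‖ ≤ s0 ∧ ‖vD φ A a m h (z + b)‖ ≤ s0)

/-- constants of the cell inequality -/
def K0 (E0 : Finset (Zd d)) (F : Rd d →L[ℝ] Rn n) (p : ℝ) : ℝ := ((‖F‖ + 1) * irange d E0) ^ p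
def Kc1 (E0 : Finset (Zd d)) (F : Rd d →L[ℝ] Rn n) (p c₁ : ℝ) : ℝ := c₁ * (1 + 2 ^ p * K0 E0 F p)
def Kc2 (E0 : Finset (Zd d)) (F : Rd d →L[ℝ] Rn n) (p c₁ : ℝ) : ℝ :=
  c₁ * 2 ^ p * (8 * 4 ^ p) * 2 ^ p * (irange d E0 ^ p * (c₁ + c₁ ^ 2) + K0 E0 F p)

lemma K0_nonneg (E0 : Finset (Zd d)) (F : Rd d →L[ℝ] Rn n) (p : ℝ) : 0 ≤ K0 E0 F p := by
  unfold K0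
  have := irange_nonneg E0
  positivity

lemma Hyp.Kc1_nonneg (H : Hyp P τ E0 p c₁ V lam) (F : Rd d →L[ℝ] Rn n) : 0 ≤ Kc1 E0 F p c₁ := by
  have := H.hc₁
  have := K0_nonneg E0 F p
  unfold Kc1; positivity

lemma Hyp.Kc2_nonneg (H : Hyp P τ E0 p c₁ V lam) (F : Rd d →L[ℝ] Rn n) : 0 ≤ Kc2 E0 F p c₁ := by
  have := H.hc₁
  have := K0_nonneg E0 F p
  have := irange_nonneg E0
  unfold Kc2; positivity

lemma vD_sub (F : Rd d →L[ℝ] Rn n) (φ : Zd d → Rn n) (A : Rd d →L[ℝ] Rn n) (a : Rn n) (m h : ℕ)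
    {z b : Zd d} (hb : b ∈ E0) :
    ‖vD φ A a m h (z + b) - vD φ A a m h z‖ ≤
      ‖F (toRd b) + (φ (z + b) - φ z)‖ + (‖F‖ + 1) * irange d E0 * (1 + ‖A‖) := by
  have hR := irange_nonneg E0
  have hA := norm_nonneg A
  have hF := norm_nonneg F
  rw [Prod.norm_def]
  refine max_le ?_ ?_
  · have e : (vD φ A a m h (z + b) - vD φ A a m h z).1 =
        (F (toRd b) + (φ (z + b) - φ z)) - (F (toRd b) + A (toRd b)) := by
      simp only [vD, Prod.fst_sub, toRd_add, map_add]; abel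
    rw [e]
    refine (norm_sub_le _ _).trans (add_le_add le_rfl ((norm_add_le _ _).trans ?_))
    have h1 := norm_G_le E0 F hb
    have h2 := norm_G_le E0 A hb
    nlinarith [mul_nonneg (mul_nonneg hF hR) hA]
  · have e : (vD φ A a m h (z + b) - vD φ A a m h z).2 = (1 + ‖A‖) *
        (infDist (z + b) (inn d m h : Set (Zd d)) - infDist z (inn d m h : Set (Zd d))) := by
      simp only [vD, Prod.snd_sub]; ring
    rw [e, norm_mul, Real.norm_of_nonneg (by positivity)]
    have h1 : ‖infDist (z + b) (inn d m h : Set (Zd d)) - infDist z (inn d m h : Set (Zd d))‖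
        ≤ irange d E0 := by
      have h2 := infDist_le_infDist_add_dist (s := (inn d m h : Set (Zd d))) (x := z + b) (y := z)
      have h3 := infDist_le_infDist_add_dist (s := (inn d m h : Set (Zd d))) (x := z) (y := z + b)
      rw [dist_comm] at h3
      have h4 := dist_add_le hb z
      rw [Real.norm_eq_abs, abs_le]
      constructor <;> linarith
    have h2 := norm_nonneg (F (toRd b) + (φ (z + b) - φ z))
    nlinarith [mul_nonneg (mul_nonneg hF hR) (by linarith : (0:ℝ) ≤ 1 + ‖A‖),
      mul_le_mul_of_nonneg_left h1 (by linarith : (0:ℝ) ≤ 1 + ‖A‖)]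

lemma Hyp.edge (H : Hyp P τ E0 p c₁ V lam) (F : Rd d →L[ℝ] Rn n) (ω : Ω)
    (A : Rd d →L[ℝ] Rn n) (a : Rn n) (φ : Zd d → Rn n) (m h N : ℕ) {s0 : ℝ} (hs0 : 0 < s0)
    {b : Zd d} (hb : b ∈ E0) (z : Zd d) :
    ∑ i ∈ Finset.range N, V b ω ((‖toRd b‖)⁻¹ • ((F + A) (toRd b) +
      ((tr (s0 * 2 ^ i) (vD φ A a m h (z + b))).1 - (tr (s0 * 2 ^ i) (vD φ A a m h z)).1)))
    ≤ N * V b ω ((‖toRd b‖)⁻¹ • (F (toRd b) + (φ (z + b) - φ z)))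
      + N * (Kc1 E0 F p c₁ * (1 + ‖A‖) ^ p * (if touched φ A a m h s0 z b then 1 + lam b ω else 0))
      + Kc2 E0 F p c₁ * (V b ω ((‖toRd b‖)⁻¹ • (F (toRd b) + (φ (z + b) - φ z)))
        + (1 + ‖A‖) ^ p * lam b ω) := by
  have hp1 := H.hp
  have hp0 : 0 ≤ p := by linarith
  have hc := H.hc₁
  have hR := irange_nonneg E0
  have hA := norm_nonneg A
  have hF := norm_nonneg F
  have hl := H.lamnn b hb ω
  have hK0 := K0_nonneg E0 F p
  set M := 1 + ‖A‖ with hM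
  have hM1 : 1 ≤ M := by linarith
  have hMp : 1 ≤ M ^ p := Real.one_le_rpow hM1 hp0
  set T0 := (‖F‖ + 1) * irange d E0 * M with hT0
  have hT00 : 0 ≤ T0 := by positivity
  have hT0p : T0 ^ p = K0 E0 F p * M ^ p := by
    rw [hT0, Real.mul_rpow (by positivity) (by positivity)]; rfl
  set u := F (toRd b) + (φ (z + b) - φ z) with hu
  set Vφ := V b ω ((‖toRd b‖)⁻¹ • u) with hVφ
  have hV0 : 0 ≤ Vφ := H.Vnn b hb _ _
  set x := vD φ A a m h (z + b) with hx
  set y := vD φ A a m h z with hy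
  have hterm : ∀ i ∈ Finset.range N, V b ω ((‖toRd b‖)⁻¹ • ((F + A) (toRd b) +
      ((tr (s0 * 2 ^ i) x).1 - (tr (s0 * 2 ^ i) y).1))) ≤
      (Vφ + Kc1 E0 F p c₁ * M ^ p * (if touched φ A a m h s0 z b then 1 + lam b ω else 0)) +
      c₁ * lam b ω * 2 ^ p * (if ‖x‖ ≤ s0 * 2 ^ i ∧ ‖y‖ ≤ s0 * 2 ^ i then 0 else
      ‖tr (s0 * 2 ^ i) x - tr (s0 * 2 ^ i) y‖ ^ p) := by
    intro i _
    have hs : (0:ℝ) < s0 * 2 ^ i := by positivity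
    have hss : s0 ≤ s0 * 2 ^ i := le_mul_of_one_le_right hs0.le (one_le_pow₀ (by norm_num))
    by_cases hbo : ‖x‖ ≤ s0 * 2 ^ i ∧ ‖y‖ ≤ s0 * 2 ^ i
    · rw [if_pos hbo, mul_zero, add_zero, tr_id hs hbo.1, tr_id hs hbo.2]
      have e : (F + A) (toRd b) + (x.1 - y.1) = u := by
        simp only [hx, hy, vD, hu, toRd_add, map_add, add_apply]; abel
      rw [e]
      have : 0 ≤ Kc1 E0 F p c₁ * M ^ p * (if touched φ A a m h s0 z b then 1 + lam b ω else 0) := by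
        have := H.Kc1_nonneg F
        split_ifs
        · positivity
        · simp
      linarith
    · have ht : touched φ A a m h s0 z b := by
        intro hcon
        exact hbo ⟨hcon.2.trans hss, hcon.1.trans hss⟩
      rw [if_neg hbo, if_pos ht]
      set D := ‖tr (s0 * 2 ^ i) x - tr (s0 * 2 ^ i) y‖ with hD
      have hD0 : 0 ≤ D := norm_nonneg _
      have h1 : ‖(F + A) (toRd b) + ((tr (s0 * 2 ^ i) x).1 - (tr (s0 * 2 ^ i) y).1)‖ ≤ T0 + D := by
        refine (norm_add_le _ _).trans (add_le_add ?_ ?_)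
        · refine (norm_G_le E0 (F + A) hb).trans ?_
          have := norm_add_le F A
          have : ‖F + A‖ * irange d E0 ≤ (‖F‖ + ‖A‖) * irange d E0 := by gcongr
          refine this.trans ?_
          rw [hT0]
          nlinarith [mul_nonneg (mul_nonneg hF hR) hA]
        · exact norm_fst_le (tr (s0 * 2 ^ i) x - tr (s0 * 2 ^ i) y)
      have h2 := H.V_le hb ω _ h1
      have h3 := add_rpow_le hp0 hT00 hD0
      have h4 : c₁ * (1 + lam b ω * ((T0 + D) ^ p + 1)) ≤
          c₁ * (1 + lam b ω * (2 ^ p * (T0 ^ p + D ^ p) + 1)) := by gcongr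
      have h5 : c₁ * (1 + lam b ω * (2 ^ p * (T0 ^ p + D ^ p) + 1)) ≤
          Kc1 E0 F p c₁ * M ^ p * (1 + lam b ω) + c₁ * lam b ω * 2 ^ p * D ^ p := by
        rw [hT0p]; unfold Kc1
        have h6 : (0:ℝ) ≤ 2 ^ p := by positivity
        have e : c₁ * (1 + lam b ω * (2 ^ p * (K0 E0 F p * M ^ p + D ^ p) + 1)) =
          c₁ * (1 + lam b ω) + c₁ * (2 ^ p * K0 E0 F p * M ^ p) * lam b ω
            + c₁ * lam b ω * 2 ^ p * D ^ p := by ring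
        rw [e]
        have e2 : c₁ * (1 + 2 ^ p * K0 E0 F p) * M ^ p * (1 + lam b ω) =
          c₁ * (1 + lam b ω) * M ^ p + c₁ * (2 ^ p * K0 E0 F p * M ^ p) * lam b ω
            + c₁ * (2 ^ p * K0 E0 F p * M ^ p) := by ring
        rw [e2]
        have h7 : c₁ * (1 + lam b ω) ≤ c₁ * (1 + lam b ω) * M ^ p :=
          le_mul_of_one_le_right (by positivity) hMp
        have h8 : 0 ≤ c₁ * (2 ^ p * K0 E0 F p * M ^ p) := by positivity
        linarith
      linarith
  refine (Finset.sum_le_sum hterm).trans ?_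
  rw [Finset.sum_add_distrib, Finset.sum_const, Finset.card_range, nsmul_eq_mul, ← Finset.mul_sum]
  have hsum := tr_sum hp1.le hs0 N x y
  have hxy : ‖x - y‖ ≤ ‖u‖ + T0 := vD_sub F φ A a m h hb
  have h1 : ‖x - y‖ ^ p ≤ 2 ^ p * (‖u‖ ^ p + T0 ^ p) :=
    (Real.rpow_le_rpow (norm_nonneg _) hxy hp0).trans (add_rpow_le hp0 (norm_nonneg _) hT00)
  have hnb := H.one_le_norm hb
  have h2 : lam b ω * ‖u‖ ^ p ≤ irange d E0 ^ p * ((c₁ + c₁ ^ 2) * (Vφ + M ^ p * lam b ω)) := by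
    have hlo := H.lo b hb ω ((‖toRd b‖)⁻¹ • u)
    rw [← hVφ] at hlo
    set r := ‖(‖toRd b‖)⁻¹ • u‖ with hr
    have hr0 : 0 ≤ r := norm_nonneg _
    have hur : ‖u‖ ≤ irange d E0 * r := by
      have : ‖u‖ = ‖toRd b‖ * r := by
        rw [hr, norm_smul, norm_inv, norm_norm]; field_simp
      rw [this]
      have := norm_le_irange hb
      gcongr
    have h3 : ‖u‖ ^ p ≤ irange d E0 ^ p * r ^ p := by
      rw [← Real.mul_rpow hR hr0]
      exact Real.rpow_le_rpow (norm_nonneg _) hur hp0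
    have h4 : lam b ω * r ^ p ≤ c₁ * Vφ + c₁ ^ 2 * lam b ω := by
      have e : lam b ω * (r ^ p / c₁ - c₁) = (lam b ω * r ^ p) / c₁ - lam b ω * c₁ := by ring
      rw [e] at hlo
      have : (lam b ω * r ^ p) / c₁ ≤ Vφ + lam b ω * c₁ := by linarith
      rw [div_le_iff₀ hc] at this
      nlinarith
    have h5 : c₁ * Vφ + c₁ ^ 2 * lam b ω ≤ (c₁ + c₁ ^ 2) * (Vφ + M ^ p * lam b ω) := by
      have : lam b ω ≤ M ^ p * lam b ω := le_mul_of_one_le_left hl hMp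
      have h6 : c₁ ^ 2 * lam b ω ≤ c₁ ^ 2 * (M ^ p * lam b ω) := by gcongr
      have h7 : 0 ≤ c₁ * (M ^ p * lam b ω) := by positivity
      have h8 : 0 ≤ c₁ ^ 2 * Vφ := by positivity
      nlinarith
    calc lam b ω * ‖u‖ ^ p ≤ lam b ω * (irange d E0 ^ p * r ^ p) := by gcongr
      _ = irange d E0 ^ p * (lam b ω * r ^ p) := by ring
      _ ≤ _ := mul_le_mul_of_nonneg_left (h4.trans h5) (by positivity)
  have h3 : c₁ * lam b ω * 2 ^ p * (8 * 4 ^ p * ‖x - y‖ ^ p) ≤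
      Kc2 E0 F p c₁ * (Vφ + M ^ p * lam b ω) := by
    calc c₁ * lam b ω * 2 ^ p * (8 * 4 ^ p * ‖x - y‖ ^ p)
        ≤ c₁ * lam b ω * 2 ^ p * (8 * 4 ^ p * (2 ^ p * (‖u‖ ^ p + T0 ^ p))) := by gcongr
      _ = c₁ * 2 ^ p * (8 * 4 ^ p) * 2 ^ p * (lam b ω * ‖u‖ ^ p + lam b ω * T0 ^ p) := by ring
      _ ≤ c₁ * 2 ^ p * (8 * 4 ^ p) * 2 ^ p *
          (irange d E0 ^ p * ((c₁ + c₁ ^ 2) * (Vφ + M ^ p * lam b ω)) +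
            K0 E0 F p * (Vφ + M ^ p * lam b ω)) := by
          refine mul_le_mul_of_nonneg_left (add_le_add h2 ?_) (by positivity)
          rw [hT0p]
          have : 0 ≤ K0 E0 F p * Vφ := by positivity
          nlinarith
      _ = _ := by unfold Kc2; ring
  have h4 : c₁ * lam b ω * 2 ^ p * ∑ i ∈ Finset.range N,
      (if ‖x‖ ≤ s0 * 2 ^ i ∧ ‖y‖ ≤ s0 * 2 ^ i then 0 else
      ‖tr (s0 * 2 ^ i) x - tr (s0 * 2 ^ i) y‖ ^ p) ≤
      c₁ * lam b ω * 2 ^ p * (8 * 4 ^ p * ‖x - y‖ ^ p) := by gcongr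
  rw [mul_add]
  linarith

/-- the cell inequality -/
lemma Hyp.cell_ineq (H : Hyp P τ E0 p c₁ V lam) (F : Rd d →L[ℝ] Rn n) (ω : Ω)
    (A : Rd d →L[ℝ] Rn n) (a : Rn n) (φ : Zd d → Rn n) {m h N : ℕ} (hN : 0 < N) {s0 : ℝ}
    (hs0 : 0 < s0) (hmh : 2 * h < m) (hsN : s0 * 2 ^ N ≤ (1 + ‖A‖) * (h - irange d E0)) :
    mF τ E0 V ω (F + A) (cube d m) ≤ (1 + Kc2 E0 F p c₁ / N) * en τ E0 V ω F φ m
      + Kc2 E0 F p c₁ / N * ((1 + ‖A‖) ^ p * ∑ z ∈ bx d m, ∑ b ∈ E0, lam b (τ z ω))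
      + Kc1 E0 F p c₁ * ((1 + ‖A‖) ^ p * ∑ z ∈ bx d m, ∑ b ∈ E0,
          if touched φ A a m h s0 z b then 1 + lam b (τ z ω) else 0) := by
  have hNR : (0:ℝ) < N := by exact_mod_cast hN
  have hadm : ∀ i ∈ Finset.range N, mF τ E0 V ω (F + A) (cube d m) ≤
      en τ E0 V ω (F + A) (fun z => (tr (s0 * 2 ^ i) (vD φ A a m h z)).1) m := by
    intro i hi
    refine H.mF_le ω (F + A) m _ fun z hz => ?_
    have hs : (0:ℝ) < s0 * 2 ^ i := by positivity
    have h1 := infDist_inn_ge hmh hz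
    have h2 : 2 * (s0 * 2 ^ i) ≤ ‖vD φ A a m h z‖ := by
      refine le_trans ?_ (norm_snd_le _)
      have e : ‖(vD φ A a m h z).2‖ = (1 + ‖A‖) * infDist z (inn d m h : Set (Zd d)) := by
        simp only [vD]
        exact Real.norm_of_nonneg (mul_nonneg (by positivity) infDist_nonneg)
      rw [e]
      have h3 : (2:ℝ) ^ (i + 1) ≤ 2 ^ N := pow_le_pow_right₀ (by norm_num) (Finset.mem_range.1 hi)
      calc 2 * (s0 * 2 ^ i) = s0 * 2 ^ (i + 1) := by ring
        _ ≤ s0 * 2 ^ N := by gcongr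
        _ ≤ _ := hsN
        _ ≤ _ := by gcongr
    show (tr (s0 * 2 ^ i) (vD φ A a m h z)).1 = 0
    rw [tr_zero hs h2]; rfl
  have h1 : N * mF τ E0 V ω (F + A) (cube d m) ≤ ∑ i ∈ Finset.range N,
      en τ E0 V ω (F + A) (fun z => (tr (s0 * 2 ^ i) (vD φ A a m h z)).1) m := by
    have := Finset.card_nsmul_le_sum _ _ _ hadm
    rwa [Finset.card_range, nsmul_eq_mul] at this
  have h2 : ∑ i ∈ Finset.range N,
      en τ E0 V ω (F + A) (fun z => (tr (s0 * 2 ^ i) (vD φ A a m h z)).1) m ≤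
      N * en τ E0 V ω F φ m + N * (Kc1 E0 F p c₁ * ((1 + ‖A‖) ^ p * ∑ z ∈ bx d m, ∑ b ∈ E0,
          if touched φ A a m h s0 z b then 1 + lam b (τ z ω) else 0))
      + Kc2 E0 F p c₁ * (en τ E0 V ω F φ m
        + (1 + ‖A‖) ^ p * ∑ z ∈ bx d m, ∑ b ∈ E0, lam b (τ z ω)) := by
    unfold en
    rw [Finset.sum_comm]
    simp only [Finset.mul_sum, ← Finset.sum_add_distrib]
    refine Finset.sum_le_sum fun z _ => ?_
    rw [Finset.sum_comm]
    refine Finset.sum_le_sum fun b hb => ?_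
    have := H.edge F (τ z ω) A a φ m h N hs0 hb z
    refine this.trans (le_of_eq ?_)
    ring
  refine le_of_mul_le_mul_left ((h1.trans h2).trans (le_of_eq ?_)) hNR
  field_simp
  ring
end


/-- with high probability as `k → ∞` -/
def WHP (P : Measure Ω) (Q : ℕ → Ω → Prop) : Prop :=
  Tendsto (fun k => P {ω | ¬ Q k ω}) atTop (𝓝 0)

section
variable {P : Measure Ω}

lemma WHP.mono {Q Q' : ℕ → Ω → Prop} (h : WHP P Q) (hQ : ∀ᶠ k in atTop, ∀ ω, Q k ω → Q' k ω) :
    WHP P Q' := by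
  refine tendsto_of_tendsto_of_tendsto_of_le_of_le' tendsto_const_nhds h
    (Eventually.of_forall fun _ => zero_le) ?_
  filter_upwards [hQ] with k hk
  exact measure_mono fun ω hω h1 => hω (hk ω h1)

lemma WHP.and {Q Q' : ℕ → Ω → Prop} (h : WHP P Q) (h' : WHP P Q') :
    WHP P (fun k ω => Q k ω ∧ Q' k ω) := by
  have h2 := h.add h'
  rw [add_zero] at h2
  refine tendsto_of_tendsto_of_tendsto_of_le_of_le tendsto_const_nhds h2
    (fun _ => zero_le) (fun k => ?_)
  refine (measure_mono (t := {ω | ¬ Q k ω} ∪ {ω | ¬ Q' k ω}) ?_).trans (measure_union_le _ _)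
  intro ω hω
  by_contra hcon
  simp only [Set.mem_union, Set.mem_ofPred_eq, not_or, not_not] at hcon hω
  exact hω hcon

lemma WHP.of_ae {Q : ℕ → Ω → Prop} (h : ∀ k, ∀ᵐ ω ∂P, Q k ω) : WHP P Q := by
  have : (fun k => P {ω | ¬ Q k ω}) = fun _ => 0 := funext fun k => h k
  unfold WHP
  rw [this]
  exact tendsto_const_nhds

lemma WHP.finset {ι : Type*} (s : Finset ι) {Q : ι → ℕ → Ω → Prop} (h : ∀ i ∈ s, WHP P (Q i)) :
    WHP P (fun k ω => ∀ i ∈ s, Q i k ω) := by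
  induction s using Finset.induction_on with
  | empty => exact WHP.of_ae fun k => by simp
  | insert a s ha ih =>
    have h1 := ih fun i hi => h i (Finset.mem_insert_of_mem hi)
    have h2 := h a (Finset.mem_insert_self _ _)
    refine (h2.and h1).mono (Eventually.of_forall fun k ω hk i hi => ?_)
    rcases Finset.mem_insert.1 hi with rfl | hi
    · exact hk.1
    · exact hk.2 i hi
end

section
variable {P : Measure Ω} {τ : Zd d → Ω → Ω} {E0 : Finset (Zd d)} {p c₁ : ℝ}
    {V : Zd d → Ω → Rn n → ℝ} {lam : Zd d → Ω → ℝ}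

lemma Hyp.whp_shift (H : Hyp P τ E0 p c₁ V lam) {Q : ℕ → Ω → Prop} (h : WHP P Q) {m : ℕ → ℕ}
    (hm : Tendsto m atTop atTop) (c : ℕ → Zd d) :
    WHP P (fun k ω => Q (m k) (τ (c k) ω)) := by
  have h1 := h.comp hm
  refine tendsto_of_tendsto_of_tendsto_of_le_of_le tendsto_const_nhds h1
    (fun _ => zero_le) (fun k => ?_)
  set S := {ω | ¬ Q (m k) ω} with hS
  have : {ω | ¬ Q (m k) (τ (c k) ω)} ⊆ τ (c k) ⁻¹' (toMeasurable P S) := fun ω hω =>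
    subset_toMeasurable P S hω
  refine (measure_mono this).trans ?_
  rw [(H.τmp (c k)).measure_preimage (measurableSet_toMeasurable P S).nullMeasurableSet,
    measure_toMeasurable]
  exact le_rfl

lemma Hyp.whp_sum_le (H : Hyp P τ E0 p c₁ V lam) (g : Ω → ℝ) (hg : Integrable g P) {B : ℝ}
    (hB : ∫ ω, g ω ∂P < B) : WHP P (fun m ω => ∑ z ∈ bx d m, g (τ z ω) ≤ B * (m:ℝ) ^ d) := by
  have h : WHP P (fun m ω => |avg τ g m ω - ∫ x, g x ∂P| < B - ∫ ω, g ω ∂P) := by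
    have := H.mean_prob g hg (sub_pos.2 hB)
    unfold WHP
    simpa only [not_lt] using this
  refine h.mono ?_
  filter_upwards [eventually_gt_atTop 0] with m hm ω hω
  have h1 := (abs_lt.1 hω).2
  have h2 : avg τ g m ω < B := by linarith
  unfold avg at h2
  have hm' : (0:ℝ) < (m:ℝ) ^ d := by positivity
  rw [inv_mul_lt_iff₀ hm'] at h2
  linarith

lemma vD_norm_inn {φ : Zd d → Rn n} {A : Rd d →L[ℝ] Rn n} {a : Rn n} {m h : ℕ} {z : Zd d}
    (hz : z ∈ inn d m h) : ‖vD φ A a m h z‖ = ‖φ z - A (toRd z) - a‖ := by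
  unfold vD
  rw [infDist_zero_of_mem (Finset.mem_coe.2 hz), mul_zero, Prod.norm_def]
  simp

lemma inn_add {m h R0 : ℕ} (hR0 : irange d E0 ≤ R0) {z b : Zd d} (hb : b ∈ E0)
    (hz : z ∈ inn d m (h + R0)) : z + b ∈ inn d m h := by
  rw [mem_inn] at *
  intro j
  have h1 := hz j
  have h2 : |(b j:ℝ)| ≤ (R0:ℝ) := (coord_le_irange hb j).trans hR0
  have h3 : |b j| ≤ (R0:ℤ) := by exact_mod_cast h2
  rw [abs_le] at h3
  push_cast at h1
  simp only [Pi.add_apply]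
  constructor <;> linarith [h1.1, h1.2, h3.1, h3.2]

lemma touched_sum {φ : Zd d → Rn n} {A : Rd d →L[ℝ] Rn n} {a : Rn n} {m h R0 : ℕ}
    (hR0 : irange d E0 ≤ R0) {s0 : ℝ} (hs0 : 0 < s0) {b : Zd d} (hb : b ∈ E0) {K : ℝ} (hK : 0 ≤ K)
    (g : Zd d → ℝ) (hg : ∀ z, 0 ≤ g z) :
    ∑ z ∈ bx d m, (if touched φ A a m h s0 z b then 1 + g z else 0) ≤
      (1 + K) * (((bx d m \ inn d m (h + R0)).card : ℝ) +
        2 * s0⁻¹ * ∑ z ∈ bx d m, ‖φ z - A (toRd z) - a‖) +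
      ∑ z ∈ bx d m, (if K < g z then g z else 0) := by
  set v : Zd d → ℝ := fun z => ‖φ z - A (toRd z) - a‖ with hv
  have hv0 : ∀ z, 0 ≤ v z := fun z => norm_nonneg _
  have hs' : 0 < s0⁻¹ := inv_pos.2 hs0
  have hone : ∀ z, s0 < v z → 1 ≤ s0⁻¹ * v z := by
    intro z hz
    rw [inv_mul_eq_div, le_div_iff₀ hs0]; linarith
  have hpt : ∀ z ∈ bx d m, (if touched φ A a m h s0 z b then 1 + g z else 0) ≤
      (1 + K) * ((if z ∈ inn d m (h + R0) then 0 else 1) + s0⁻¹ * v z +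
        (if z ∈ inn d m (h + R0) then s0⁻¹ * v (z + b) else 0)) +
        (if K < g z then g z else 0) := by
    intro z hz
    have h0 : 0 ≤ (if z ∈ inn d m (h + R0) then s0⁻¹ * v (z + b) else 0) := by
      split_ifs
      · exact mul_nonneg hs'.le (hv0 _)
      · exact le_rfl
    have h0' : (0:ℝ) ≤ (if z ∈ inn d m (h + R0) then 0 else 1) := by split_ifs <;> norm_num
    have h0'' : 0 ≤ (if K < g z then g z else 0) := by
      split_ifs
      · exact hg z
      · exact le_rfl
    have h1 : 0 ≤ s0⁻¹ * v z := mul_nonneg hs'.le (hv0 _)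
    by_cases ht : touched φ A a m h s0 z b
    swap
    · rw [if_neg ht]; positivity
    rw [if_pos ht]
    have hcount : 1 ≤ ((if z ∈ inn d m (h + R0) then (0:ℝ) else 1) + s0⁻¹ * v z +
        (if z ∈ inn d m (h + R0) then s0⁻¹ * v (z + b) else 0)) := by
      by_cases hi : z ∈ inn d m (h + R0)
      · rw [if_pos hi, if_pos hi]
        have hz1 : z ∈ inn d m h := by
          rw [mem_inn] at *
          intro j
          have := hi j
          push_cast at this
          constructor <;> omega
        have hz2 := inn_add hR0 hb hi
        have ht' : ¬ (v z ≤ s0 ∧ v (z + b) ≤ s0) := by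
          unfold touched at ht
          rw [vD_norm_inn hz1, vD_norm_inn hz2] at ht
          exact ht
        by_cases hz3 : v z ≤ s0
        · have hz4 : s0 < v (z + b) := by
            by_contra hcon
            exact ht' (And.intro hz3 (not_lt.1 hcon))
          linarith [hone _ hz4]
        · have := mul_nonneg hs'.le (hv0 (z + b))
          linarith [hone _ (not_le.1 hz3)]
      · rw [if_neg hi, if_neg hi]; linarith
    have h5 := mul_le_mul_of_nonneg_left hcount (by linarith : 0 ≤ 1 + K)
    have h6 : g z ≤ K + (if K < g z then g z else 0) := by
      split_ifs with h7
      · linarith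
      · linarith
    linarith
  refine (Finset.sum_le_sum hpt).trans ?_
  rw [Finset.sum_add_distrib, ← Finset.mul_sum, Finset.sum_add_distrib, Finset.sum_add_distrib,
    ← Finset.mul_sum]
  have e1 : ∑ z ∈ bx d m, (if z ∈ inn d m (h + R0) then (0:ℝ) else 1) =
      ((bx d m \ inn d m (h + R0)).card : ℝ) := by
    rw [Finset.card_eq_sum_ones, Nat.cast_sum, Finset.sdiff_eq_filter, Finset.sum_filter]
    refine Finset.sum_congr rfl fun z _ => ?_
    split_ifs <;> simp
  have e2 : ∑ z ∈ bx d m, (if z ∈ inn d m (h + R0) then s0⁻¹ * v (z + b) else 0) ≤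
      s0⁻¹ * ∑ z ∈ bx d m, v z := by
    rw [← Finset.sum_filter, ← Finset.mul_sum]
    refine mul_le_mul_of_nonneg_left ?_ hs'.le
    have : ∑ z ∈ (bx d m).filter (fun z => z ∈ inn d m (h + R0)), v (z + b) =
        ∑ z ∈ ((bx d m).filter (fun z => z ∈ inn d m (h + R0))).map (addRightEmbedding b), v z := by
      rw [Finset.sum_map]; rfl
    rw [this]
    refine Finset.sum_le_sum_of_subset_of_nonneg ?_ fun z _ _ => hv0 z
    intro y hy
    rw [Finset.mem_map] at hy
    obtain ⟨z, hz, rfl⟩ := hy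
    exact inn_subset d m h (inn_add hR0 hb (Finset.mem_filter.1 hz).2)
  rw [e1]
  have hfin : ∀ c x y w : ℝ, 0 ≤ 1 + K → w ≤ s0⁻¹ * x →
      (1 + K) * (c + s0⁻¹ * x + w) + y ≤ (1 + K) * (c + 2 * s0⁻¹ * x) + y := by
    intro c x y w h1 h2
    have := mul_le_mul_of_nonneg_left h2 h1
    nlinarith
  exact hfin _ _ _ _ (by linarith) e2
end

/-- path lemma -/
lemma path_le {X : Type*} [SeminormedAddCommGroup X] (u : Zd d → X) (c : Zd d) {ρ σ : ℝ} (hσ : 0 ≤ σ)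
    (hu : ∀ z j, dist z c ≤ ρ → ‖u (z + stdb j) - u z‖ ≤ σ) :
    ∀ (N : ℕ) (z : Zd d), dist z c ≤ ρ → ∑ j, (z j - c j).natAbs = N → ‖u z - u c‖ ≤ N * σ := by
  intro N
  induction N with
  | zero =>
    intro z _ hN
    have : z = c := by
      funext j
      have := (Finset.sum_eq_zero_iff.1 hN) j (Finset.mem_univ j)
      omega
    rw [this]; simp
  | succ N ih =>
    intro z hz hN
    have hρ : 0 ≤ ρ := dist_nonneg.trans hz
    obtain ⟨j, _, hj⟩ : ∃ j ∈ Finset.univ, (z j - c j).natAbs ≠ 0 := by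
      apply Finset.exists_ne_zero_of_sum_ne_zero
      rw [hN]; omega
    have hst : ∀ i, (stdb j : Zd d) i = if i = j then 1 else 0 := by
      intro i; simp [stdb]
    have hsum : ∀ y : Zd d, (∀ i, i ≠ j → y i = z i) → (y j - c j).natAbs + 1 = (z j - c j).natAbs →
        ∑ i, (y i - c i).natAbs = N := by
      intro y hy hyj
      have h1 := Finset.add_sum_erase Finset.univ (fun i => (y i - c i).natAbs) (Finset.mem_univ j)
      have h2 := Finset.add_sum_erase Finset.univ (fun i => (z i - c i).natAbs) (Finset.mem_univ j)
      have h3 : ∑ i ∈ Finset.univ.erase j, (y i - c i).natAbs =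
          ∑ i ∈ Finset.univ.erase j, (z i - c i).natAbs :=
        Finset.sum_congr rfl fun i hi => by rw [hy i (Finset.ne_of_mem_erase hi)]
      omega
    have hdist : ∀ y : Zd d, (∀ i, i ≠ j → y i = z i) → (y j - c j).natAbs + 1 = (z j - c j).natAbs →
        dist y c ≤ ρ := by
      intro y hy hyj
      rw [dist_pi_le_iff hρ] at hz ⊢
      intro i
      by_cases hi : i = j
      · subst hi
        refine le_trans ?_ (hz i)
        rw [Int.dist_eq, Int.dist_eq, ← Int.cast_sub, ← Int.cast_sub, ← Int.cast_abs, ← Int.cast_abs]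
        have : |y i - c i| ≤ |z i - c i| := by rw [Int.abs_eq_natAbs, Int.abs_eq_natAbs]; omega
        exact_mod_cast this
      · rw [hy i hi]; exact hz i
    by_cases hlt : c j < z j
    · set y := z - stdb j with hy
      have hy1 : ∀ i, i ≠ j → y i = z i := by
        intro i hi; simp [hy, hst, hi]
      have hy2 : (y j - c j).natAbs + 1 = (z j - c j).natAbs := by
        have : y j = z j - 1 := by simp [hy, hst]
        omega
      have h1 := ih y (hdist y hy1 hy2) (hsum y hy1 hy2)
      have h2 := hu y j (hdist y hy1 hy2)
      have e : y + stdb j = z := by rw [hy]; abel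
      rw [e] at h2
      have : u z - u c = (u z - u y) + (u y - u c) := by abel
      rw [this]
      refine (norm_add_le _ _).trans ?_
      push_cast; linarith
    · set y := z + stdb j with hy
      have hy1 : ∀ i, i ≠ j → y i = z i := by
        intro i hi; simp [hy, hst, hi]
      have hy2 : (y j - c j).natAbs + 1 = (z j - c j).natAbs := by
        have : y j = z j + 1 := by simp [hy, hst]
        omega
      have h1 := ih y (hdist y hy1 hy2) (hsum y hy1 hy2)
      have h2 := hu z j hz
      rw [norm_sub_rev] at h2
      have : u z - u c = (u z - u y) + (u y - u c) := by abel
      rw [this]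
      refine (norm_add_le _ _).trans ?_
      push_cast; linarith

lemma path_le' {X : Type*} [SeminormedAddCommGroup X] (u : Zd d → X) (c : Zd d) {ρ σ : ℝ} (hσ : 0 ≤ σ)
    (hu : ∀ z j, dist z c ≤ ρ → ‖u (z + stdb j) - u z‖ ≤ σ) {z : Zd d} {h : ℕ} (hz : dist z c ≤ ρ)
    (hh : dist z c ≤ h) : ‖u z - u c‖ ≤ d * h * σ := by
  refine (path_le u c hσ hu _ z hz rfl).trans ?_
  have h1 : ∑ j, (z j - c j).natAbs ≤ ∑ _j : Fin d, h := by
    refine Finset.sum_le_sum fun j _ => ?_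
    have h2 := (dist_pi_le_iff (Nat.cast_nonneg h)).1 hh j
    rw [Int.dist_eq, ← Int.cast_sub, ← Int.cast_abs] at h2
    have h3 : |z j - c j| ≤ (h:ℤ) := by exact_mod_cast h2
    rw [Int.abs_eq_natAbs] at h3
    omega
  rw [Finset.sum_const, Finset.card_univ, Fintype.card_fin, smul_eq_mul] at h1
  have h2 : ((∑ j, (z j - c j).natAbs : ℕ) : ℝ) ≤ d * h := by exact_mod_cast h1
  exact mul_le_mul_of_nonneg_right h2 hσ


/-- `p`-th power of the gradient norm over one period -/
def gp (k : ℕ) (p : ℝ) (f : Zd d → Rn n) : ℝ :=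
  ∑ z ∈ bx d k, ∑ j, ‖f (z + stdb j) - f z‖ ^ p

lemma gp_nonneg (k : ℕ) (p : ℝ) (f : Zd d → Rn n) : 0 ≤ gp k p f :=
  Finset.sum_nonneg fun _ _ => Finset.sum_nonneg fun _ _ => Real.rpow_nonneg (norm_nonneg _) _

lemma Per.comp {X Y : Type*} {k : ℕ} {f : Zd d → X} (hf : Per k f) (g : X → Y) :
    Per k (fun z => g (f z)) := fun z z' => by simp only [hf z z']

lemma Per.comp₂ {X X' Y : Type*} {k : ℕ} {f : Zd d → X} {f' : Zd d → X'} (hf : Per k f)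
    (hf' : Per k f') (g : X → X' → Y) : Per k (fun z => g (f z) (f' z)) := fun z z' => by
  simp only [hf z z', hf' z z']

lemma Per.diff {k : ℕ} {f : Zd d → Rn n} (hf : Per k f) (w : Zd d) :
    Per k (fun z => f (z + w) - f z) := (hf.shift w).comp₂ hf (fun a b => a - b)

lemma trans_le {k : ℕ} (hk : 0 < k) {p : ℝ} (hp : 1 ≤ p) {f : Zd d → Rn n} (hf : Per k f)
    (w : Zd d) {h : ℕ} (hw : ∀ j, |w j| ≤ h) :
    ∑ z ∈ bx d k, ‖f (z + w) - f z‖ ^ p ≤ (d * h) ^ p * gp k p f := by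
  have hp0 : 0 < p := by linarith
  have : Fact (1 ≤ ENNReal.ofReal p) := ⟨by rw [ENNReal.one_le_ofReal]; exact hp⟩
  have hpr : (ENNReal.ofReal p).toReal = p := ENNReal.toReal_ofReal hp0.le
  set u : Zd d → PiLp (ENNReal.ofReal p) (fun _ : bx d k => Rn n) := fun w =>
    WithLp.toLp _ (fun z => f (z.1 + w)) with hu
  have hnorm : ∀ w w' : Zd d, ‖u w - u w'‖ =
      (∑ z ∈ bx d k, ‖f (z + w) - f (z + w')‖ ^ p) ^ (1 / p) := by
    intro w w'
    rw [PiLp.norm_eq_sum (by rw [hpr]; exact hp0), hpr,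
      ← Finset.sum_coe_sort (bx d k) (fun z => ‖f (z + w) - f (z + w')‖ ^ p)]
    rfl
  have hnn : ∀ w w' : Zd d, 0 ≤ ∑ z ∈ bx d k, ‖f (z + w) - f (z + w')‖ ^ p := fun w w' =>
    Finset.sum_nonneg fun _ _ => Real.rpow_nonneg (norm_nonneg _) _
  have hstep : ∀ (y : Zd d) j, dist y 0 ≤ dist w 0 → ‖u (y + stdb j) - u y‖ ≤ (gp k p f) ^ (1 / p) := by
    intro y j _
    rw [hnorm]
    refine Real.rpow_le_rpow (hnn _ _) ?_ (by positivity)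
    have hper : Per k (fun z => ‖f (z + stdb j) - f z‖ ^ p) := (hf.diff _).comp (fun x => ‖x‖ ^ p)
    have e : ∑ z ∈ bx d k, ‖f (z + (y + stdb j)) - f (z + y)‖ ^ p =
        ∑ z ∈ bx d k, ‖f (z + stdb j) - f z‖ ^ p := by
      rw [← sum_per hk hper y]
      refine Finset.sum_congr rfl fun z _ => ?_
      rw [show z + (y + stdb j) = z + y + stdb j by abel]
    rw [e]
    refine Finset.sum_le_sum fun z _ => ?_
    exact Finset.single_le_sum (f := fun j => ‖f (z + stdb j) - f z‖ ^ p)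
      (fun _ _ => Real.rpow_nonneg (norm_nonneg _) _) (Finset.mem_univ j)
  have hdist : dist w 0 ≤ (h:ℝ) := by
    rw [dist_pi_le_iff (Nat.cast_nonneg h)]
    intro j
    rw [Int.dist_eq]
    simp only [Pi.zero_apply, Int.cast_zero, sub_zero]
    exact_mod_cast hw j
  have h1 := path_le' u 0 (Real.rpow_nonneg (gp_nonneg k p f) _) hstep le_rfl hdist
  rw [hnorm] at h1
  have h2 := Real.rpow_le_rpow (Real.rpow_nonneg (hnn _ _) _) h1 hp0.le
  rw [← Real.rpow_mul (hnn _ _), one_div_mul_cancel hp0.ne', Real.rpow_one,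
    Real.mul_rpow (by positivity) (Real.rpow_nonneg (gp_nonneg k p f) _),
    ← Real.rpow_mul (gp_nonneg k p f), one_div_mul_cancel hp0.ne', Real.rpow_one] at h2
  simpa only [add_zero] using h2

/-- Jensen -/
lemma jensen {X : Type*} [SeminormedAddCommGroup X] [NormedSpace ℝ X] {p : ℝ} (hp : 1 ≤ p) {ι : Type*}
    (Y : Finset ι) (hY : Y.Nonempty) (x : ι → X) :
    ‖(Y.card:ℝ)⁻¹ • ∑ y ∈ Y, x y‖ ^ p ≤ (Y.card:ℝ)⁻¹ * ∑ y ∈ Y, ‖x y‖ ^ p := by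
  have hc : (0:ℝ) < Y.card := by exact_mod_cast hY.card_pos
  have h1 : ‖(Y.card:ℝ)⁻¹ • ∑ y ∈ Y, x y‖ ≤ ∑ y ∈ Y, (Y.card:ℝ)⁻¹ * ‖x y‖ := by
    rw [norm_smul, norm_inv, Real.norm_of_nonneg hc.le, ← Finset.mul_sum]
    exact mul_le_mul_of_nonneg_left (norm_sum_le _ _) (inv_nonneg.2 hc.le)
  refine (Real.rpow_le_rpow (norm_nonneg _) h1 (by linarith)).trans ?_
  have h2 := Real.rpow_arith_mean_le_arith_mean_rpow Y (fun _ => (Y.card:ℝ)⁻¹) (fun y => ‖x y‖)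
    (fun _ _ => inv_nonneg.2 hc.le) (by rw [Finset.sum_const, nsmul_eq_mul]; field_simp)
    (fun _ _ => norm_nonneg _) hp
  rw [Finset.mul_sum]
  exact h2

/-- average over translations in `Y` -/
def Av (Y : Finset (Zd d)) (f : Zd d → Rn n) (z : Zd d) : Rn n :=
  (Y.card:ℝ)⁻¹ • ∑ y ∈ Y, f (z + y)

lemma Per.av {k : ℕ} {f : Zd d → Rn n} (hf : Per k f) (Y : Finset (Zd d)) : Per k (Av Y f) := by
  intro z z'
  unfold Av
  congr 1
  exact Finset.sum_congr rfl fun y _ => hf.shift y z z'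

lemma av_diff (Y : Finset (Zd d)) (f : Zd d → Rn n) (z e : Zd d) :
    Av Y f (z + e) - Av Y f z = Av Y (fun z => f (z + e) - f z) z := by
  unfold Av
  rw [← smul_sub, ← Finset.sum_sub_distrib]
  congr 1
  refine Finset.sum_congr rfl fun y _ => ?_
  rw [show z + e + y = z + y + e by abel]

lemma av_sum_le {k : ℕ} (hk : 0 < k) {p : ℝ} (hp : 1 ≤ p) {f : Zd d → Rn n} (hf : Per k f)
    {Y : Finset (Zd d)} (hY : Y.Nonempty) :
    ∑ z ∈ bx d k, ‖Av Y f z‖ ^ p ≤ ∑ z ∈ bx d k, ‖f z‖ ^ p := by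
  have hc : (0:ℝ) < Y.card := by exact_mod_cast hY.card_pos
  refine (Finset.sum_le_sum fun z _ => jensen hp Y hY (fun y => f (z + y))).trans ?_
  rw [← Finset.mul_sum, Finset.sum_comm]
  have : ∀ y ∈ Y, ∑ z ∈ bx d k, ‖f (z + y)‖ ^ p = ∑ z ∈ bx d k, ‖f z‖ ^ p := fun y _ =>
    sum_per hk (hf.comp (fun x => ‖x‖ ^ p)) y
  rw [Finset.sum_congr rfl this, Finset.sum_const, nsmul_eq_mul, ← mul_assoc,
    inv_mul_cancel₀ hc.ne', one_mul]

lemma av_gp_le {k : ℕ} (hk : 0 < k) {p : ℝ} (hp : 1 ≤ p) {f : Zd d → Rn n} (hf : Per k f)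
    {Y : Finset (Zd d)} (hY : Y.Nonempty) : gp k p (Av Y f) ≤ gp k p f := by
  unfold gp
  rw [Finset.sum_comm, Finset.sum_comm (s := bx d k)]
  refine Finset.sum_le_sum fun j _ => ?_
  simp only [av_diff]
  exact av_sum_le hk hp (hf.diff _) hY

/-- uniform convexity of the power of the norm -/
lemma unif_conv {p : ℝ} (hp : 1 < p) {η : ℝ} (hη : 0 < η) : ∃ C : ℝ, 0 ≤ C ∧ ∀ a b : Rn n,
    ‖b - a‖ ^ p ≤ η * (‖a‖ ^ p + ‖b‖ ^ p) +
      C * (1 / 2 * ‖a‖ ^ p + 1 / 2 * ‖b‖ ^ p - ‖(1 / 2 : ℝ) • (a + b)‖ ^ p) := by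
  have hp0 : 0 < p := by linarith
  set Gap : Rn n × Rn n → ℝ := fun q =>
    1 / 2 * ‖q.1‖ ^ p + 1 / 2 * ‖q.2‖ ^ p - ‖(1 / 2 : ℝ) • (q.1 + q.2)‖ ^ p with hGap
  have hGc : Continuous Gap := by
    have h1 : ∀ g : Rn n × Rn n → Rn n, Continuous g → Continuous fun q => ‖g q‖ ^ p :=
      fun g hg => hg.norm.rpow_const fun _ => Or.inr hp0.le
    exact (((h1 _ continuous_fst).const_mul _).add ((h1 _ continuous_snd).const_mul _)).sub
      (h1 _ (by fun_prop))
  have hGpos : ∀ q : Rn n × Rn n, q.1 ≠ q.2 → 0 < Gap q := by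
    rintro ⟨a, b⟩ hab
    simp only at hab
    have e : (1 / 2 : ℝ) • (a + b) = (1 / 2 : ℝ) • a + (1 / 2 : ℝ) • b := smul_add _ _ _
    by_cases hn : ‖a‖ = ‖b‖
    · have h1 : ‖(1 / 2 : ℝ) • a + (1 / 2 : ℝ) • b‖ < ‖a‖ :=
        norm_combo_lt_of_ne le_rfl hn.symm.le hab (by norm_num) (by norm_num) (by norm_num)
      have h2 := Real.rpow_lt_rpow (norm_nonneg _) h1 hp0
      simp only [hGap, e]
      rw [← hn]; linarith
    · have h1 : ‖(1 / 2 : ℝ) • a + (1 / 2 : ℝ) • b‖ ≤ 1 / 2 * ‖a‖ + 1 / 2 * ‖b‖ := by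
        refine (norm_add_le _ _).trans ?_
        rw [norm_smul, norm_smul]; norm_num
      have h2 := (strictConvexOn_rpow hp).2 (Set.mem_Ici.2 (norm_nonneg a))
        (Set.mem_Ici.2 (norm_nonneg b)) hn (by norm_num : (0:ℝ) < 1 / 2) (by norm_num : (0:ℝ) < 1 / 2)
        (by norm_num)
      simp only [smul_eq_mul] at h2
      have h3 := Real.rpow_le_rpow (norm_nonneg _) h1 hp0.le
      simp only [hGap, e]
      linarith
  have hGnn : ∀ q : Rn n × Rn n, 0 ≤ Gap q := by
    intro q
    by_cases h : q.1 = q.2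
    · simp only [hGap, ← h]
      rw [← two_smul ℝ q.1, smul_smul]
      norm_num
      linarith
    · exact (hGpos q h).le
  have hGh : ∀ (t : ℝ) (q : Rn n × Rn n), 0 ≤ t → Gap (t • q) = t ^ p * Gap q := by
    intro t q ht
    simp only [hGap, Prod.smul_fst, Prod.smul_snd]
    rw [← smul_add, smul_comm, norm_smul t, norm_smul t, norm_smul t, Real.norm_of_nonneg ht,
      Real.mul_rpow ht (norm_nonneg _), Real.mul_rpow ht (norm_nonneg _),
      Real.mul_rpow ht (norm_nonneg _)]
    ring
  set S : Set (Rn n × Rn n) := Metric.sphere 0 1 ∩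
    {q | η * (‖q.1‖ ^ p + ‖q.2‖ ^ p) ≤ ‖q.2 - q.1‖ ^ p} with hS
  have hScomp : IsCompact S := by
    refine (isCompact_sphere _ _).inter_right (isClosed_le ?_ ?_)
    · exact (((continuous_fst.norm).rpow_const fun _ => Or.inr hp0.le).add
        ((continuous_snd.norm).rpow_const fun _ => Or.inr hp0.le)).const_mul _
    · exact ((continuous_snd.sub continuous_fst).norm).rpow_const fun _ => Or.inr hp0.le
  have hSne : ∀ q ∈ S, q.1 ≠ q.2 := by
    rintro q ⟨hq1, hq2⟩ heq
    rw [Set.mem_ofPred_eq, heq, sub_self, norm_zero, Real.zero_rpow hp0.ne'] at hq2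
    have : ‖q.2‖ = 1 := by
      have := mem_sphere_zero_iff_norm.1 hq1
      rw [Prod.norm_def, heq, max_self] at this
      exact this
    rw [this, Real.one_rpow] at hq2
    linarith
  obtain ⟨γ, hγ, hγS⟩ : ∃ γ > 0, ∀ q ∈ S, γ ≤ Gap q := by
    rcases S.eq_empty_or_nonempty with h | h
    · exact ⟨1, one_pos, by simp [h]⟩
    · obtain ⟨q, hq, hmin⟩ := hScomp.exists_isMinOn h hGc.continuousOn
      exact ⟨Gap q, hGpos q (hSne q hq), fun y hy => hmin hy⟩
  refine ⟨2 ^ p / γ, by positivity, fun a b => ?_⟩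
  show _ ≤ η * (‖a‖ ^ p + ‖b‖ ^ p) + 2 ^ p / γ * Gap (a, b)
  have ha : 0 ≤ ‖a‖ ^ p := Real.rpow_nonneg (norm_nonneg _) _
  have hb : 0 ≤ ‖b‖ ^ p := Real.rpow_nonneg (norm_nonneg _) _
  have hG := mul_nonneg (by positivity : (0:ℝ) ≤ 2 ^ p / γ) (hGnn (a, b))
  by_cases hle : ‖b - a‖ ^ p ≤ η * (‖a‖ ^ p + ‖b‖ ^ p)
  · linarith
  push Not at hle
  set t := ‖(a, b)‖ with ht
  have ht0 : 0 < t := by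
    rw [ht, norm_pos_iff]
    intro h0
    rw [Prod.mk_eq_zero] at h0
    rw [h0.1, h0.2] at hle
    simp [Real.zero_rpow hp0.ne'] at hle
  have hq : t⁻¹ • (a, b) ∈ S := by
    refine ⟨?_, ?_⟩
    · rw [mem_sphere_zero_iff_norm, norm_smul, norm_inv, norm_norm, inv_mul_cancel₀ ht0.ne']
    · rw [Set.mem_ofPred_eq]
      simp only [Prod.smul_mk]
      rw [← smul_sub, norm_smul, norm_smul, norm_smul, norm_inv, Real.norm_of_nonneg ht0.le,
        Real.mul_rpow (by positivity) (norm_nonneg _), Real.mul_rpow (by positivity) (norm_nonneg _),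
        Real.mul_rpow (by positivity) (norm_nonneg _)]
      have : 0 ≤ (t⁻¹) ^ p := by positivity
      nlinarith [mul_le_mul_of_nonneg_left hle.le this]
  have h1 := hγS _ hq
  have e : Gap (a, b) = t ^ p * Gap (t⁻¹ • (a, b)) := by
    rw [← hGh t _ ht0.le, smul_smul, mul_inv_cancel₀ ht0.ne', one_smul]
  have h2 : ‖b - a‖ ^ p ≤ 2 ^ p * t ^ p := by
    rw [← Real.mul_rpow (by norm_num) ht0.le]
    refine Real.rpow_le_rpow (norm_nonneg _) ?_ hp0.le
    have h3 : ‖a‖ ≤ t := norm_fst_le (a, b)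
    have h4 : ‖b‖ ≤ t := norm_snd_le (a, b)
    linarith [norm_sub_le b a]
  have h3 : 2 ^ p * t ^ p ≤ 2 ^ p / γ * Gap (a, b) := by
    rw [e, div_mul_eq_mul_div, le_div_iff₀ hγ]
    have : 0 ≤ (2:ℝ) ^ p * t ^ p := by positivity
    nlinarith [mul_le_mul_of_nonneg_left h1 this]
  have h4 : 0 ≤ η * (‖a‖ ^ p + ‖b‖ ^ p) := by positivity
  linarith

lemma av_dev {p η C : ℝ} (hp : 1 < p) (hη : 0 ≤ η) (hC : 0 ≤ C)
    (hUC : ∀ a b : Rn n, ‖b - a‖ ^ p ≤ η * (‖a‖ ^ p + ‖b‖ ^ p) +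
      C * (1 / 2 * ‖a‖ ^ p + 1 / 2 * ‖b‖ ^ p - ‖(1 / 2 : ℝ) • (a + b)‖ ^ p)) {ι : Type*}
    (Y : Finset ι) (hY : Y.Nonempty) (x : ι → Rn n) :
    (Y.card:ℝ)⁻¹ * ∑ y ∈ Y, ‖x y - (Y.card:ℝ)⁻¹ • ∑ y ∈ Y, x y‖ ^ p ≤
      2 * η * ((Y.card:ℝ)⁻¹ * ∑ y ∈ Y, ‖x y‖ ^ p) +
      C / 2 * ((Y.card:ℝ)⁻¹ * ∑ y ∈ Y, ‖x y‖ ^ p - ‖(Y.card:ℝ)⁻¹ • ∑ y ∈ Y, x y‖ ^ p) := by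
  have hc : (0:ℝ) < Y.card := by exact_mod_cast hY.card_pos
  have hci : 0 ≤ (Y.card:ℝ)⁻¹ := inv_nonneg.2 hc.le
  set m := (Y.card:ℝ)⁻¹ • ∑ y ∈ Y, x y with hm
  set B := (Y.card:ℝ)⁻¹ * ∑ y ∈ Y, ‖x y‖ ^ p with hB
  have hJ : ‖m‖ ^ p ≤ B := jensen hp.le Y hY x
  have hmean : (Y.card:ℝ)⁻¹ • ∑ y ∈ Y, (1 / 2 : ℝ) • (m + x y) = m := by
    rw [← Finset.smul_sum, Finset.sum_add_distrib, Finset.sum_const, ← Nat.cast_smul_eq_nsmul ℝ,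
      smul_comm, smul_add, smul_smul, inv_mul_cancel₀ hc.ne', one_smul, ← hm, ← two_smul ℝ m,
      smul_smul]
    norm_num
  have hJ2 := jensen hp.le Y hY (fun y => (1 / 2 : ℝ) • (m + x y))
  rw [hmean] at hJ2
  set D := (Y.card:ℝ)⁻¹ * ∑ y ∈ Y, ‖(1 / 2 : ℝ) • (m + x y)‖ ^ p with hD
  have h1 : (Y.card:ℝ)⁻¹ * ∑ y ∈ Y, ‖x y - m‖ ^ p ≤ (Y.card:ℝ)⁻¹ * ∑ y ∈ Y,
      (η * (‖m‖ ^ p + ‖x y‖ ^ p) +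
      C * (1 / 2 * ‖m‖ ^ p + 1 / 2 * ‖x y‖ ^ p - ‖(1 / 2 : ℝ) • (m + x y)‖ ^ p)) :=
    mul_le_mul_of_nonneg_left (Finset.sum_le_sum fun y _ => hUC m (x y)) hci
  have h2 : (Y.card:ℝ)⁻¹ * ∑ y ∈ Y, (η * (‖m‖ ^ p + ‖x y‖ ^ p) +
      C * (1 / 2 * ‖m‖ ^ p + 1 / 2 * ‖x y‖ ^ p - ‖(1 / 2 : ℝ) • (m + x y)‖ ^ p)) =
      η * (‖m‖ ^ p + B) + C * (1 / 2 * ‖m‖ ^ p + 1 / 2 * B - D) := by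
    rw [Finset.sum_add_distrib, ← Finset.mul_sum, ← Finset.mul_sum, Finset.sum_sub_distrib,
      Finset.sum_add_distrib, Finset.sum_add_distrib, ← Finset.mul_sum, Finset.sum_const,
      ← Finset.mul_sum, nsmul_eq_mul, hB, hD]
    field_simp
  rw [h2] at h1
  refine h1.trans ?_
  have h3 := mul_le_mul_of_nonneg_left hJ hη
  have h4 := mul_le_mul_of_nonneg_left hJ2 hC
  nlinarith

/-- the reflected box -/
def nb (d l : ℕ) : Finset (Zd d) := (bx d l).map (Equiv.neg (Zd d)).toEmbedding

lemma card_nb (d l : ℕ) : (nb d l).card = l ^ d := by unfold nb; rw [Finset.card_map, card_bx]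

lemma bx_nonempty {l : ℕ} (hl : 0 < l) : (bx d l).Nonempty := by
  rw [← Finset.card_pos, card_bx]; positivity

lemma nb_nonempty {l : ℕ} (hl : 0 < l) : (nb d l).Nonempty := by
  rw [← Finset.card_pos, card_nb]; positivity

/-- double smoothing -/
def Tm (l : ℕ) (f : Zd d → Rn n) : Zd d → Rn n := Av (nb d l) (Av (bx d l) f)

lemma Per.tm {k : ℕ} {f : Zd d → Rn n} (hf : Per k f) (l : ℕ) : Per k (Tm l f) := (hf.av _).av _

lemma tm_gp_le {k : ℕ} (hk : 0 < k) {p : ℝ} (hp : 1 ≤ p) {f : Zd d → Rn n} (hf : Per k f)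
    {l : ℕ} (hl : 0 < l) : gp k p (Tm l f) ≤ gp k p f :=
  (av_gp_le hk hp (hf.av _) (nb_nonempty hl)).trans (av_gp_le hk hp hf (bx_nonempty hl))

lemma smooth_dev {k : ℕ} (hk : 0 < k) {p η C : ℝ} (hp : 1 < p) (hη : 0 ≤ η) (hC : 0 ≤ C)
    (hUC : ∀ a b : Rn n, ‖b - a‖ ^ p ≤ η * (‖a‖ ^ p + ‖b‖ ^ p) +
      C * (1 / 2 * ‖a‖ ^ p + 1 / 2 * ‖b‖ ^ p - ‖(1 / 2 : ℝ) • (a + b)‖ ^ p))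
    {u : Zd d → Rn n} (hu : Per k u) {l : ℕ} (hl : 0 < l) :
    ∑ z ∈ bx d k, ‖u z - Tm l u z‖ ^ p ≤ 2 * η * ∑ z ∈ bx d k, ‖u z‖ ^ p +
      C / 2 * (∑ z ∈ bx d k, ‖u z‖ ^ p - ∑ z ∈ bx d k, ‖Tm l u z‖ ^ p) := by
  have hbn := bx_nonempty (d := d) hl
  set g := Av (bx d l) u with hg
  have hgP : Per k g := hu.av _
  have hc : (0:ℝ) < ((bx d l).card : ℝ) := by exact_mod_cast hbn.card_pos
  have hcn : ((nb d l).card : ℝ) = (bx d l).card := by rw [card_nb, card_bx]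
  have h1 : ∀ z, ‖u z - Tm l u z‖ ^ p ≤ ((bx d l).card : ℝ)⁻¹ * ∑ y ∈ bx d l, ‖u z - g (z - y)‖ ^ p := by
    intro z
    have e : u z - Tm l u z = ((nb d l).card : ℝ)⁻¹ • ∑ y ∈ nb d l, (u z - g (z + y)) := by
      rw [Finset.sum_sub_distrib, Finset.sum_const, ← Nat.cast_smul_eq_nsmul ℝ, smul_sub, smul_smul,
        inv_mul_cancel₀ (by rw [hcn]; exact hc.ne'), one_smul]
      rfl
    rw [e]
    refine (jensen hp.le _ (nb_nonempty hl) _).trans (le_of_eq ?_)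
    rw [hcn]
    unfold nb
    rw [Finset.sum_map]
    simp only [Equiv.coe_toEmbedding, Equiv.neg_apply, ← sub_eq_add_neg]
  have h2 : ∑ z ∈ bx d k, ‖u z - Tm l u z‖ ^ p ≤
      ∑ z ∈ bx d k, ((bx d l).card : ℝ)⁻¹ * ∑ y ∈ bx d l, ‖u (z + y) - g z‖ ^ p := by
    refine (Finset.sum_le_sum fun z _ => h1 z).trans (le_of_eq ?_)
    rw [← Finset.mul_sum, ← Finset.mul_sum, Finset.sum_comm, Finset.sum_comm (s := bx d k)]
    congr 1
    refine Finset.sum_congr rfl fun y _ => ?_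
    have hper : Per k (fun z => ‖u (z + y) - g z‖ ^ p) :=
      (hu.shift y).comp₂ hgP (fun a b => ‖a - b‖ ^ p)
    rw [← sum_per hk hper (-y)]
    refine Finset.sum_congr rfl fun z _ => ?_
    simp only [neg_add_cancel_right, sub_eq_add_neg z y]
  refine h2.trans ((Finset.sum_le_sum fun z _ =>
    av_dev hp hη hC hUC (bx d l) hbn (fun y => u (z + y))).trans ?_)
  have h3 : ∑ z ∈ bx d k, ((bx d l).card : ℝ)⁻¹ * ∑ y ∈ bx d l, ‖u (z + y)‖ ^ p =
      ∑ z ∈ bx d k, ‖u z‖ ^ p := by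
    rw [← Finset.mul_sum, Finset.sum_comm]
    have : ∀ y ∈ bx d l, ∑ z ∈ bx d k, ‖u (z + y)‖ ^ p = ∑ z ∈ bx d k, ‖u z‖ ^ p := fun y _ =>
      sum_per hk (hu.comp (fun x => ‖x‖ ^ p)) y
    rw [Finset.sum_congr rfl this, Finset.sum_const, nsmul_eq_mul, ← mul_assoc,
      inv_mul_cancel₀ hc.ne', one_mul]
  have h4 : ∑ z ∈ bx d k, ‖Tm l u z‖ ^ p ≤ ∑ z ∈ bx d k, ‖g z‖ ^ p :=
    av_sum_le hk hp.le hgP (nb_nonempty hl)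
  have h5 : ∑ z ∈ bx d k, ‖g z‖ ^ p = ∑ z ∈ bx d k,
    ‖((bx d l).card : ℝ)⁻¹ • ∑ y ∈ bx d l, u (z + y)‖ ^ p := rfl
  have e6 : ∑ z ∈ bx d k, (2 * η * (((bx d l).card : ℝ)⁻¹ * ∑ y ∈ bx d l, ‖u (z + y)‖ ^ p) +
      C / 2 * (((bx d l).card : ℝ)⁻¹ * ∑ y ∈ bx d l, ‖u (z + y)‖ ^ p -
        ‖((bx d l).card : ℝ)⁻¹ • ∑ y ∈ bx d l, u (z + y)‖ ^ p)) =
      2 * η * ∑ z ∈ bx d k, (((bx d l).card : ℝ)⁻¹ * ∑ y ∈ bx d l, ‖u (z + y)‖ ^ p) +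
      C / 2 * (∑ z ∈ bx d k, (((bx d l).card : ℝ)⁻¹ * ∑ y ∈ bx d l, ‖u (z + y)‖ ^ p) -
        ∑ z ∈ bx d k, ‖((bx d l).card : ℝ)⁻¹ • ∑ y ∈ bx d l, u (z + y)‖ ^ p) := by
    rw [Finset.sum_add_distrib, ← Finset.sum_sub_distrib]
    congr 1
    · exact (Finset.mul_sum _ _ _).symm
    · exact (Finset.mul_sum _ _ _).symm
  rw [e6, h3, ← h5]
  have : C / 2 * ∑ z ∈ bx d k, ‖Tm l u z‖ ^ p ≤ C / 2 * ∑ z ∈ bx d k, ‖g z‖ ^ p :=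
    mul_le_mul_of_nonneg_left h4 (by positivity)
  linarith

lemma tm_diff (l : ℕ) (f : Zd d → Rn n) (z e : Zd d) :
    Tm l f (z + e) - Tm l f z = Tm l (fun z => f (z + e) - f z) z := by
  unfold Tm
  rw [av_diff]
  congr 1
  funext y
  exact av_diff _ _ _ _

lemma smooth_gap {k : ℕ} (hk : 0 < k) {p η C : ℝ} (hp : 1 < p) (hη : 0 ≤ η) (hC : 0 ≤ C)
    (hUC : ∀ a b : Rn n, ‖b - a‖ ^ p ≤ η * (‖a‖ ^ p + ‖b‖ ^ p) +
      C * (1 / 2 * ‖a‖ ^ p + 1 / 2 * ‖b‖ ^ p - ‖(1 / 2 : ℝ) • (a + b)‖ ^ p))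
    {f : Zd d → Rn n} (hf : Per k f) {l : ℕ} (hl : 0 < l) :
    gp k p (fun z => f z - Tm l f z) ≤ 2 * η * gp k p f + C / 2 * (gp k p f - gp k p (Tm l f)) := by
  unfold gp
  rw [Finset.sum_comm, Finset.sum_comm (s := bx d k), Finset.sum_comm (s := bx d k), Finset.mul_sum,
    ← Finset.sum_sub_distrib, Finset.mul_sum, ← Finset.sum_add_distrib]
  refine Finset.sum_le_sum fun j _ => ?_
  have h := smooth_dev hk hp hη hC hUC (hf.diff (stdb j)) hl
  simp only [tm_diff]
  refine le_trans (le_of_eq (Finset.sum_congr rfl fun z _ => ?_)) h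
  rw [← tm_diff, sub_sub_sub_comm]


lemma bx_abs_le {l : ℕ} {y : Zd d} (hy : y ∈ bx d l) (j : Fin d) : |y j| ≤ l := by
  have := (mem_bx.1 hy) j
  rw [abs_le]; omega

lemma nb_abs_le {l : ℕ} {y : Zd d} (hy : y ∈ nb d l) (j : Fin d) : |y j| ≤ l := by
  unfold nb at hy
  obtain ⟨x, hx, rfl⟩ := Finset.mem_map.1 hy
  simp only [Equiv.coe_toEmbedding, Equiv.neg_apply, Pi.neg_apply, abs_neg]
  exact bx_abs_le hx j

lemma l1_av {k : ℕ} (hk : 0 < k) {f : Zd d → Rn n} (hf : Per k f) {Y : Finset (Zd d)}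
    (hY : Y.Nonempty) {l : ℕ} (hl : ∀ y ∈ Y, ∀ j, |y j| ≤ l) :
    ∑ z ∈ bx d k, ‖f z - Av Y f z‖ ≤ d * l * gp k 1 f := by
  have hc : (0:ℝ) < Y.card := by exact_mod_cast hY.card_pos
  have h1 : ∀ z, ‖f z - Av Y f z‖ ≤ (Y.card:ℝ)⁻¹ * ∑ y ∈ Y, ‖f (z + y) - f z‖ := by
    intro z
    have e : f z - Av Y f z = (Y.card:ℝ)⁻¹ • ∑ y ∈ Y, (f z - f (z + y)) := by
      rw [Finset.sum_sub_distrib, Finset.sum_const, ← Nat.cast_smul_eq_nsmul ℝ, smul_sub, smul_smul,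
        inv_mul_cancel₀ hc.ne', one_smul]
      rfl
    rw [e, norm_smul, norm_inv, Real.norm_of_nonneg hc.le]
    refine mul_le_mul_of_nonneg_left ((norm_sum_le _ _).trans (le_of_eq ?_)) (inv_nonneg.2 hc.le)
    exact Finset.sum_congr rfl fun y _ => norm_sub_rev _ _
  refine (Finset.sum_le_sum fun z _ => h1 z).trans ?_
  rw [← Finset.mul_sum, Finset.sum_comm, inv_mul_le_iff₀ hc]
  have h2 : ∀ y ∈ Y, ∑ z ∈ bx d k, ‖f (z + y) - f z‖ ≤ d * l * gp k 1 f := fun y hy => by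
    have := trans_le hk le_rfl hf y (hl y hy)
    simpa only [Real.rpow_one] using this
  refine (Finset.sum_le_sum h2).trans (le_of_eq ?_)
  rw [Finset.sum_const, nsmul_eq_mul]

lemma l1_tm {k : ℕ} (hk : 0 < k) {f : Zd d → Rn n} (hf : Per k f) {l : ℕ} (hl : 0 < l) :
    ∑ z ∈ bx d k, ‖f z - Tm l f z‖ ≤ 2 * d * l * gp k 1 f := by
  have h1 := l1_av hk hf (bx_nonempty (d := d) hl) (fun y hy => bx_abs_le hy)
  have h2 := l1_av hk (hf.av (bx d l)) (nb_nonempty (d := d) hl) (fun y hy => nb_abs_le hy)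
  have h3 := mul_le_mul_of_nonneg_left (av_gp_le hk le_rfl hf (bx_nonempty (d := d) hl))
    (by positivity : (0:ℝ) ≤ d * l)
  have h4 : ∑ z ∈ bx d k, ‖f z - Tm l f z‖ ≤ ∑ z ∈ bx d k, ‖f z - Av (bx d l) f z‖ +
      ∑ z ∈ bx d k, ‖Av (bx d l) f z - Av (nb d l) (Av (bx d l) f) z‖ := by
    rw [← Finset.sum_add_distrib]
    refine Finset.sum_le_sum fun z _ => ?_
    exact norm_sub_le_norm_sub_add_norm_sub _ _ _
  linarith

lemma le_one_add_rpow {p x : ℝ} (hp : 1 ≤ p) (hx : 0 ≤ x) : x ≤ 1 + x ^ p := by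
  rcases le_total x 1 with h | h
  · have := Real.rpow_nonneg hx p; linarith
  · have := Real.self_le_rpow_of_one_le h hp; linarith

lemma av_sup {k : ℕ} (hk : 0 < k) {u : Zd d → Rn n} (hu : Per k u) {l : ℕ} (hlk : l ≤ k)
    (z : Zd d) : ‖Av (bx d l) u z‖ ≤ ((l:ℝ) ^ d)⁻¹ * ∑ z ∈ bx d k, ‖u z‖ := by
  unfold Av
  rw [card_bx, norm_smul, norm_inv, Real.norm_of_nonneg (Nat.cast_nonneg _), Nat.cast_pow]
  refine mul_le_mul_of_nonneg_left ((norm_sum_le _ _).trans ?_) (by positivity)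
  rw [← sum_per hk (hu.comp norm) z]
  have hsub : bx d l ⊆ bx d k := fun y hy => by
    rw [mem_bx] at *
    intro j
    have := hy j
    omega
  refine (Finset.sum_le_sum_of_subset_of_nonneg hsub fun _ _ _ => norm_nonneg _).trans (le_of_eq ?_)
  exact Finset.sum_congr rfl fun y _ => by rw [add_comm]

lemma scale_ge {k q : ℕ} (hq : 0 < q) (hkq : q ≤ k) : 0 < k / q ∧ (k:ℝ) ≤ 2 * q * (k / q : ℕ) := by
  have h1 : 0 < k / q := Nat.div_pos hkq hq
  refine ⟨h1, ?_⟩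
  have h2 : k < q * (k / q + 1) := Nat.lt_mul_div_succ k hq
  have h3 : k ≤ 2 * q * (k / q) := by nlinarith
  exact_mod_cast h3

/-- the sup bound for the gradient of a smoothed function -/
lemma dav_sup {k q : ℕ} (hq : 0 < q) (hkq : q ≤ k) {p C0 : ℝ} (hp : 1 ≤ p) {f : Zd d → Rn n}
    (hf : Per k f) (hC : gp k p f ≤ C0 * (k:ℝ) ^ d) (j : Fin d) (z : Zd d) :
    ‖Av (bx d (k / q)) (fun z => f (z + stdb j) - f z) z‖ ≤ (2 * q) ^ d * (1 + C0) := by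
  obtain ⟨hl, hkl⟩ := scale_ge hq hkq
  have hk : 0 < k := lt_of_lt_of_le hq hkq
  refine (av_sup hk (hf.diff (stdb j)) (Nat.div_le_self k q) z).trans ?_
  have hl' : (0:ℝ) < ((k / q : ℕ):ℝ) ^ d := by positivity
  rw [inv_mul_le_iff₀ hl']
  have h1 : ∑ z ∈ bx d k, ‖f (z + stdb j) - f z‖ ≤ (1 + C0) * (k:ℝ) ^ d := by
    have h2 : ∑ z ∈ bx d k, ‖f (z + stdb j) - f z‖ ≤
        ∑ z ∈ bx d k, (1 + ∑ j, ‖f (z + stdb j) - f z‖ ^ p) := by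
      refine Finset.sum_le_sum fun z _ => (le_one_add_rpow hp (norm_nonneg _)).trans ?_
      have := Finset.single_le_sum (f := fun j => ‖f (z + stdb j) - f z‖ ^ p)
        (fun _ _ => Real.rpow_nonneg (norm_nonneg _) _) (Finset.mem_univ j)
      linarith
    rw [Finset.sum_add_distrib, Finset.sum_const, card_bx, nsmul_eq_mul, mul_one] at h2
    unfold gp at hC
    push_cast at h2
    linarith
  refine h1.trans ?_
  have h0 : 0 ≤ 1 + C0 := by
    have := (gp_nonneg k p f).trans hC
    have hk' : (0:ℝ) < (k:ℝ) ^ d := by positivity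
    have : 0 ≤ C0 := nonneg_of_mul_nonneg_left this hk'
    linarith
  have h3 : (k:ℝ) ^ d ≤ (2 * q * (k / q : ℕ)) ^ d := pow_le_pow_left₀ (Nat.cast_nonneg _) hkl _
  rw [mul_pow] at h3
  calc (1 + C0) * (k:ℝ) ^ d ≤ (1 + C0) * ((2 * q) ^ d * ((k / q : ℕ):ℝ) ^ d) :=
        mul_le_mul_of_nonneg_left h3 h0
    _ = _ := by ring

lemma nb_sup {u : Zd d → Rn n} {l : ℕ} (hl : 0 < l) {Λ : ℝ} (hΛ : ∀ z, ‖u z‖ ≤ Λ) (z : Zd d) :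
    ‖Av (nb d l) u z‖ ≤ Λ := by
  have hc : (0:ℝ) < (nb d l).card := by exact_mod_cast (nb_nonempty hl).card_pos
  unfold Av
  rw [norm_smul, norm_inv, Real.norm_of_nonneg hc.le, inv_mul_le_iff₀ hc]
  refine (norm_sum_le _ _).trans ((Finset.sum_le_sum fun y _ => hΛ _).trans (le_of_eq ?_))
  rw [Finset.sum_const, nsmul_eq_mul]

lemma nb_lip (hd : 0 < d) {u : Zd d → Rn n} {l : ℕ} (hl : 0 < l) {Λ : ℝ} (hΛ : ∀ z, ‖u z‖ ≤ Λ)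
    (z y : Zd d) {h : ℕ} (hy : ∀ j, |y j| ≤ h) :
    ‖Av (nb d l) u (z + y) - Av (nb d l) u z‖ ≤ 4 * Λ * d * h / l := by
  have hl' : (0:ℝ) < (l:ℝ) := by exact_mod_cast hl
  have hΛ0 : 0 ≤ Λ := (norm_nonneg _).trans (hΛ 0)
  have e : Av (nb d l) u (z + y) - Av (nb d l) u z =
      -(((l:ℝ) ^ d)⁻¹ • ∑ x ∈ bx d l, (u (z - x) - u (z - (x + -y)))) := by
    unfold Av
    rw [card_nb, ← smul_sub, ← Finset.sum_sub_distrib, ← smul_neg, ← Finset.sum_neg_distrib]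
    unfold nb
    rw [Finset.sum_map, Nat.cast_pow]
    congr 1
    refine Finset.sum_congr rfl fun x _ => ?_
    simp only [Equiv.coe_toEmbedding, Equiv.neg_apply, neg_sub]
    congr 2 <;> abel
  rw [e, norm_neg, norm_smul, norm_inv, Real.norm_of_nonneg (by positivity)]
  have h1 := norm_sum_shift_sub_le (fun x => u (z - x)) (-y) (h := h)
    (by intro j; rw [Pi.neg_apply, abs_neg]; exact hy j) l (fun x => hΛ _)
  rw [card_layer] at h1
  have h2 := h1.trans (mul_le_mul_of_nonneg_left (layer_le d l h) (by positivity))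
  rw [inv_mul_le_iff₀ (by positivity)]
  refine h2.trans (le_of_eq ?_)
  obtain ⟨d', rfl⟩ : ∃ d', d = d' + 1 := ⟨d - 1, by omega⟩
  rw [Nat.add_sub_cancel, pow_succ]
  field_simp
  ring

/-- summary of the gradient bounds of the smoothed function -/
lemma tm_grad (hd : 0 < d) {k q : ℕ} (hq : 0 < q) (hkq : q ≤ k) {p C0 : ℝ} (hp : 1 ≤ p)
    {f : Zd d → Rn n} (hf : Per k f) (hC : gp k p f ≤ C0 * (k:ℝ) ^ d) (j : Fin d) :
    (∀ z, ‖Tm (k / q) f (z + stdb j) - Tm (k / q) f z‖ ≤ (2 * q) ^ d * (1 + C0)) ∧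
    ∀ (z y : Zd d) (h : ℕ), (∀ i, |y i| ≤ h) →
      ‖(Tm (k / q) f (z + y + stdb j) - Tm (k / q) f (z + y)) -
        (Tm (k / q) f (z + stdb j) - Tm (k / q) f z)‖ ≤
        8 * q * ((2 * q) ^ d * (1 + C0)) * d * h / k := by
  obtain ⟨hl, hkl⟩ := scale_ge hq hkq
  have hk : 0 < k := lt_of_lt_of_le hq hkq
  have hs := dav_sup hq hkq hp hf hC j
  refine ⟨fun z => ?_, fun z y h hy => ?_⟩
  · rw [tm_diff]
    exact nb_sup hl hs z
  · rw [tm_diff, tm_diff]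
    refine (nb_lip hd hl hs z y hy).trans ?_
    have hk' : (0:ℝ) < k := by exact_mod_cast hk
    have hl' : (0:ℝ) < (k / q : ℕ) := by exact_mod_cast hl
    set Λ := (2 * q : ℝ) ^ d * (1 + C0) with hΛ
    have hΛ0 : 0 ≤ Λ := (norm_nonneg _).trans (hs 0)
    rw [div_le_div_iff₀ hl' hk']
    have : 0 ≤ 4 * Λ * d * h := by positivity
    nlinarith [mul_le_mul_of_nonneg_left hkl this]


lemma young_mu {p a t x : ℝ} (hp : 1 < p) (ha : 0 < a) (ht : 0 < t) (hx : 0 ≤ x) :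
    x ≤ t ^ (p - 1) * (a * x ^ p) + a ^ (-(1 / (p - 1))) / t := by
  have hp1 : 0 < p - 1 := by linarith
  have hmu : 0 < a ^ (-(1 / (p - 1))) := Real.rpow_pos_of_pos ha _
  rcases le_total x (a ^ (-(1 / (p - 1))) / t) with h | h
  · have : 0 ≤ t ^ (p - 1) * (a * x ^ p) := by positivity
    linarith
  · have hx0 : 0 < x := lt_of_lt_of_le (by positivity) h
    have h1 : a ^ (-(1 / (p - 1))) ≤ x * t := by rwa [div_le_iff₀ ht] at h
    have h2 := Real.rpow_le_rpow hmu.le h1 hp1.le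
    rw [← Real.rpow_mul ha.le, Real.mul_rpow hx ht.le] at h2
    have e1 : -(1 / (p - 1)) * (p - 1) = -1 := by field_simp
    rw [e1, Real.rpow_neg_one] at h2
    have h3 : 1 ≤ a * (x ^ (p - 1) * t ^ (p - 1)) := by
      have := mul_le_mul_of_nonneg_left h2 ha.le
      rwa [mul_inv_cancel₀ ha.ne'] at this
    have e2 : x ^ p = x ^ (p - 1) * x := by
      rw [← Real.rpow_add_one hx0.ne']; congr 1; ring
    have h4 : x ≤ t ^ (p - 1) * (a * x ^ p) := by
      rw [e2]
      nlinarith [mul_le_mul_of_nonneg_right h3 hx]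
    have : 0 ≤ a ^ (-(1 / (p - 1))) / t := by positivity
    linarith

/-- averaged Young inequality -/
lemma avg_young {p C1 : ℝ} (hp : 1 < p) (hC1 : 0 ≤ C1) {ι : Type*} (Y : Finset ι) {N : ℝ} (hN : 0 < N)
    (a x : ι → ℝ) (ha : ∀ y ∈ Y, 0 < a y) (hx : ∀ y ∈ Y, 0 ≤ x y)
    (hmu : ∑ y ∈ Y, a y ^ (-(1 / (p - 1))) ≤ C1 * N) :
    (N⁻¹ * ∑ y ∈ Y, x y) ^ p ≤ (1 + C1) ^ p * (1 + N⁻¹ * ∑ y ∈ Y, a y * x y ^ p) := by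
  have hp0 : 0 < p := by linarith
  set A := N⁻¹ * ∑ y ∈ Y, a y * x y ^ p with hA
  have hA0 : 0 ≤ A := mul_nonneg (inv_nonneg.2 hN.le)
    (Finset.sum_nonneg fun y hy => mul_nonneg (ha y hy).le (Real.rpow_nonneg (hx y hy) _))
  have hA1 : 0 < 1 + A := by linarith
  set t := (1 + A) ^ (-(1 / p)) with ht
  have ht0 : 0 < t := Real.rpow_pos_of_pos hA1 _
  have h1 : N⁻¹ * ∑ y ∈ Y, x y ≤ t ^ (p - 1) * A + C1 / t := by
    have h2 : ∑ y ∈ Y, x y ≤ t ^ (p - 1) * ∑ y ∈ Y, a y * x y ^ p +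
        (∑ y ∈ Y, a y ^ (-(1 / (p - 1)))) / t := by
      rw [Finset.mul_sum, Finset.sum_div, ← Finset.sum_add_distrib]
      exact Finset.sum_le_sum fun y hy => young_mu hp (ha y hy) ht0 (hx y hy)
    have h3 : (∑ y ∈ Y, a y ^ (-(1 / (p - 1)))) / t ≤ C1 * N / t :=
      div_le_div_of_nonneg_right hmu ht0.le
    rw [inv_mul_le_iff₀ hN]
    refine (h2.trans (add_le_add_right h3 _)).trans (le_of_eq ?_)
    rw [hA]
    field_simp
  have h4 : t ^ (p - 1) * A ≤ (1 + A) ^ (1 / p) := by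
    have h5 : t ^ (p - 1) * A ≤ t ^ (p - 1) * (1 + A) :=
      mul_le_mul_of_nonneg_left (by linarith) (Real.rpow_nonneg ht0.le _)
    refine h5.trans (le_of_eq ?_)
    rw [ht, ← Real.rpow_mul hA1.le, ← Real.rpow_add_one hA1.ne']
    congr 1
    field_simp
    ring
  have h6 : C1 / t = C1 * (1 + A) ^ (1 / p) := by
    rw [ht, Real.rpow_neg hA1.le, div_inv_eq_mul]
  have h7 : N⁻¹ * ∑ y ∈ Y, x y ≤ (1 + C1) * (1 + A) ^ (1 / p) := by
    rw [h6] at h1; linarith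
  have h0 : 0 ≤ N⁻¹ * ∑ y ∈ Y, x y := mul_nonneg (inv_nonneg.2 hN.le) (Finset.sum_nonneg hx)
  refine (Real.rpow_le_rpow h0 h7 hp0.le).trans (le_of_eq ?_)
  rw [Real.mul_rpow (by positivity) (by positivity), ← Real.rpow_mul hA1.le,
    one_div_mul_cancel hp0.ne', Real.rpow_one]

/-- sums over small torus cubes are controlled by sums over a fixed grid -/
lemma torus_sum {k q : ℕ} (hq : 0 < q) (hkq : q ≤ k) (μ : Zd d → ℝ) (hμ : ∀ z, 0 ≤ μ z) {K : ℝ}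
    (hK : 0 ≤ K) (hgrid : ∀ x ∈ bx d q, ∑ z ∈ bx d (k / q + 1), μ (z + (k / q + 1) • x) ≤
      K * ((k / q + 1 : ℕ):ℝ) ^ d) (z : Zd d) :
    ∑ y ∈ bx d (k / q), μ (pm k (z + y)) ≤ 8 ^ d * K * ((k / q : ℕ):ℝ) ^ d := by
  have hk : 0 < k := lt_of_lt_of_le hq hkq
  have hl : 0 < k / q := Nat.div_pos hkq hq
  set l := k / q with hldef
  set s := l + 1 with hs
  have hks : k < q * s := Nat.lt_mul_div_succ k hq
  have hs0 : (0:ℤ) < s := by exact_mod_cast Nat.succ_pos l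
  set g : Zd d → ℝ := fun w => if w ∈ bx d k then μ w else 0 with hg
  have hg0 : ∀ w, 0 ≤ g w := fun w => by
    simp only [hg]; split_ifs
    · exact hμ w
    · exact le_rfl
  have hgμ : ∀ w, g w ≤ μ w := fun w => by
    simp only [hg]; split_ifs
    · exact le_rfl
    · exact hμ w
  -- grid cells
  have hcellg : ∀ x : Zd d, ∑ w ∈ bx d s, g (w + s • x) ≤ K * (s:ℝ) ^ d := by
    intro x
    by_cases hx : x ∈ bx d q
    · exact (Finset.sum_le_sum fun w _ => hgμ _).trans (hgrid x hx)
    · have : ∀ w ∈ bx d s, g (w + s • x) = 0 := by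
        intro w hw
        simp only [hg]
        rw [if_neg]
        intro hmem
        apply hx
        rw [mem_bx] at *
        intro j
        have h1 := hw j
        have h2 := hmem j
        simp only [Pi.add_apply, nsmul_app] at h2
        have hks' : (k:ℤ) < q * s := by exact_mod_cast hks
        constructor
        · by_contra hneg
          have : x j ≤ -1 := by omega
          nlinarith
        · by_contra hneg
          have : (q:ℤ) ≤ x j := by omega
          nlinarith
      rw [Finset.sum_eq_zero this]
      positivity
  -- arbitrary cubes of side l
  have hcorner : ∀ c : Zd d, ∑ y ∈ bx d l, g (c + y) ≤ 2 ^ d * (K * (s:ℝ) ^ d) := by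
    intro c
    set x0 : Zd d := fun j => c j / s with hx0
    have h1 : ∑ y ∈ bx d l, g (c + y) ≤ ∑ w ∈ bx d (s * 2), g (s • x0 + w) := by
      rw [← sum_cell l c g, ← sum_cell (s * 2) (s • x0) g]
      refine Finset.sum_le_sum_of_subset_of_nonneg ?_ fun w _ _ => hg0 w
      intro w hw
      rw [mem_cell, mem_bx] at *
      intro j
      have h2 := hw j
      simp only [Pi.sub_apply, nsmul_app, hx0] at *
      have h3 := Int.emod_add_mul_ediv (c j) s
      have h4 := Int.emod_nonneg (c j) hs0.ne'
      have h5 := Int.emod_lt_of_pos (c j) hs0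
      push_cast at *
      constructor <;> linarith
    refine h1.trans ?_
    rw [← sum_bx_mul s 2 (fun w => g (s • x0 + w)), Finset.sum_comm]
    have h6 : ∀ x ∈ bx d 2, ∑ y ∈ bx d s, g (s • x0 + (y + s • x)) ≤ K * (s:ℝ) ^ d := by
      intro x _
      refine le_trans (le_of_eq (Finset.sum_congr rfl fun y _ => ?_)) (hcellg (x0 + x))
      congr 1
      rw [smul_add]; abel
    refine (Finset.sum_le_sum h6).trans (le_of_eq ?_)
    rw [Finset.sum_const, card_bx, nsmul_eq_mul]
    push_cast; ring
  -- reduce to `z` in the box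
  have hred : ∀ y ∈ bx d l, μ (pm k (z + y)) ≤ ∑ e ∈ bx d 2, g (pm k z - k • e + y) := by
    intro y hy
    have hk' : (0:ℤ) < k := by exact_mod_cast hk
    set e : Zd d := fun j => if pm k z j + y j < k then 0 else 1 with he
    have he2 : e ∈ bx d 2 := by
      rw [mem_bx]; intro j
      simp only [he]
      split_ifs <;> norm_num
    have hmem : pm k z - k • e + y ∈ bx d k := by
      rw [mem_bx] at *
      intro j
      have h1 := mem_bx.1 (pm_mem hk z) j
      have h2 := hy j
      have hlk : (l:ℤ) ≤ k := by exact_mod_cast Nat.div_le_self k q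
      simp only [Pi.add_apply, Pi.sub_apply, nsmul_app, he]
      split_ifs with hh
      · constructor <;> linarith
      · constructor <;> linarith
    have heq : pm k (z + y) = pm k z - k • e + y := by
      have h3 : pm k z - k • e + y = z + y + k • ((fun j => -(z j / k)) - e) := by
        rw [pm_eq, smul_sub]; abel
      rw [← pm_of_mem hmem]
      conv_rhs => rw [h3, pm_add_smul]
    have h4 : μ (pm k (z + y)) = g (pm k z - k • e + y) := by
      simp only [hg]
      rw [if_pos hmem, heq]
    rw [h4]
    exact Finset.single_le_sum (f := fun e => g (pm k z - k • e + y)) (fun _ _ => hg0 _) he2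
  refine (Finset.sum_le_sum hred).trans ?_
  rw [Finset.sum_comm]
  refine (Finset.sum_le_sum fun e _ => hcorner (pm k z - k • e)).trans ?_
  rw [Finset.sum_const, card_bx, nsmul_eq_mul]
  have hsl : (s:ℝ) ≤ 2 * l := by
    have : s ≤ 2 * l := by omega
    exact_mod_cast this
  have h7 : (s:ℝ) ^ d ≤ 2 ^ d * (l:ℝ) ^ d := by
    rw [← mul_pow]; exact pow_le_pow_left₀ (Nat.cast_nonneg _) hsl _
  have h8 : (8:ℝ) ^ d = 2 ^ d * 2 ^ d * 2 ^ d := by rw [← mul_pow, ← mul_pow]; norm_num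
  push_cast
  rw [h8]
  calc (2:ℝ) ^ d * (2 ^ d * (K * (s:ℝ) ^ d)) ≤ (2:ℝ) ^ d * (2 ^ d * (K * (2 ^ d * (l:ℝ) ^ d))) := by
        gcongr
    _ = _ := by ring

section
variable {P : Measure Ω} {τ : Zd d → Ω → Ω} {E0 : Finset (Zd d)} {p c₁ : ℝ}
    {V : Zd d → Ω → Rn n → ℝ} {lam : Zd d → Ω → ℝ}

lemma norm_toRd_stdb (j : Fin d) : ‖toRd (stdb j : Zd d)‖ = 1 := by
  have h : toRd (stdb j : Zd d) = EuclideanSpace.single j (1:ℝ) := by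
    ext i
    rw [toRd_apply]
    simp [stdb, Pi.single_apply, eq_comm]
  rw [h]; simp

lemma Hyp.coer (H : Hyp P τ E0 p c₁ V lam) (F : Rd d →L[ℝ] Rn n) (ω : Ω) (φ : Zd d → Rn n)
    (z : Zd d) (j : Fin d) :
    lam (stdb j) (τ z ω) * ‖φ (z + stdb j) - φ z‖ ^ p ≤
      2 ^ p * (c₁ * ∑ b ∈ E0, V b (τ z ω) ((‖toRd b‖)⁻¹ • (F (toRd b) + (φ (z + b) - φ z))) +
        (c₁ ^ 2 + ‖F‖ ^ p) * lam (stdb j) (τ z ω)) := by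
  have hp0 : 0 ≤ p := by linarith [H.hp]
  have hb := H.E0b j
  have hc := H.hc₁
  set a := lam (stdb j) (τ z ω) with ha
  have ha0 : 0 ≤ a := H.lamnn _ hb _
  set r := F (toRd (stdb j)) + (φ (z + stdb j) - φ z) with hr
  have h1 : V (stdb j) (τ z ω) r ≤
      ∑ b ∈ E0, V b (τ z ω) ((‖toRd b‖)⁻¹ • (F (toRd b) + (φ (z + b) - φ z))) := by
    have := Finset.single_le_sum (f := fun b => V b (τ z ω) ((‖toRd b‖)⁻¹ •
      (F (toRd b) + (φ (z + b) - φ z)))) (fun b hb => H.Vnn b hb _ _) hb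
    simp only [norm_toRd_stdb, inv_one, one_smul] at this
    exact this
  have h2 := H.lo _ hb (τ z ω) r
  rw [← ha] at h2
  have h3 : ‖φ (z + stdb j) - φ z‖ ≤ ‖r‖ + ‖F‖ := by
    have e : φ (z + stdb j) - φ z = r - F (toRd (stdb j)) := by rw [hr]; abel
    rw [e]
    refine (norm_sub_le _ _).trans (add_le_add_right ?_ _)
    have := F.le_opNorm (toRd (stdb j))
    rwa [norm_toRd_stdb, mul_one] at this
  have h4 : ‖φ (z + stdb j) - φ z‖ ^ p ≤ 2 ^ p * (‖r‖ ^ p + ‖F‖ ^ p) :=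
    (Real.rpow_le_rpow (norm_nonneg _) h3 hp0).trans
      (add_rpow_le hp0 (norm_nonneg _) (norm_nonneg _))
  have h5 : a * ‖r‖ ^ p ≤ c₁ * V (stdb j) (τ z ω) r + c₁ ^ 2 * a := by
    have := mul_le_mul_of_nonneg_left h2 hc.le
    have e : c₁ * (a * (‖r‖ ^ p / c₁ - c₁)) = a * ‖r‖ ^ p - c₁ ^ 2 * a := by field_simp
    linarith
  have h6 := mul_le_mul_of_nonneg_left h1 hc.le
  calc a * ‖φ (z + stdb j) - φ z‖ ^ p ≤ a * (2 ^ p * (‖r‖ ^ p + ‖F‖ ^ p)) :=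
        mul_le_mul_of_nonneg_left h4 ha0
    _ = 2 ^ p * (a * ‖r‖ ^ p + ‖F‖ ^ p * a) := by ring
    _ ≤ _ := by
        refine mul_le_mul_of_nonneg_left ?_ (by positivity)
        linarith

lemma Hyp.lampos_all (H : Hyp P τ E0 p c₁ V lam) :
    ∀ᵐ ω ∂P, ∀ z : Zd d, ∀ j, 0 < lam (stdb j) (τ z ω) := by
  rw [ae_all_iff]
  intro z
  rw [ae_all_iff]
  intro j
  exact (H.τmp z).quasiMeasurePreserving.ae (H.lampos j)

/-- the starting bound -/
lemma Hyp.start (H : Hyp P τ E0 p c₁ V lam) (F : Rd d →L[ℝ] Rn n) : ∃ C0 : ℝ, 0 ≤ C0 ∧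
    ∀ q : ℕ, 0 < q → WHP P (fun k ω => ∀ φ : Zd d → Rn n, Per k φ →
      en τ E0 V ω F φ k ≤ (k:ℝ) ^ d * W0 P τ E0 V F →
      gp k p (Av (bx d (k / q)) φ) ≤ C0 * (k:ℝ) ^ d ∧ gp k 1 φ ≤ C0 * (k:ℝ) ^ d) := by
  have hp0 : 0 ≤ p := by linarith [H.hp]
  have hc := H.hc₁
  have hW := H.W0_nonneg F
  set L := Lbd P E0 lam + 1 with hL
  have hL0 : 0 ≤ L := by have := H.one_le_Lbd; linarith
  set μ : Fin d → Ω → ℝ := fun j ω => (lam (stdb j) ω) ^ (-(1 / (p - 1))) with hμdef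
  have hμ0 : ∀ j ω, 0 ≤ μ j ω := fun j ω => Real.rpow_nonneg (H.lamnn _ (H.E0b j) ω) _
  set K := 1 + ∑ j, ∫ ω, μ j ω ∂P with hK
  have hKj : ∀ j, ∫ ω, μ j ω ∂P < K := fun j => by
    have := Finset.single_le_sum (f := fun j => ∫ ω, μ j ω ∂P)
      (fun j _ => integral_nonneg (μ := P) (hμ0 j)) (Finset.mem_univ j)
    rw [hK]; linarith
  have hK0 : 0 ≤ K := by
    have := Finset.sum_nonneg (s := Finset.univ) (f := fun j => ∫ ω, μ j ω ∂P)
      (fun j _ => integral_nonneg (μ := P) (hμ0 j))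
    rw [hK]; linarith
  set C1 := 8 ^ d * K with hC1
  have hC10 : 0 ≤ C1 := by positivity
  set CE := d * (2 ^ p * (c₁ * W0 P τ E0 V F + (c₁ ^ 2 + ‖F‖ ^ p) * L)) with hCE
  have hCE0 : 0 ≤ CE := by positivity
  refine ⟨(1 + C1) ^ p * (d + CE) + (CE + d * K), by positivity, fun q hq => ?_⟩
  have w1 : WHP P (fun k ω => ∀ b ∈ E0, ∑ z ∈ bx d k, lam b (τ z ω) ≤ L * (k:ℝ) ^ d) :=
    WHP.finset E0 fun b hb => H.whp_sum_le _ (H.lamint b hb) (by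
      have := H.le_Lbd hb; rw [hL]; linarith)
  have w2 : WHP P (fun k ω => ∀ j ∈ (Finset.univ : Finset (Fin d)),
      ∑ z ∈ bx d k, μ j (τ z ω) ≤ K * (k:ℝ) ^ d) :=
    WHP.finset _ fun j _ => H.whp_sum_le _ (H.muint j) (hKj j)
  have hst : Tendsto (fun k => k / q + 1) atTop atTop :=
    tendsto_atTop_mono (fun k => Nat.le_succ _) (Nat.tendsto_div_const_atTop hq.ne')
  have w3 : WHP P (fun k ω => ∀ j ∈ (Finset.univ : Finset (Fin d)), ∀ x ∈ bx d q,
      ∑ z ∈ bx d (k / q + 1), μ j (τ z (τ ((k / q + 1) • x) ω)) ≤ K * ((k / q + 1 : ℕ):ℝ) ^ d) :=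
    WHP.finset _ fun j _ => WHP.finset _ fun x _ =>
      H.whp_shift (H.whp_sum_le _ (H.muint j) (hKj j)) hst (fun k => (k / q + 1) • x)
  have w4 : WHP P (fun _ ω => ∀ z : Zd d, ∀ j, 0 < lam (stdb j) (τ z ω)) :=
    WHP.of_ae fun _ => H.lampos_all
  refine ((w1.and w2).and (w3.and w4)).mono ?_
  filter_upwards [eventually_ge_atTop q] with k hkq ω hω φ hφ hen
  obtain ⟨⟨g1, g2⟩, g3, g4⟩ := hω
  have hk : 0 < k := lt_of_lt_of_le hq hkq
  obtain ⟨hl, -⟩ := scale_ge hq hkq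
  have hkd : (0:ℝ) < (k:ℝ) ^ d := by positivity
  set a : Fin d → Zd d → ℝ := fun j z => lam (stdb j) (τ (pm k z) ω) with ha
  have haP : ∀ j, Per k (a j) := fun j => per_comp_pm k (fun z => lam (stdb j) (τ z ω))
  have ha0 : ∀ j z, 0 < a j z := fun j z => g4 _ j
  set X : Fin d → Zd d → ℝ := fun j z => ‖φ (z + stdb j) - φ z‖ with hX
  have hXP : ∀ j, Per k (X j) := fun j => (hφ.diff (stdb j)).comp norm
  -- energy bound
  have hE : ∑ j, ∑ z ∈ bx d k, a j z * X j z ^ p ≤ CE * (k:ℝ) ^ d := by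
    have h1 : ∀ j ∈ (Finset.univ : Finset (Fin d)), ∑ z ∈ bx d k, a j z * X j z ^ p ≤
        2 ^ p * (c₁ * W0 P τ E0 V F + (c₁ ^ 2 + ‖F‖ ^ p) * L) * (k:ℝ) ^ d := by
      intro j _
      have h2 : ∀ z ∈ bx d k, a j z * X j z ^ p ≤
        2 ^ p * (c₁ * ∑ b ∈ E0, V b (τ z ω) ((‖toRd b‖)⁻¹ • (F (toRd b) + (φ (z + b) - φ z))) +
        (c₁ ^ 2 + ‖F‖ ^ p) * lam (stdb j) (τ z ω)) := by
        intro z hz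
        simp only [ha, hX]
        rw [pm_of_mem hz]
        exact H.coer F ω φ z j
      refine (Finset.sum_le_sum h2).trans ?_
      rw [← Finset.mul_sum, Finset.sum_add_distrib, ← Finset.mul_sum, ← Finset.mul_sum]
      have h3 := g1 _ (H.E0b j)
      unfold en at hen
      have h4 := mul_le_mul_of_nonneg_left hen hc.le
      have h5 := mul_le_mul_of_nonneg_left h3 (by positivity : 0 ≤ c₁ ^ 2 + ‖F‖ ^ p)
      rw [mul_assoc]
      refine mul_le_mul_of_nonneg_left ?_ (by positivity)
      linarith
    refine (Finset.sum_le_sum h1).trans (le_of_eq ?_)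
    rw [Finset.sum_const, Finset.card_univ, Fintype.card_fin, nsmul_eq_mul, hCE]
    ring
  constructor
  · -- smoothed gradient
    have hNl : (0:ℝ) < ((k / q : ℕ):ℝ) ^ d := by positivity
    have hmain : ∀ j (z : Zd d), ‖Av (bx d (k / q)) φ (z + stdb j) - Av (bx d (k / q)) φ z‖ ^ p ≤
        (1 + C1) ^ p * (1 + (((k / q : ℕ):ℝ) ^ d)⁻¹ *
          ∑ y ∈ bx d (k / q), a j (z + y) * X j (z + y) ^ p) := by
      intro j z
      have hmu := torus_sum hq hkq (fun w => μ j (τ w ω)) (fun w => hμ0 j _) hK0 (fun x hx => by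
        have := g3 j (Finset.mem_univ j) x hx
        simpa only [H.τadd'] using this) z
      refine le_trans ?_ (avg_young H.hp hC10 (bx d (k / q)) hNl (fun y => a j (z + y))
        (fun y => X j (z + y)) (fun y _ => ha0 _ _) (fun y _ => norm_nonneg _) hmu)
      refine Real.rpow_le_rpow (norm_nonneg _) ?_ hp0
      rw [av_diff]
      unfold Av
      rw [card_bx, norm_smul, norm_inv, Real.norm_of_nonneg (Nat.cast_nonneg _), Nat.cast_pow]
      exact mul_le_mul_of_nonneg_left (norm_sum_le _ _) (by positivity)
    have hsum : ∀ j, ∑ z ∈ bx d k, (((k / q : ℕ):ℝ) ^ d)⁻¹ *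
        ∑ y ∈ bx d (k / q), a j (z + y) * X j (z + y) ^ p = ∑ z ∈ bx d k, a j z * X j z ^ p := by
      intro j
      rw [← Finset.mul_sum, Finset.sum_comm]
      have hP : Per k (fun z => a j z * X j z ^ p) := (haP j).comp₂ (hXP j) (fun s t => s * t ^ p)
      have : ∀ y ∈ bx d (k / q), ∑ z ∈ bx d k, a j (z + y) * X j (z + y) ^ p =
          ∑ z ∈ bx d k, a j z * X j z ^ p := fun y _ => sum_per hk hP y
      rw [Finset.sum_congr rfl this, Finset.sum_const, card_bx, nsmul_eq_mul, ← mul_assoc,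
        Nat.cast_pow, inv_mul_cancel₀ hNl.ne', one_mul]
    have h1 : gp k p (Av (bx d (k / q)) φ) ≤ (1 + C1) ^ p * (d * (k:ℝ) ^ d +
        ∑ j, ∑ z ∈ bx d k, a j z * X j z ^ p) := by
      unfold gp
      rw [Finset.sum_comm]
      refine (Finset.sum_le_sum fun j _ => Finset.sum_le_sum fun z _ => hmain j z).trans (le_of_eq ?_)
      simp only [← Finset.mul_sum (s := bx d k) (a := (1 + C1) ^ p), Finset.sum_add_distrib, hsum]
      rw [← Finset.mul_sum, Finset.sum_add_distrib]
      simp [card_bx]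
    have h2 := mul_le_mul_of_nonneg_left hE (by positivity : 0 ≤ (1 + C1) ^ p)
    have h3 : 0 ≤ (CE + d * K) * (k:ℝ) ^ d := by positivity
    nlinarith
  · have h1 : gp k 1 φ ≤ ∑ j, ∑ z ∈ bx d k, a j z * X j z ^ p + ∑ j, ∑ z ∈ bx d k, μ j (τ z ω) := by
      unfold gp
      rw [Finset.sum_comm, ← Finset.sum_add_distrib]
      refine Finset.sum_le_sum fun j _ => ?_
      rw [← Finset.sum_add_distrib]
      refine Finset.sum_le_sum fun z hz => ?_
      have := young_mu H.hp (ha0 j z) one_pos (norm_nonneg (φ (z + stdb j) - φ z))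
      rw [Real.one_rpow, one_mul, div_one] at this
      rw [Real.rpow_one]
      simp only [ha, hX, hμdef] at *
      rwa [pm_of_mem hz] at *
    have h2 : ∑ j, ∑ z ∈ bx d k, μ j (τ z ω) ≤ d * K * (k:ℝ) ^ d := by
      refine (Finset.sum_le_sum fun j hj => g2 j hj).trans (le_of_eq ?_)
      rw [Finset.sum_const, Finset.card_univ, Fintype.card_fin, nsmul_eq_mul]; ring
    have h3 : 0 ≤ (1 + C1) ^ p * (d + CE) * (k:ℝ) ^ d := by positivity
    nlinarith
end


/-- scale relations -/
structure Grd (k Nc T R0 r g m h : ℕ) : Prop where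
  Nc0 : 0 < Nc
  T4 : 4 ≤ T
  kr : r * Nc ≤ k
  rk : k ≤ r * Nc + Nc
  Ng : Nc ≤ g
  gT : g * T ≤ r
  rg : r ≤ 2 * T * g
  mg : m + 2 * g = r
  hm : h * T ≤ m
  rh : r + 4 * T * R0 ≤ 4 * T * h
  Rg : 4 * R0 ≤ g
  R0p : 0 < R0

lemma Grd.ex {Nc T R0 : ℕ} (hNc : 0 < Nc) (hT : 4 ≤ T) (hR0 : 0 < R0) : ∀ᶠ k in atTop,
    Grd k Nc T R0 (k / Nc) (k / Nc / T) (k / Nc - 2 * (k / Nc / T))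
      ((k / Nc - 2 * (k / Nc / T)) / T) := by
  have h1 : Tendsto (fun k => k / Nc) atTop atTop := Nat.tendsto_div_const_atTop hNc.ne'
  have hT0 : 0 < T := by omega
  filter_upwards [h1.eventually_ge_atTop (4 * T * (R0 + 1 + Nc))] with k hk
  set r := k / Nc with hr
  have hgr : r / T * T ≤ r := Nat.div_mul_le_self r T
  have hgr2 : r < T * (r / T + 1) := Nat.lt_mul_div_succ r hT0
  have hg : 4 * (R0 + 1 + Nc) ≤ r / T := by
    rw [Nat.le_div_iff_mul_le hT0]; nlinarith
  set g := r / T with hgd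
  have h4g : 4 * g ≤ r := by nlinarith
  set m := r - 2 * g with hm
  have hm2 : 2 * m ≥ r := by omega
  have hht : m / T * T ≤ m := Nat.div_mul_le_self m T
  have hht2 : m < T * (m / T + 1) := Nat.lt_mul_div_succ m hT0
  refine ⟨hNc, hT, Nat.div_mul_le_self k Nc, ?_, by omega, hgr, by nlinarith, by omega, hht, ?_,
    by omega, hR0⟩
  · have := Nat.lt_mul_div_succ k hNc
    nlinarith
  · nlinarith

section
variable {k Nc T R0 r g m h : ℕ}

lemma Grd.gpos (G : Grd k Nc T R0 r g m h) : 0 < g := lt_of_lt_of_le G.Nc0 G.Ng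
lemma Grd.rg4 (G : Grd k Nc T R0 r g m h) : 4 * g ≤ r := by
  have := G.gT; have := G.T4; nlinarith
lemma Grd.rpos (G : Grd k Nc T R0 r g m h) : 0 < r := by have := G.rg4; have := G.gpos; omega
lemma Grd.mpos (G : Grd k Nc T R0 r g m h) : 0 < m := by
  have := G.rg4; have := G.mg; have := G.gpos; omega
lemma Grd.kpos (G : Grd k Nc T R0 r g m h) : 0 < k :=
  lt_of_lt_of_le (Nat.mul_pos G.rpos G.Nc0) G.kr
lemma Grd.hm2 (G : Grd k Nc T R0 r g m h) : 2 * h < m := by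
  have := G.hm; have := G.T4; have := G.mpos; nlinarith

/-- corners of the small cells -/
def ctr (r g : ℕ) (x : Zd d) : Zd d := r • x + (fun _ => (g:ℤ))

/-- index of the large cell -/
def idx (r Nc : ℕ) (z : Zd d) : Zd d := fun j => min (z j / r) (Nc - 1)

/-- the affine function -/
def ell (ψ : Zd d → Rn n) (c : Zd d) (A : Rd d →L[ℝ] Rn n) (z : Zd d) : Rn n :=
  ψ c + A (toRd (z - c))

lemma Grd.idx_mem (G : Grd k Nc T R0 r g m h) {z : Zd d} (hz : z ∈ bx d k) : idx r Nc z ∈ bx d Nc := by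
  rw [mem_bx] at *
  intro j
  have h1 := hz j
  have h2 : 0 ≤ z j / r := Int.ediv_nonneg h1.1 (Int.natCast_nonneg r)
  have h3 := G.Nc0
  simp only [idx]
  omega

lemma Grd.idx_cell (G : Grd k Nc T R0 r g m h) {z : Zd d} (hz : z ∈ bx d k) :
    z ∈ cell (r + Nc) (r • idx r Nc z) := by
  rw [mem_cell, mem_bx] at *
  intro j
  have h1 := hz j
  have hr0 : (0:ℤ) < r := by exact_mod_cast G.rpos
  have h3 := Int.emod_add_mul_ediv (z j) r
  have h4 := Int.emod_nonneg (z j) hr0.ne'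
  have h5 := Int.emod_lt_of_pos (z j) hr0
  have h6 : (k:ℤ) ≤ r * Nc + Nc := by exact_mod_cast G.rk
  have hN : (0:ℤ) < Nc := by exact_mod_cast G.Nc0
  simp only [Pi.sub_apply, nsmul_app, idx]
  push_cast
  rcases le_total (z j / r) ((Nc:ℤ) - 1) with h7 | h7
  · rw [min_eq_left h7]
    constructor <;> linarith
  · rw [min_eq_right h7]
    constructor
    · nlinarith
    · nlinarith

lemma Grd.idx_eq (G : Grd k Nc T R0 r g m h) {x z : Zd d} (hx : x ∈ bx d Nc)
    (hz : z ∈ cell r (r • x)) : z ∈ bx d k ∧ idx r Nc z = x := by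
  rw [mem_cell, mem_bx] at hz
  rw [mem_bx] at hx
  have hr0 : (0:ℤ) < r := by exact_mod_cast G.rpos
  have hk : (r:ℤ) * Nc ≤ k := by exact_mod_cast G.kr
  refine ⟨mem_bx.2 fun j => ?_, funext fun j => ?_⟩
  · have h1 := hz j
    have h2 := hx j
    simp only [Pi.sub_apply, nsmul_app] at h1
    constructor <;> nlinarith
  · have h1 := hz j
    have h2 := hx j
    simp only [Pi.sub_apply, nsmul_app] at h1
    have h3 : z j / r = x j := by
      apply le_antisymm
      · rw [← Int.lt_add_one_iff]
        apply Int.ediv_lt_of_lt_mul hr0; nlinarith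
      · apply Int.le_ediv_of_mul_le hr0; nlinarith
    simp only [idx, h3]
    omega

lemma Grd.cell_sub (G : Grd k Nc T R0 r g m h) (x : Zd d) : cell m (ctr r g x) ⊆ cell r (r • x) := by
  intro z hz
  rw [mem_cell, mem_bx] at *
  intro j
  have h1 := hz j
  have h2 := G.mg
  simp only [Pi.sub_apply, ctr, Pi.add_apply, nsmul_app] at *
  omega

lemma Grd.cell_ne (G : Grd k Nc T R0 r g m h) (x : Zd d) :
    ((cell m (ctr r g x) : Finset (Zd d)) : Set (Zd d)).Nonempty := by
  refine ⟨ctr r g x, ?_⟩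
  rw [Finset.mem_coe, mem_cell, sub_self, mem_bx]
  intro j
  have := G.mpos
  simp only [Pi.zero_apply]
  omega

lemma Grd.near (G : Grd k Nc T R0 r g m h) {x z : Zd d} (hx : x ∈ bx d Nc)
    (hz : infDist z (cell m (ctr r g x) : Set (Zd d)) < g) : z ∈ bx d k ∧ idx r Nc z = x := by
  refine G.idx_eq hx ?_
  rw [infDist_lt_iff (G.cell_ne x)] at hz
  obtain ⟨y, hy, hd⟩ := hz
  rw [Finset.mem_coe, mem_cell, mem_bx] at hy
  rw [mem_cell, mem_bx]
  intro j
  have h1 := hy j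
  have h2 : dist (z j) (y j) < g := lt_of_le_of_lt (dist_le_pi_dist z y j) hd
  rw [Int.dist_eq, ← Int.cast_sub, ← Int.cast_abs] at h2
  have h3 : |z j - y j| < (g:ℤ) := by exact_mod_cast h2
  have h5 := abs_lt.1 h3
  have h4 := G.mg
  simp only [Pi.sub_apply, ctr, Pi.add_apply, nsmul_app] at *
  omega

lemma Grd.dist_ctr (G : Grd k Nc T R0 r g m h) {x z : Zd d} (hz : z ∈ cell (r + Nc) (r • x)) :
    dist z (ctr r g x) ≤ ((2 * r : ℕ) : ℝ) := by
  rw [dist_pi_le_iff (Nat.cast_nonneg _)]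
  intro j
  rw [mem_cell, mem_bx] at hz
  have h1 := hz j
  have h2 := G.Ng
  have h3 := G.rg4
  simp only [Pi.sub_apply, nsmul_app] at h1
  rw [Int.dist_eq, ← Int.cast_sub, ← Int.cast_abs]
  have h4 : |z j - ctr r g x j| ≤ ((2 * r : ℕ):ℤ) := by
    rw [abs_le]
    simp only [ctr, Pi.add_apply, nsmul_app]
    push_cast at *
    constructor <;> linarith
  exact_mod_cast h4

lemma cell_mono {m m' : ℕ} (hm : m ≤ m') (c : Zd d) : cell m c ⊆ cell m' c := by
  intro z hz
  rw [mem_cell, mem_bx] at *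
  intro j
  have := hz j
  omega

lemma ell_err {ψ : Zd d → Rn n} {A : Rd d →L[ℝ] Rn n} {c : Zd d} {ρ σ : ℝ} (hσ : 0 ≤ σ)
    (hA : ∀ z j, dist z c ≤ ρ → ‖ψ (z + stdb j) - ψ z - A (toRd (stdb j))‖ ≤ σ) :
    (∀ z (h : ℕ), dist z c ≤ ρ → dist z c ≤ h → ‖ell ψ c A z - ψ z‖ ≤ d * h * σ) ∧
    ∀ z b (h : ℕ), dist z c + dist (z + b) z ≤ ρ → dist (z + b) z ≤ h →
      ‖(ell ψ c A (z + b) - ψ (z + b)) - (ell ψ c A z - ψ z)‖ ≤ d * h * σ := by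
  set u : Zd d → Rn n := fun z => ell ψ c A z - ψ z with hu
  have hstep : ∀ z j, dist z c ≤ ρ → ‖u (z + stdb j) - u z‖ ≤ σ := by
    intro z j hz
    have e : u (z + stdb j) - u z = -(ψ (z + stdb j) - ψ z - A (toRd (stdb j))) := by
      simp only [hu, ell, toRd_sub, toRd_add, map_sub, map_add]
      abel
    rw [e, norm_neg]
    exact hA z j hz
  refine ⟨fun z h hz hh => ?_, fun z b h hz hh => ?_⟩
  · have h1 := path_le' u c hσ hstep hz hh
    have h0 : u c = 0 := by simp [hu, ell, toRd_zero]
    rwa [h0, sub_zero] at h1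
  · refine path_le' u z (ρ := dist (z + b) z) hσ (fun y j hy => hstep y j ?_) le_rfl hh
    have := dist_triangle y z c
    linarith

section
variable {P : Measure Ω} {τ : Zd d → Ω → Ω} {E0 : Finset (Zd d)} {p c₁ : ℝ}
    {V : Zd d → Ω → Rn n → ℝ} {lam : Zd d → Ω → ℝ}

lemma tr_lip' {X : Type*} [NormedAddCommGroup X] [NormedSpace ℝ X] {s : ℝ} (hs : 0 < s) (x y : X) :
    ‖tr s x - tr s y‖ ≤ 3 * ‖x - y‖ := by
  rcases le_total ‖x‖ ‖y‖ with h | h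
  · exact tr_lip hs h
  · rw [norm_sub_rev, norm_sub_rev x y]; exact tr_lip hs h

/-- corrector making `ψ` affine on the cells -/
def Zc (r g m Nc : ℕ) (ψ : Zd d → Rn n) (A : Zd d → Rd d →L[ℝ] Rn n) (y : Zd d) : Rn n × ℝ :=
  (ell ψ (ctr r g (idx r Nc y)) (A (idx r Nc y)) y - ψ y,
    infDist y (cell m (ctr r g (idx r Nc y)) : Set (Zd d)))

lemma Hyp.upper (H : Hyp P τ E0 p c₁ V lam) (F : Rd d →L[ℝ] Rn n) (G : Grd k Nc T R0 r g m h)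
    (hR0 : irange d E0 ≤ R0) {σ : ℝ} (hσ : 0 ≤ σ) (hσ1 : σ ≤ 1) (hσT : 24 * d * T * σ ≤ 1)
    {ψ : Zd d → Rn n} (hψ : Per k ψ) (A : Zd d → Rd d →L[ℝ] Rn n)
    (hA : ∀ x ∈ bx d Nc, ∀ z j, dist z (ctr r g x) ≤ ((2 * r + R0 : ℕ):ℝ) →
      ‖ψ (z + stdb j) - ψ z - A x (toRd (stdb j))‖ ≤ σ) :
    (k:ℝ) ^ d * W0 P τ E0 V F ≤ ∑ x ∈ bx d Nc, ∫ ω, mF τ E0 V ω (F + A x) (cube d m) ∂P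
        + ∑ z ∈ bx d k \ (bx d Nc).biUnion (fun x => cell m (ctr r g x)),
          E0.card * Cv P E0 lam p c₁ (R0 * (‖F‖ + 4 * d + 4) * (1 + ‖A (idx r Nc z)‖)) := by
  set s : ℝ := (g:ℝ) / 4 with hs
  have hgp : (0:ℝ) < g := by exact_mod_cast G.gpos
  have hs0 : 0 < s := by positivity
  have hRs : (R0:ℝ) ≤ s := by
    have : ((4 * R0 : ℕ):ℝ) ≤ g := by exact_mod_cast G.Rg
    push_cast at this; rw [hs]; linarith
  have hR0' : (0:ℝ) ≤ R0 := Nat.cast_nonneg _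
  have hir := irange_nonneg E0
  have hlarge : (d:ℝ) * ((2 * r + R0 : ℕ):ℝ) * σ ≤ s := by
    have h1 : ((2 * r + R0 : ℕ):ℝ) ≤ 3 * r := by
      have : 2 * r + R0 ≤ 3 * r := by have := G.Rg; have := G.rg4; omega
      exact_mod_cast this
    have h2 : (r:ℝ) ≤ 2 * T * g := by exact_mod_cast G.rg
    have h3 : (d:ℝ) * ((2 * r + R0 : ℕ):ℝ) * σ ≤ d * (3 * (2 * T * g)) * σ := by
      refine mul_le_mul_of_nonneg_right (mul_le_mul_of_nonneg_left (by linarith) (by positivity)) hσ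
    have h4 : (d:ℝ) * (3 * (2 * T * g)) * σ = 24 * d * T * σ * s := by rw [hs]; ring
    rw [h4] at h3
    nlinarith
  set Z : Zd d → Rn n := fun y => (tr s (Zc r g m Nc ψ A y)).1 with hZ
  set w : Zd d → Rn n := fun z => ψ z + Z (pm k z) with hw
  have hwP : Per k w := hψ.comp₂ (per_comp_pm k Z) (fun a b => a + b)
  -- distance bookkeeping
  have hinf : ∀ (x z b : Zd d), b ∈ E0 → infDist (z + b) (cell m (ctr r g x) : Set (Zd d)) ≤
      infDist z (cell m (ctr r g x) : Set (Zd d)) + R0 := by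
    intro x z b hb
    refine (infDist_le_infDist_add_dist (y := z)).trans ?_
    have := dist_add_le hb z
    linarith
  have hinf' : ∀ (x z b : Zd d), b ∈ E0 → infDist z (cell m (ctr r g x) : Set (Zd d)) ≤
      infDist (z + b) (cell m (ctr r g x) : Set (Zd d)) + R0 := by
    intro x z b hb
    refine (infDist_le_infDist_add_dist (y := z + b)).trans ?_
    have := dist_add_le hb z
    rw [dist_comm] at this
    linarith
  have hdc : ∀ z ∈ bx d k, dist z (ctr r g (idx r Nc z)) ≤ ((2 * r : ℕ):ℝ) := fun z hz =>
    G.dist_ctr (G.idx_cell hz)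
  -- Zc vanishing far away
  have hZfar : ∀ y, 2 * s ≤ infDist y (cell m (ctr r g (idx r Nc y)) : Set (Zd d)) → Z y = 0 := by
    intro y hy
    simp only [hZ]
    rw [tr_zero hs0]
    · rfl
    · refine hy.trans ?_
      have h1 := norm_snd_le (Zc r g m Nc ψ A y)
      have h2 : ‖(Zc r g m Nc ψ A y).2‖ = infDist y (cell m (ctr r g (idx r Nc y)) : Set (Zd d)) :=
        Real.norm_of_nonneg infDist_nonneg
      linarith
  -- dichotomy on edges
  have hdich : ∀ z ∈ bx d k, ∀ b ∈ E0, (z + b ∈ bx d k ∧ idx r Nc (z + b) = idx r Nc z) ∨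
      (Z z = 0 ∧ Z (pm k (z + b)) = 0) := by
    intro z hz b hb
    by_cases h1 : infDist z (cell m (ctr r g (idx r Nc z)) : Set (Zd d)) < 2 * s
    · left
      have h2 := hinf (idx r Nc z) z b hb
      exact G.near (G.idx_mem hz) (by rw [hs] at h1 hRs; linarith)
    · push Not at h1
      by_cases h3 : infDist (pm k (z + b)) (cell m (ctr r g (idx r Nc (pm k (z + b)))) : Set (Zd d)) < 2 * s
      · left
        set y := pm k (z + b) with hy
        have hyk : y ∈ bx d k := pm_mem G.kpos _
        have h4 := hinf' (idx r Nc y) (y - b) b hb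
        rw [sub_add_cancel] at h4
        obtain ⟨h5, h6⟩ := G.near (z := y - b) (G.idx_mem hyk) (by rw [hs] at h3 hRs; linarith)
        have h7 : y - b = z := by
          have h8 : y - b = z + k • (fun j => -((z + b) j / k)) := by
            rw [hy, pm_eq]; abel
          rw [← pm_of_mem h5, h8, pm_add_smul, pm_of_mem hz]
        have h9 : y = z + b := by rw [← h7, sub_add_cancel]
        rw [h7] at h6
        rw [← h9]
        exact ⟨hyk, h6.symm⟩
      · push Not at h3
        exact Or.inr ⟨hZfar z h1, hZfar _ h3⟩
  -- Lipschitz bound of the corrector on an edge inside one cell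
  have hlip : ∀ z ∈ bx d k, ∀ b ∈ E0, ‖Z (pm k (z + b)) - Z z‖ ≤ 3 * (d * R0 + R0) := by
    intro z hz b hb
    rcases hdich z hz b hb with ⟨h1, h2⟩ | ⟨h1, h2⟩
    · rw [pm_of_mem h1]
      simp only [hZ]
      rw [← Prod.fst_sub]
      refine (norm_fst_le _).trans ((tr_lip' hs0 _ _).trans (mul_le_mul_of_nonneg_left ?_ (by norm_num)))
      have hdb : dist (z + b) z ≤ (R0:ℝ) := (dist_add_le hb z).trans hR0
      rw [Prod.norm_def]
      refine max_le ?_ ?_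
      · have h3 := (ell_err hσ (hA _ (G.idx_mem hz))).2 z b R0 (by
          have := hdc z hz
          push_cast at *
          linarith) hdb
        have h4 : ‖(Zc r g m Nc ψ A (z + b) - Zc r g m Nc ψ A z).1‖ ≤ d * R0 * σ := by
          simp only [Zc, h2, Prod.mk_sub_mk]
          exact h3
        have : (d:ℝ) * R0 * σ ≤ d * R0 * 1 := mul_le_mul_of_nonneg_left hσ1 (by positivity)
        linarith
      · simp only [Zc, h2, Prod.mk_sub_mk]
        rw [Real.norm_eq_abs, abs_le]
        have h5 := hinf (idx r Nc z) z b hb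
        have h6 := hinf' (idx r Nc z) z b hb
        have : (0:ℝ) ≤ d * R0 := by positivity
        constructor <;> linarith
    · rw [h1, h2, sub_zero, norm_zero]; positivity
  have hkR : irange d E0 < k := by
    have h1 : 4 * R0 < k := by
      have := G.Rg; have := G.rg4; have := G.gpos
      have : r ≤ k := le_trans (Nat.le_mul_of_pos_right r G.Nc0) G.kr
      omega
    have h2 : ((4 * R0 : ℕ):ℝ) < k := by exact_mod_cast h1
    push_cast at h2
    linarith
  -- exactness on cells
  have hcellx : ∀ x ∈ bx d Nc, ∀ y, infDist y (cell m (ctr r g x) : Set (Zd d)) ≤ R0 →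
      y ∈ bx d k ∧ w y = ell ψ (ctr r g x) (A x) y := by
    intro x hx y hy
    obtain ⟨h1, h2⟩ := G.near hx (lt_of_le_of_lt hy (by rw [hs] at hRs; linarith))
    refine ⟨h1, ?_⟩
    simp only [hw, hZ]
    rw [pm_of_mem h1, tr_id hs0]
    · simp only [Zc, h2]; abel
    · rw [Prod.norm_def]
      refine max_le ?_ ?_
      · simp only [Zc]
        have h3 := hdc y h1
        have h4 := (ell_err hσ (hA _ (G.idx_mem h1))).1 y (2 * r + R0) (by push_cast at *; linarith)
          (by push_cast at *; linarith)
        exact h4.trans hlarge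
      · simp only [Zc, h2]
        rw [Real.norm_of_nonneg infDist_nonneg]
        linarith
  have hnear : ∀ x, ∀ z ∈ cell m (ctr r g x), ∀ b ∈ E0,
      infDist (z + b) (cell m (ctr r g x) : Set (Zd d)) ≤ R0 := by
    intro x z hz b hb
    have := hinf x z b hb
    rwa [infDist_zero_of_mem (Finset.mem_coe.2 hz), zero_add] at this
  refine H.up F hkR w hwP (bx d Nc) (ctr r g) A ?_ ?_ ?_ ?_ _ ?_
  · intro x hx z hz
    exact (G.idx_eq hx (G.cell_sub x hz)).1
  · intro x hx y hy z h1 h2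
    rw [← (G.idx_eq hx (G.cell_sub x h1)).2, ← (G.idx_eq hy (G.cell_sub y h2)).2]
  · intro x hx z hz b hb
    exact (hcellx x hx (z + b) (hnear x z hz b hb)).1
  · intro x hx z hz b hb
    rw [(hcellx x hx (z + b) (hnear x z hz b hb)).2, (hcellx x hx z (by
      rw [infDist_zero_of_mem (Finset.mem_coe.2 hz)]; exact hR0')).2]
    simp only [ell, toRd_sub, toRd_add, map_sub, map_add]
    abel
  · intro z hz b hb
    set x := idx r Nc z with hx
    have e : F (toRd b) + (w (z + b) - w z) = F (toRd b) + A x (toRd b) -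
        ((ell ψ (ctr r g x) (A x) (z + b) - ψ (z + b)) - (ell ψ (ctr r g x) (A x) z - ψ z)) +
        (Z (pm k (z + b)) - Z z) := by
      simp only [hw, ell, toRd_sub, toRd_add, map_sub, map_add, pm_of_mem hz]
      abel
    have hdb : dist (z + b) z ≤ (R0:ℝ) := (dist_add_le hb z).trans hR0
    have h3 := (ell_err hσ (hA _ (G.idx_mem hz))).2 z b R0 (by
          have := hdc z hz
          push_cast at *
          linarith) hdb
    rw [← hx] at h3
    have h4 := hlip z hz b hb
    have h5 := norm_G_le E0 F hb
    have h6 := norm_G_le E0 (A x) hb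
    have h7 : ‖F‖ * irange d E0 ≤ ‖F‖ * R0 := mul_le_mul_of_nonneg_left hR0 (norm_nonneg _)
    have h8 : ‖A x‖ * irange d E0 ≤ ‖A x‖ * R0 := mul_le_mul_of_nonneg_left hR0 (norm_nonneg _)
    have h9 : (d:ℝ) * R0 * σ ≤ d * R0 * 1 := mul_le_mul_of_nonneg_left hσ1 (by positivity)
    rw [e]
    refine (norm_add_le _ _).trans ?_
    have h10 := norm_sub_le (F (toRd b) + A x (toRd b))
      ((ell ψ (ctr r g x) (A x) (z + b) - ψ (z + b)) - (ell ψ (ctr r g x) (A x) z - ψ z))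
    have h11 := norm_add_le (F (toRd b)) (A x (toRd b))
    have h12 : 0 ≤ (R0:ℝ) * (‖F‖ + 4 * d) * ‖A x‖ := by positivity
    have h13 : 0 ≤ (R0:ℝ) * ‖A x‖ := by positivity
    nlinarith
end
end


section
variable {k Nc T R0 r g m h : ℕ}

lemma Grd.sum_cells_le (G : Grd k Nc T R0 r g m h) {f : Zd d → ℝ} (hf : ∀ z, 0 ≤ f z) :
    ∑ x ∈ bx d Nc, ∑ z ∈ cell r (r • x), f z ≤ ∑ z ∈ bx d k, f z := by
  rw [← Finset.sum_biUnion]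
  · refine Finset.sum_le_sum_of_subset_of_nonneg ?_ fun z _ _ => hf z
    intro z hz
    rw [Finset.mem_biUnion] at hz
    obtain ⟨x, hx, hz⟩ := hz
    exact (G.idx_eq hx hz).1
  · intro x hx y hy hxy
    rw [Function.onFun, Finset.disjoint_left]
    intro z h1 h2
    exact hxy ((G.idx_eq hx h1).2.symm.trans (G.idx_eq hy h2).2)

lemma Grd.sum_small_le (G : Grd k Nc T R0 r g m h) {f : Zd d → ℝ} (hf : ∀ z, 0 ≤ f z) :
    ∑ x ∈ bx d Nc, ∑ z ∈ cell m (ctr r g x), f z ≤ ∑ z ∈ bx d k, f z :=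
  (Finset.sum_le_sum fun x _ => Finset.sum_le_sum_of_subset_of_nonneg (G.cell_sub x)
    fun z _ _ => hf z).trans (G.sum_cells_le hf)

lemma Grd.fibre_card (hd : 0 < d) (G : Grd k Nc T R0 r g m h) (x : Zd d) :
    ((cell (r + Nc) (r • x) \ cell m (ctr r g x)).card : ℝ) ≤ 4 * d * 2 ^ d / T * (r:ℝ) ^ d := by
  have hsub : cell m (ctr r g x) ⊆ cell (r + Nc) (r • x) :=
    (G.cell_sub x).trans (cell_mono (Nat.le_add_right _ _) _)
  have h1 := G.rg4
  have h2 := G.mg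
  have h3 := G.Ng
  have hT : (0:ℝ) < T := by have := G.T4; exact_mod_cast (by omega : 0 < T)
  rw [Finset.card_sdiff_of_subset hsub, card_cell, card_cell, Nat.cast_sub (Nat.pow_le_pow_left (by omega) _)]
  push_cast
  have h4 := layer_le d (r + Nc) (2 * g)
  have h5 : ((r + Nc - 2 * (2 * g) : ℕ):ℝ) ^ d ≤ (m:ℝ) ^ d :=
    pow_le_pow_left₀ (Nat.cast_nonneg _) (by exact_mod_cast (by omega : r + Nc - 2 * (2 * g) ≤ m)) _
  have h6 : (d:ℝ) * (2 * (2 * g : ℕ)) * ((r + Nc : ℕ):ℝ) ^ (d - 1) ≤ 4 * d * 2 ^ d / T * (r:ℝ) ^ d := by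
    have h7 : ((r + Nc : ℕ):ℝ) ≤ 2 * r := by exact_mod_cast (by omega : r + Nc ≤ 2 * r)
    have h8 : ((r + Nc : ℕ):ℝ) ^ (d - 1) ≤ (2 * r) ^ (d - 1) := pow_le_pow_left₀ (Nat.cast_nonneg _) h7 _
    have h9 : (g:ℝ) ≤ r / T := by
      rw [le_div_iff₀ hT]; exact_mod_cast G.gT
    obtain ⟨e, rfl⟩ : ∃ e, d = e + 1 := ⟨d - 1, by omega⟩
    simp only [Nat.add_sub_cancel] at h8 ⊢
    calc ((e + 1 : ℕ):ℝ) * (2 * (2 * g : ℕ)) * ((r + Nc : ℕ):ℝ) ^ e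
        ≤ ((e + 1 : ℕ):ℝ) * (2 * (2 * (r / T))) * (2 * r) ^ e := by
          push_cast at *
          gcongr
      _ = 4 * ((e + 1 : ℕ):ℝ) * 2 ^ e / T * (r:ℝ) ^ (e + 1) := by rw [mul_pow]; ring
      _ ≤ 4 * ((e + 1 : ℕ):ℝ) * 2 ^ (e + 1) / T * (r:ℝ) ^ (e + 1) := by
          gcongr
          · norm_num
          · omega
  push_cast at h4 h6 ⊢
  linarith

lemma Grd.rem_le (hd : 0 < d) (G : Grd k Nc T R0 r g m h) {Φ : Zd d → ℝ} (hΦ : ∀ x, 0 ≤ Φ x) :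
    ∑ z ∈ bx d k \ (bx d Nc).biUnion (fun x => cell m (ctr r g x)), Φ (idx r Nc z) ≤
      4 * d * 2 ^ d / T * ∑ x ∈ bx d Nc, (r:ℝ) ^ d * Φ x := by
  rw [← Finset.sum_fiberwise_of_maps_to (t := bx d Nc) (g := idx r Nc)
    (fun z hz => G.idx_mem (Finset.mem_sdiff.1 hz).1), Finset.mul_sum]
  refine Finset.sum_le_sum fun x hx => ?_
  have h1 : ∑ z ∈ bx d k \ (bx d Nc).biUnion (fun x => cell m (ctr r g x)) with idx r Nc z = x,
      Φ (idx r Nc z) = ({z ∈ bx d k \ (bx d Nc).biUnion (fun x => cell m (ctr r g x)) |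
        idx r Nc z = x}.card : ℝ) * Φ x := by
    rw [← nsmul_eq_mul, ← Finset.sum_const]
    refine Finset.sum_congr rfl fun z hz => ?_
    rw [(Finset.mem_filter.1 hz).2]
  rw [h1, ← mul_assoc]
  refine mul_le_mul_of_nonneg_right (le_trans ?_ (G.fibre_card hd x)) (hΦ x)
  refine Nat.cast_le.2 (Finset.card_le_card ?_)
  intro z hz
  obtain ⟨hz1, hz2⟩ := Finset.mem_filter.1 hz
  obtain ⟨hz3, hz4⟩ := Finset.mem_sdiff.1 hz1
  refine Finset.mem_sdiff.2 ⟨?_, fun hc => hz4 (Finset.mem_biUnion.2 ⟨x, hx, hc⟩)⟩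
  have := G.idx_cell hz3
  rwa [hz2] at this

lemma toRd_sum_stdb (v : Rd d) : v = ∑ j, v j • toRd (stdb j : Zd d) := by
  ext i
  simp [toRd_apply, stdb, Finset.sum_apply, Pi.single_apply]

lemma opNorm_le_sum (A : Rd d →L[ℝ] Rn n) : ‖A‖ ≤ ∑ j, ‖A (toRd (stdb j : Zd d))‖ := by
  refine A.opNorm_le_bound (Finset.sum_nonneg fun _ _ => norm_nonneg _) fun v => ?_
  conv_lhs => rw [toRd_sum_stdb v, map_sum]
  refine (norm_sum_le _ _).trans ?_
  rw [Finset.sum_mul]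
  refine Finset.sum_le_sum fun j _ => ?_
  rw [map_smul, norm_smul, mul_comm]
  exact mul_le_mul_of_nonneg_left (PiLp.norm_apply_le v j) (norm_nonneg _)

/-- constant in the moment bound of the slopes -/
def CM (d : ℕ) (p : ℝ) : ℝ := (2 * (1 + d)) ^ p

lemma CM_nonneg (d : ℕ) (p : ℝ) : 0 ≤ CM d p := Real.rpow_nonneg (by positivity) _

lemma slope_pow {p : ℝ} (hp : 1 ≤ p) {A : Rd d →L[ℝ] Rn n} {a : Fin d → ℝ} (ha : ∀ j, 0 ≤ a j)
    (hA : ∀ j, ‖A (toRd (stdb j : Zd d))‖ ≤ a j + 1) :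
    (1 + ‖A‖) ^ p ≤ CM d p * (1 + ∑ j, a j ^ p) := by
  have h0 : 0 ≤ ∑ j, a j := Finset.sum_nonneg fun j _ => ha j
  have hp0 : 0 ≤ p := by linarith
  have h1 : 1 + ‖A‖ ≤ (1 + d) + ∑ j, a j := by
    have := (opNorm_le_sum A).trans (Finset.sum_le_sum fun j _ => hA j)
    rw [Finset.sum_add_distrib] at this
    simp only [Finset.sum_const, Finset.card_univ, Fintype.card_fin, nsmul_eq_mul, mul_one] at this
    linarith
  have h2 : (∑ j, a j) ^ p ≤ (d:ℝ) ^ (p - 1) * ∑ j, a j ^ p := by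
    have := Real.rpow_sum_le_const_mul_sum_rpow Finset.univ a hp
    simp only [abs_of_nonneg (ha _), Finset.card_univ, Fintype.card_fin] at this
    exact this
  have hS : 0 ≤ ∑ j, a j ^ p := Finset.sum_nonneg fun j _ => Real.rpow_nonneg (ha j) _
  have h3 : (d:ℝ) ^ (p - 1) ≤ (1 + d) ^ p := by
    calc (d:ℝ) ^ (p - 1) ≤ (1 + d:ℝ) ^ (p - 1) := by
          apply Real.rpow_le_rpow (by positivity) (by linarith) (by linarith)
      _ ≤ (1 + d:ℝ) ^ p := Real.rpow_le_rpow_of_exponent_le (by linarith [Nat.cast_nonneg (α := ℝ) d])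
          (by linarith)
  calc (1 + ‖A‖) ^ p ≤ ((1 + d) + ∑ j, a j) ^ p := Real.rpow_le_rpow (by positivity) h1 hp0
    _ ≤ 2 ^ p * ((1 + d) ^ p + (∑ j, a j) ^ p) := add_rpow_le hp0 (by positivity) h0
    _ ≤ 2 ^ p * ((1 + d) ^ p + (1 + d) ^ p * ∑ j, a j ^ p) := by
        have := mul_le_mul_of_nonneg_right h3 hS
        have h5 : (0:ℝ) < 2 ^ p := Real.rpow_pos_of_pos (by norm_num) _
        refine mul_le_mul_of_nonneg_left ?_ h5.le
        linarith
    _ = CM d p * (1 + ∑ j, a j ^ p) := by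
        unfold CM; rw [Real.mul_rpow (by norm_num) (by positivity)]; ring

lemma Grd.slope_sum (G : Grd k Nc T R0 r g m h) {p : ℝ} (hp : 1 ≤ p) {σ : ℝ} (hσ1 : σ ≤ 1)
    {ψ : Zd d → Rn n} (A : Zd d → Rd d →L[ℝ] Rn n)
    (hA : ∀ x ∈ bx d Nc, ∀ z j, dist z (ctr r g x) ≤ ((2 * r + R0 : ℕ):ℝ) →
      ‖ψ (z + stdb j) - ψ z - A x (toRd (stdb j))‖ ≤ σ) :
    ∑ x ∈ bx d Nc, (r:ℝ) ^ d * (1 + ‖A x‖) ^ p ≤ CM d p * ((k:ℝ) ^ d + gp k p ψ) := by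
  have h1 : ∀ x ∈ bx d Nc, (r:ℝ) ^ d * (1 + ‖A x‖) ^ p ≤
      ∑ z ∈ cell r (r • x), CM d p * (1 + ∑ j, ‖ψ (z + stdb j) - ψ z‖ ^ p) := by
    intro x hx
    have : (r:ℝ) ^ d * (1 + ‖A x‖) ^ p = ∑ z ∈ cell r (r • x), (1 + ‖A x‖) ^ p := by
      rw [Finset.sum_const, card_cell, nsmul_eq_mul]; push_cast; rfl
    rw [this]
    refine Finset.sum_le_sum fun z hz => slope_pow hp (fun j => norm_nonneg _) fun j => ?_
    have h2 := G.dist_ctr (cell_mono (Nat.le_add_right r Nc) _ hz)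
    have h3 := hA x hx z j (h2.trans (by exact_mod_cast Nat.le_add_right _ _))
    have h4 := norm_sub_norm_le (A x (toRd (stdb j))) (ψ (z + stdb j) - ψ z)
    rw [norm_sub_rev (A x (toRd (stdb j)))] at h4
    linarith
  refine (Finset.sum_le_sum h1).trans ((G.sum_cells_le fun z => mul_nonneg (CM_nonneg d p)
    (add_nonneg zero_le_one (Finset.sum_nonneg fun j _ => Real.rpow_nonneg (norm_nonneg _) _))).trans ?_)
  rw [← Finset.mul_sum, Finset.sum_add_distrib, Finset.sum_const, card_bx, nsmul_eq_mul]
  unfold gp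
  push_cast
  rw [mul_one]

lemma young_t {p t a b : ℝ} (hp : 1 < p) (ht : 0 < t) (ha : 0 ≤ a) (hb : 0 ≤ b) :
    a ^ (p - 1) * b ≤ t * a ^ p + t ^ (1 - p) * b ^ p := by
  have hp0 : 0 < p := by linarith
  rcases le_total b (t * a) with hle | hle
  · have h1 : a ^ (p - 1) * b ≤ a ^ (p - 1) * (t * a) :=
      mul_le_mul_of_nonneg_left hle (Real.rpow_nonneg ha _)
    have h2 : a ^ (p - 1) * a = a ^ p := by
      rcases ha.eq_or_lt with rfl | ha'
      · rw [mul_zero, Real.zero_rpow hp0.ne']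
      · rw [← Real.rpow_add_one ha'.ne']; congr 1; ring
    have h3 : 0 ≤ t ^ (1 - p) * b ^ p := by positivity
    calc a ^ (p - 1) * b ≤ a ^ (p - 1) * (t * a) := h1
      _ = t * (a ^ (p - 1) * a) := by ring
      _ ≤ _ := by rw [h2]; linarith
  · have h1 : a ≤ b / t := by rw [le_div_iff₀ ht]; linarith
    have h2 : a ^ (p - 1) ≤ (b / t) ^ (p - 1) := Real.rpow_le_rpow ha h1 (by linarith)
    have h3 : (b / t) ^ (p - 1) * b = t ^ (1 - p) * b ^ p := by
      rcases hb.eq_or_lt with rfl | hb'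
      · rw [mul_zero, Real.zero_rpow hp0.ne', mul_zero]
      · rw [Real.div_rpow hb ht.le, show (1:ℝ) - p = -(p - 1) by ring, Real.rpow_neg ht.le,
          div_mul_eq_mul_div, ← Real.rpow_add_one hb'.ne', show p - 1 + 1 = p by ring]
        field_simp
    have h4 : 0 ≤ t * a ^ p := by positivity
    calc a ^ (p - 1) * b ≤ (b / t) ^ (p - 1) * b := mul_le_mul_of_nonneg_right h2 hb
      _ ≤ _ := by rw [h3]; linarith

/-- best constants on all cells -/
lemma Grd.poinc (G : Grd k Nc T R0 r g m h) {p : ℝ} (hp : 1 ≤ p) {κ : Zd d → Rn n} (hκ : Per k κ) :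
    ∃ y : Zd d → Zd d, ∑ x ∈ bx d Nc, ∑ w ∈ cell m (ctr r g x), ‖κ w - κ (y x)‖ ^ p ≤
      2 ^ d * ((d * m) ^ p * gp k p κ) := by
  have hch : ∀ x : Zd d, ∃ y ∈ cell m (ctr r g x), ∑ w ∈ cell m (ctr r g x), ‖κ w - κ y‖ ^ p ≤
      ((m:ℝ) ^ d)⁻¹ * ∑ y ∈ cell m (ctr r g x), ∑ w ∈ cell m (ctr r g x), ‖κ w - κ y‖ ^ p := by
    intro x
    have hne : (cell m (ctr r g x)).Nonempty := by exact_mod_cast G.cell_ne x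
    refine Finset.exists_le_of_sum_le hne ?_
    rw [Finset.sum_const, card_cell, nsmul_eq_mul]
    push_cast
    have : (0:ℝ) < m := by exact_mod_cast G.mpos
    rw [mul_inv_cancel_left₀ (by positivity)]
  choose y hy hy2 using hch
  refine ⟨y, (Finset.sum_le_sum fun x _ => hy2 x).trans ?_⟩
  rw [← Finset.mul_sum]
  have hm0 : (0:ℝ) < m := by exact_mod_cast G.mpos
  rw [inv_mul_le_iff₀ (by positivity)]
  set c0 : Zd d := fun _ => -(m:ℤ) with hc0
  have h1 : ∀ x, ∑ y ∈ cell m (ctr r g x), ∑ w ∈ cell m (ctr r g x), ‖κ w - κ y‖ ^ p ≤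
      ∑ y ∈ cell m (ctr r g x), ∑ v ∈ cell (2 * m) c0, ‖κ (y + v) - κ y‖ ^ p := by
    intro x
    refine Finset.sum_le_sum fun y hy => ?_
    have e : ∑ w ∈ cell m (ctr r g x), ‖κ w - κ y‖ ^ p =
        ∑ v ∈ (cell m (ctr r g x)).image (fun w => w - y), ‖κ (y + v) - κ y‖ ^ p := by
      rw [Finset.sum_image (by intro a _ b _ hab; exact sub_left_injective hab)]
      refine Finset.sum_congr rfl fun w _ => ?_
      rw [add_sub_cancel]
    rw [e]
    refine Finset.sum_le_sum_of_subset_of_nonneg ?_ fun v _ _ => Real.rpow_nonneg (norm_nonneg _) _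
    intro v hv
    obtain ⟨w, hw, rfl⟩ := Finset.mem_image.1 hv
    rw [mem_cell, mem_bx] at *
    intro j
    have a1 := hw j
    have a2 := hy j
    simp only [Pi.sub_apply, hc0] at *
    push_cast
    omega
  refine (Finset.sum_le_sum fun x _ => h1 x).trans ((G.sum_small_le fun z =>
    Finset.sum_nonneg fun v _ => Real.rpow_nonneg (norm_nonneg _) _).trans ?_)
  rw [Finset.sum_comm]
  have h2 : ∀ v ∈ cell (2 * m) c0, ∑ z ∈ bx d k, ‖κ (z + v) - κ z‖ ^ p ≤ (d * m) ^ p * gp k p κ := by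
    intro v hv
    refine trans_le G.kpos hp hκ v fun j => ?_
    rw [mem_cell, mem_bx] at hv
    have := hv j
    simp only [Pi.sub_apply, hc0] at this
    push_cast at this
    rw [abs_le]
    omega
  refine (Finset.sum_le_sum h2).trans ?_
  rw [Finset.sum_const, card_cell, nsmul_eq_mul]
  push_cast
  rw [mul_pow]
  linarith
end


section
variable {k Nc T R0 r g m h : ℕ}
variable {P : Measure Ω} {τ : Zd d → Ω → Ω} {E0 : Finset (Zd d)} {p c₁ : ℝ}
    {V : Zd d → Ω → Rn n → ℝ} {lam : Zd d → Ω → ℝ}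

lemma Hyp.cell_low (H : Hyp P τ E0 p c₁ V lam) (F : Rd d →L[ℝ] Rn n) (G : Grd k Nc T R0 r g m h)
    (hR0 : irange d E0 ≤ R0) (ω : Ω) (A : Rd d →L[ℝ] Rn n) (a : Rn n) (φ : Zd d → Rn n) {N : ℕ}
    (hN : 0 < N) {K L ε' : ℝ} (hK : 0 ≤ K)
    (h2 : ∀ b ∈ E0, ∑ z ∈ bx d m, lam b (τ z ω) ≤ L * (m:ℝ) ^ d)
    (h3 : ∀ b ∈ E0, ∑ z ∈ bx d m, (if K < lam b (τ z ω) then lam b (τ z ω) else 0) ≤ ε' * (m:ℝ) ^ d) :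
    mF τ E0 V ω (F + A) (cube d m) ≤ (1 + Kc2 E0 F p c₁ / N) * en τ E0 V ω F φ m
      + ((m:ℝ) ^ d * (1 + ‖A‖) ^ p) * (E0.card * (Kc2 E0 F p c₁ / N * L +
          Kc1 E0 F p c₁ * ((1 + K) * (4 * d / T) + ε')))
      + Kc1 E0 F p c₁ * E0.card * (1 + K) * 8 * 2 ^ N * T *
        ((1 + ‖A‖) ^ (p - 1) * ((r:ℝ)⁻¹ * ∑ z ∈ bx d m, ‖φ z - A (toRd z) - a‖)) := by
  set M : ℝ := 1 + ‖A‖ with hM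
  have hM1 : 1 ≤ M := by rw [hM]; linarith [norm_nonneg A]
  have hM0 : 0 < M := by linarith
  set Y : ℝ := ∑ z ∈ bx d m, ‖φ z - A (toRd z) - a‖ with hY
  have hY0 : 0 ≤ Y := Finset.sum_nonneg fun _ _ => norm_nonneg _
  have hT : (0:ℝ) < T := by have := G.T4; exact_mod_cast (by omega : 0 < T)
  have hr : (0:ℝ) < r := by exact_mod_cast G.rpos
  have hm0 : (0:ℝ) < m := by exact_mod_cast G.mpos
  set δ : ℝ := h - irange d E0 with hδ
  have hδr : (r:ℝ) / (4 * T) ≤ δ := by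
    have h4 : (r:ℝ) + 4 * T * R0 ≤ 4 * T * h := by exact_mod_cast G.rh
    rw [div_le_iff₀ (by positivity), hδ]
    have := mul_le_mul_of_nonneg_left hR0 (by positivity : (0:ℝ) ≤ 4 * T)
    linarith
  have hδ0 : 0 < δ := lt_of_lt_of_le (by positivity) hδr
  set s0 : ℝ := M * δ / 2 ^ N with hs0
  have hs00 : 0 < s0 := by positivity
  have hmain := H.cell_ineq F ω A a φ hN hs00 G.hm2 (by
    rw [hs0, div_mul_cancel₀ _ (by positivity)])
  have hK1 := H.Kc1_nonneg F
  have hK2 := H.Kc2_nonneg F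
  have hNR : (0:ℝ) < N := by exact_mod_cast hN
  have hMp : 0 < M ^ p := Real.rpow_pos_of_pos hM0 _
  -- the sum of the weights
  have e1 : ∑ z ∈ bx d m, ∑ b ∈ E0, lam b (τ z ω) ≤ E0.card * (L * (m:ℝ) ^ d) := by
    rw [Finset.sum_comm, ← nsmul_eq_mul]
    exact Finset.sum_le_card_nsmul _ _ _ h2
  -- the layer
  have e2 : ((bx d m \ inn d m (h + R0)).card : ℝ) ≤ 4 * d / T * (m:ℝ) ^ d := by
    rw [card_layer]
    refine (layer_le d m (h + R0)).trans ?_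
    have hRh : R0 ≤ h := by
      have := G.rh; have := G.T4; have := G.rpos; nlinarith
    have hh : (h:ℝ) ≤ m / T := by rw [le_div_iff₀ hT]; exact_mod_cast G.hm
    have h5 : ((h + R0 : ℕ):ℝ) ≤ 2 * (m / T) := by
      have : ((h + R0 : ℕ):ℝ) ≤ 2 * h := by exact_mod_cast (by omega : h + R0 ≤ 2 * h)
      linarith
    have h6 : (m:ℝ) * (m:ℝ) ^ (d - 1) = (m:ℝ) ^ d := by
      rw [← pow_succ', Nat.sub_add_cancel H.hd]
    calc (d:ℝ) * (2 * ((h + R0 : ℕ):ℝ)) * (m:ℝ) ^ (d - 1)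
        ≤ d * (2 * (2 * (m / T))) * (m:ℝ) ^ (d - 1) := by gcongr
      _ = 4 * d / T * ((m:ℝ) * (m:ℝ) ^ (d - 1)) := by ring
      _ = _ := by rw [h6]
  have e3 : ∑ z ∈ bx d m, ∑ b ∈ E0,
      (if touched φ A a m h s0 z b then 1 + lam b (τ z ω) else 0) ≤
      E0.card * ((1 + K) * (4 * d / T * (m:ℝ) ^ d + 2 * s0⁻¹ * Y) + ε' * (m:ℝ) ^ d) := by
    rw [Finset.sum_comm, ← nsmul_eq_mul]
    refine Finset.sum_le_card_nsmul _ _ _ fun b hb => ?_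
    have h5 := touched_sum (φ := φ) (A := A) (a := a) (m := m) (h := h) hR0 hs00 hb hK
      (fun z => lam b (τ z ω)) (fun z => H.lamnn b hb _)
    have h6 := mul_le_mul_of_nonneg_left e2 (by linarith : (0:ℝ) ≤ 1 + K)
    have h7 := h3 b hb
    rw [← hY] at h5
    linarith
  have e4 : M ^ p * (2 * s0⁻¹ * Y) ≤ 8 * 2 ^ N * T * (M ^ (p - 1) * ((r:ℝ)⁻¹ * Y)) := by
    have h5 : M ^ p = M ^ (p - 1) * M := by
      rw [← Real.rpow_add_one hM0.ne']; congr 1; ring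
    have h6 : δ⁻¹ ≤ 4 * T * (r:ℝ)⁻¹ := by
      have := inv_anti₀ (by positivity) hδr
      rw [inv_div] at this
      exact this.trans (le_of_eq (by ring))
    have h7 : M ^ p * (2 * s0⁻¹ * Y) = (2 * 2 ^ N * M ^ (p - 1) * Y) * δ⁻¹ := by
      rw [h5, hs0, inv_div]
      field_simp
    rw [h7]
    have h8 : 0 ≤ 2 * 2 ^ N * M ^ (p - 1) * Y := by positivity
    refine (mul_le_mul_of_nonneg_left h6 h8).trans (le_of_eq (by ring))
  have f1 := mul_le_mul_of_nonneg_left (mul_le_mul_of_nonneg_left e1 hMp.le)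
    (by positivity : 0 ≤ Kc2 E0 F p c₁ / N)
  have f2 := mul_le_mul_of_nonneg_left (mul_le_mul_of_nonneg_left e3 hMp.le) hK1
  have f3 := mul_le_mul_of_nonneg_left e4 (by positivity : 0 ≤ Kc1 E0 F p c₁ * E0.card * (1 + K))
  calc _ ≤ _ := hmain
    _ ≤ (1 + Kc2 E0 F p c₁ / N) * en τ E0 V ω F φ m +
        Kc2 E0 F p c₁ / N * (M ^ p * (E0.card * (L * (m:ℝ) ^ d))) +
        Kc1 E0 F p c₁ * (M ^ p * (E0.card * ((1 + K) * (4 * d / T * (m:ℝ) ^ d + 2 * s0⁻¹ * Y)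
          + ε' * (m:ℝ) ^ d))) := by linarith
    _ ≤ _ := by linarith

lemma Grd.cell_dev (G : Grd k Nc T R0 r g m h) (hp : 1 < p) {σ t Mx : ℝ} (hσ : 0 ≤ σ) (ht : 0 < t)
    {ψ φ f : Zd d → Rn n} {A : Rd d →L[ℝ] Rn n} {x : Zd d} (y : Zd d)
    (hA : ∀ z j, dist z (ctr r g x) ≤ ((2 * r + R0 : ℕ):ℝ) →
      ‖ψ (z + stdb j) - ψ z - A (toRd (stdb j))‖ ≤ σ) (hMx : 1 + ‖A‖ ≤ Mx) :
    (1 + ‖A‖) ^ (p - 1) * ((r:ℝ)⁻¹ * ∑ z ∈ bx d m, ‖φ (ctr r g x + z) - A (toRd z) -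
        (ψ (ctr r g x) + (f y - ψ y))‖) ≤
      Mx ^ (p - 1) * ((r:ℝ)⁻¹ * ∑ w ∈ cell m (ctr r g x), ‖φ w - f w‖) +
      (t + 2 * d * σ) * ((r:ℝ) ^ d * (1 + ‖A‖) ^ p) +
      t ^ (1 - p) * (((r:ℝ)⁻¹) ^ p * ∑ w ∈ cell m (ctr r g x), ‖(f w - ψ w) - (f y - ψ y)‖ ^ p) := by
  set M : ℝ := 1 + ‖A‖ with hM
  have hM1 : 1 ≤ M := by rw [hM]; linarith [norm_nonneg A]
  have hM0 : 0 < M := by linarith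
  have hr : (0:ℝ) < r := by exact_mod_cast G.rpos
  have hri : (0:ℝ) < (r:ℝ)⁻¹ := inv_pos.2 hr
  set c := ctr r g x with hc
  have e : ∑ z ∈ bx d m, ‖φ (c + z) - A (toRd z) - (ψ c + (f y - ψ y))‖ =
      ∑ w ∈ cell m c, ‖φ w - A (toRd (w - c)) - (ψ c + (f y - ψ y))‖ := by
    rw [sum_cell]
    refine Finset.sum_congr rfl fun z _ => ?_
    rw [add_sub_cancel_left]
  rw [e]
  have hpt : ∀ w ∈ cell m c, M ^ (p - 1) * ((r:ℝ)⁻¹ * ‖φ w - A (toRd (w - c)) - (ψ c + (f y - ψ y))‖) ≤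
      Mx ^ (p - 1) * ((r:ℝ)⁻¹ * ‖φ w - f w‖) + (t + 2 * d * σ) * M ^ p +
      t ^ (1 - p) * (((r:ℝ)⁻¹) ^ p * ‖(f w - ψ w) - (f y - ψ y)‖ ^ p) := by
    intro w hw
    set κ := ‖(f w - ψ w) - (f y - ψ y)‖ with hκ
    have h1 := G.dist_ctr (cell_mono (Nat.le_add_right r Nc) _ (G.cell_sub x hw))
    have h2 := (ell_err hσ hA).1 w (2 * r) (h1.trans (by exact_mod_cast Nat.le_add_right _ _)) h1
    have h3 : φ w - A (toRd (w - c)) - (ψ c + (f y - ψ y)) =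
        (φ w - f w) + ((f w - ψ w) - (f y - ψ y)) - (ell ψ c A w - ψ w) := by
      simp only [ell]; abel
    have h4 : ‖φ w - A (toRd (w - c)) - (ψ c + (f y - ψ y))‖ ≤ ‖φ w - f w‖ + κ + d * (2 * r) * σ := by
      rw [h3]
      have a1 := norm_sub_le ((φ w - f w) + ((f w - ψ w) - (f y - ψ y))) (ell ψ c A w - ψ w)
      have a2 := norm_add_le (φ w - f w) ((f w - ψ w) - (f y - ψ y))
      push_cast at h2
      linarith
    have hMq : 0 < M ^ (p - 1) := Real.rpow_pos_of_pos hM0 _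
    have h5 : M ^ (p - 1) ≤ Mx ^ (p - 1) := Real.rpow_le_rpow hM0.le hMx (by linarith)
    have h6 : M ^ (p - 1) ≤ M ^ p := Real.rpow_le_rpow_of_exponent_le hM1 (by linarith)
    have h7 := young_t hp ht hM0.le (by positivity : 0 ≤ (r:ℝ)⁻¹ * κ)
    rw [Real.mul_rpow hri.le (norm_nonneg _)] at h7
    have h8 := mul_le_mul_of_nonneg_left (mul_le_mul_of_nonneg_left h4 hri.le) hMq.le
    have h9 := mul_le_mul_of_nonneg_right h5 (by positivity : 0 ≤ (r:ℝ)⁻¹ * ‖φ w - f w‖)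
    have h10 := mul_le_mul_of_nonneg_right h6 (by positivity : 0 ≤ 2 * d * σ)
    have h11 : M ^ (p - 1) * ((r:ℝ)⁻¹ * (‖φ w - f w‖ + κ + d * (2 * r) * σ)) =
        M ^ (p - 1) * ((r:ℝ)⁻¹ * ‖φ w - f w‖) + M ^ (p - 1) * ((r:ℝ)⁻¹ * κ) + M ^ (p - 1) * (2 * d * σ) := by
      field_simp
    linarith
  have hs := Finset.sum_le_sum hpt
  rw [Finset.sum_add_distrib, Finset.sum_add_distrib, Finset.sum_const, card_cell, nsmul_eq_mul] at hs
  simp only [← Finset.mul_sum] at hs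
  have hmr : (m:ℝ) ^ d ≤ (r:ℝ) ^ d := pow_le_pow_left₀ (Nat.cast_nonneg _) (by
    have := G.mg; exact_mod_cast (by omega : m ≤ r)) _
  have h12 := mul_le_mul_of_nonneg_right hmr (by positivity : 0 ≤ (t + 2 * d * σ) * M ^ p)
  push_cast at hs
  linarith

/-- the constant in the remainder -/
def CU (P : Measure Ω) (E0 : Finset (Zd d)) (lam : Zd d → Ω → ℝ) (p c₁ : ℝ) (F : Rd d →L[ℝ] Rn n)
    (R0 : ℕ) : ℝ := c₁ * (1 + 2 * Lbd P E0 lam) * (R0 * (‖F‖ + 4 * d + 4)) ^ p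

lemma Hyp.CU_nonneg (H : Hyp P τ E0 p c₁ V lam) (F : Rd d →L[ℝ] Rn n) (R0 : ℕ) :
    0 ≤ CU P E0 lam p c₁ F R0 := by
  have := H.hc₁
  have := H.one_le_Lbd
  unfold CU
  positivity

lemma Hyp.Cv_le (H : Hyp P τ E0 p c₁ V lam) (F : Rd d →L[ℝ] Rn n) (hR : 0 < R0) {M : ℝ} (hM : 1 ≤ M) :
    Cv P E0 lam p c₁ (R0 * (‖F‖ + 4 * d + 4) * M) ≤ CU P E0 lam p c₁ F R0 * M ^ p := by
  have hc := H.hc₁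
  have hL := H.one_le_Lbd
  have hR1 : (1:ℝ) ≤ R0 := by exact_mod_cast hR
  have hx : 1 ≤ R0 * (‖F‖ + 4 * d + 4) := by
    have h1 : (1:ℝ) ≤ ‖F‖ + 4 * d + 4 := by
      have := norm_nonneg F
      have : (0:ℝ) ≤ d := Nat.cast_nonneg _
      linarith
    nlinarith
  set X := R0 * (‖F‖ + 4 * d + 4) with hX
  have h1 : 1 ≤ (X * M) ^ p := Real.one_le_rpow (by nlinarith) (by linarith [H.hp])
  have h2 : CU P E0 lam p c₁ F R0 * M ^ p = c₁ * (1 + 2 * Lbd P E0 lam) * (X * M) ^ p := by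
    unfold CU
    rw [← hX, Real.mul_rpow (x := X) (y := M) (by linarith) (by linarith)]
    ring
  rw [h2]
  unfold Cv
  rw [mul_assoc c₁]
  refine mul_le_mul_of_nonneg_left ?_ hc.le
  nlinarith
end


section
variable {k Nc T R0 r g m h : ℕ}
variable {P : Measure Ω} {τ : Zd d → Ω → Ω} {E0 : Finset (Zd d)} {p c₁ : ℝ}
    {V : Zd d → Ω → Rn n → ℝ} {lam : Zd d → Ω → ℝ}

lemma Hyp.en_cell (H : Hyp P τ E0 p c₁ V lam) (F : Rd d →L[ℝ] Rn n) (ω : Ω) (φ : Zd d → Rn n)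
    (m : ℕ) (c : Zd d) : en τ E0 V (τ c ω) F (fun z => φ (c + z)) m = ∑ w ∈ cell m c,
      ∑ b ∈ E0, V b (τ w ω) ((‖toRd b‖)⁻¹ • (F (toRd b) + (φ (w + b) - φ w))) := by
  unfold en
  rw [sum_cell]
  refine Finset.sum_congr rfl fun z _ => Finset.sum_congr rfl fun b _ => ?_
  rw [← H.τadd', add_comm z c, add_assoc]

set_option maxHeartbeats 1000000 in
lemma Hyp.det (H : Hyp P τ E0 p c₁ V lam) (F : Rd d →L[ℝ] Rn n) (G : Grd k Nc T R0 r g m h)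
    (hR0 : irange d E0 ≤ R0) {σ : ℝ} (hσ : 0 ≤ σ) (hσ1 : σ ≤ 1) (hσT : 24 * d * T * σ ≤ 1)
    {φ f ψ : Zd d → Rn n} (hf : Per k f) (hψ : Per k ψ) (A : Zd d → Rd d →L[ℝ] Rn n)
    (hA : ∀ x ∈ bx d Nc, ∀ z j, dist z (ctr r g x) ≤ ((2 * r + R0 : ℕ):ℝ) →
      ‖ψ (z + stdb j) - ψ z - A x (toRd (stdb j))‖ ≤ σ)
    {N : ℕ} (hN : 0 < N) {K L ε' ε1 t Mx B ρ η : ℝ} (hK : 0 ≤ K) (hL : 0 ≤ L) (hε' : 0 ≤ ε')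
    (hε1 : 0 ≤ ε1)
    (ht : 0 < t) (hMx0 : 0 ≤ Mx) (hMx : ∀ x ∈ bx d Nc, 1 + ‖A x‖ ≤ Mx)
    (hB : CM d p * ((k:ℝ) ^ d + gp k p ψ) ≤ B * (k:ℝ) ^ d) (ω : Ω)
    (hen : en τ E0 V ω F φ k ≤ (k:ℝ) ^ d * W0 P τ E0 V F)
    (hρ : ∑ z ∈ bx d k, ‖φ z - f z‖ ≤ ρ * k * (k:ℝ) ^ d)
    (hη : gp k p (fun z => f z - ψ z) ≤ η * (k:ℝ) ^ d)
    (h1 : ∀ x ∈ bx d Nc, ∫ ω, Xr τ E0 V (F + A x) m ω ∂P - ε1 < Xr τ E0 V (F + A x) m (τ (ctr r g x) ω))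
    (h2 : ∀ x ∈ bx d Nc, ∀ b ∈ E0, ∑ z ∈ bx d m, lam b (τ z (τ (ctr r g x) ω)) ≤ L * (m:ℝ) ^ d)
    (h3 : ∀ x ∈ bx d Nc, ∀ b ∈ E0, ∑ z ∈ bx d m, (if K < lam b (τ z (τ (ctr r g x) ω)) then
      lam b (τ z (τ (ctr r g x) ω)) else 0) ≤ ε' * (m:ℝ) ^ d) :
    (k:ℝ) ^ d * W0 P τ E0 V F ≤ en τ E0 V ω F φ k + (k:ℝ) ^ d * (Kc2 E0 F p c₁ / N * W0 P τ E0 V F + ε1 +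
      B * (E0.card * (Kc2 E0 F p c₁ / N * L + Kc1 E0 F p c₁ * ((1 + K) * (4 * d / T) + ε'))) +
      Kc1 E0 F p c₁ * E0.card * (1 + K) * 8 * 2 ^ N * T * (Mx ^ (p - 1) * (2 * Nc * ρ) +
        (t + 2 * d * σ) * B + t ^ (1 - p) * (2 ^ d * d ^ p * η)) +
      E0.card * CU P E0 lam p c₁ F R0 * (4 * d * 2 ^ d / T) * B) := by
  have hp := H.hp
  have hK1 := H.Kc1_nonneg F
  have hK2 := H.Kc2_nonneg F
  have hNR : (0:ℝ) < N := by exact_mod_cast hN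
  have hT : (0:ℝ) < T := by have := G.T4; exact_mod_cast (by omega : 0 < T)
  have hr : (0:ℝ) < r := by exact_mod_cast G.rpos
  have hri : (0:ℝ) < (r:ℝ)⁻¹ := inv_pos.2 hr
  have hm0 : (0:ℝ) < m := by exact_mod_cast G.mpos
  have hk0 : (0:ℝ) < k := by exact_mod_cast G.kpos
  have hmr' : (m:ℝ) ≤ r := by have := G.mg; exact_mod_cast (by omega : m ≤ r)
  have hmr : (m:ℝ) ^ d ≤ (r:ℝ) ^ d := pow_le_pow_left₀ (Nat.cast_nonneg _) hmr' _
  have hslope := (G.slope_sum hp.le hσ1 A hA).trans hB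
  have hM1 : ∀ x, 1 ≤ 1 + ‖A x‖ := fun x => by linarith [norm_nonneg (A x)]
  have hMp : ∀ x, 0 ≤ (1 + ‖A x‖) ^ p := fun x => Real.rpow_nonneg (by linarith [hM1 x]) _
  -- upper bound
  have hup := H.upper F G hR0 hσ hσ1 hσT hψ A hA
  set e : ℝ := (E0.card:ℝ) with he
  have he0 : 0 ≤ e := Nat.cast_nonneg _
  have hCU := H.CU_nonneg F R0
  have hrem : ∑ z ∈ bx d k \ (bx d Nc).biUnion (fun x => cell m (ctr r g x)),
      e * Cv P E0 lam p c₁ (R0 * (‖F‖ + 4 * d + 4) * (1 + ‖A (idx r Nc z)‖)) ≤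
      e * CU P E0 lam p c₁ F R0 * (4 * d * 2 ^ d / T) * B * (k:ℝ) ^ d := by
    have a1 : ∑ z ∈ bx d k \ (bx d Nc).biUnion (fun x => cell m (ctr r g x)),
      e * Cv P E0 lam p c₁ (R0 * (‖F‖ + 4 * d + 4) * (1 + ‖A (idx r Nc z)‖)) ≤
      ∑ z ∈ bx d k \ (bx d Nc).biUnion (fun x => cell m (ctr r g x)),
        (fun x => e * CU P E0 lam p c₁ F R0 * (1 + ‖A x‖) ^ p) (idx r Nc z) := by
      refine Finset.sum_le_sum fun z _ => ?_
      have := mul_le_mul_of_nonneg_left (H.Cv_le F G.R0p (hM1 (idx r Nc z))) he0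
      simp only
      linarith
    have a2 := G.rem_le H.hd (Φ := fun x => e * CU P E0 lam p c₁ F R0 * (1 + ‖A x‖) ^ p)
      (fun x => mul_nonneg (mul_nonneg he0 hCU) (hMp x))
    have a3 : ∑ x ∈ bx d Nc, (r:ℝ) ^ d * (e * CU P E0 lam p c₁ F R0 * (1 + ‖A x‖) ^ p) =
        e * CU P E0 lam p c₁ F R0 * ∑ x ∈ bx d Nc, (r:ℝ) ^ d * (1 + ‖A x‖) ^ p := by
      rw [Finset.mul_sum]
      refine Finset.sum_congr rfl fun x _ => by ring
    rw [a3] at a2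
    have a4 := mul_le_mul_of_nonneg_left hslope
      (by positivity : 0 ≤ 4 * d * 2 ^ d / T * (e * CU P E0 lam p c₁ F R0))
    linarith
  -- best constants
  have hκP : Per k (fun z => f z - ψ z) := hf.comp₂ hψ (fun a b => a - b)
  obtain ⟨y, hy⟩ := G.poinc hp.le hκP
  set Θ : ℝ := Kc1 E0 F p c₁ * e * (1 + K) * 8 * 2 ^ N * T with hΘ
  have hΘ0 : 0 ≤ Θ := by positivity
  set Ξ : ℝ := e * (Kc2 E0 F p c₁ / N * L + Kc1 E0 F p c₁ * ((1 + K) * (4 * d / T) + ε')) with hΞ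
  have hΞ0 : 0 ≤ Ξ := by positivity
  set EE : Zd d → ℝ := fun w => ∑ b ∈ E0, V b (τ w ω) ((‖toRd b‖)⁻¹ • (F (toRd b) + (φ (w + b) - φ w)))
    with hEE
  have hEE0 : ∀ w, 0 ≤ EE w := fun w => Finset.sum_nonneg fun b hb => H.Vnn b hb _ _
  have hcell : ∀ x ∈ bx d Nc, ∫ ω, mF τ E0 V ω (F + A x) (cube d m) ∂P ≤
      (1 + Kc2 E0 F p c₁ / N) * ∑ w ∈ cell m (ctr r g x), EE w + Ξ * ((r:ℝ) ^ d * (1 + ‖A x‖) ^ p) +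
      Θ * (Mx ^ (p - 1) * ((r:ℝ)⁻¹ * ∑ w ∈ cell m (ctr r g x), ‖φ w - f w‖) +
      (t + 2 * d * σ) * ((r:ℝ) ^ d * (1 + ‖A x‖) ^ p) +
      t ^ (1 - p) * (((r:ℝ)⁻¹) ^ p * ∑ w ∈ cell m (ctr r g x),
        ‖(f w - ψ w) - (f (y x) - ψ (y x))‖ ^ p)) + ε1 * ∑ _w ∈ cell m (ctr r g x), (1:ℝ) := by
    intro x hx
    have a1 := H.cell_low F G hR0 (τ (ctr r g x) ω) (A x)
      (ψ (ctr r g x) + (f (y x) - ψ (y x))) (fun z => φ (ctr r g x + z)) hN hK (h2 x hx) (h3 x hx)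
    rw [H.en_cell] at a1
    have a2 := mul_le_mul_of_nonneg_left (G.cell_dev (φ := φ) (f := f) hp hσ ht (y x) (hA x hx) (hMx x hx)) hΘ0
    have a3 := h1 x hx
    unfold Xr at a3
    rw [integral_const_mul] at a3
    have a4 : ∫ ω, mF τ E0 V ω (F + A x) (cube d m) ∂P ≤
        mF τ E0 V (τ (ctr r g x) ω) (F + A x) (cube d m) + ε1 * (m:ℝ) ^ d := by
      have hmd : 0 < (m:ℝ) ^ d := by positivity
      have a5 := mul_le_mul_of_nonneg_left a3.le hmd.le
      rw [mul_sub, mul_inv_cancel_left₀ hmd.ne', mul_inv_cancel_left₀ hmd.ne'] at a5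
      linarith
    have a6 : ∑ _w ∈ cell m (ctr r g x), (1:ℝ) = (m:ℝ) ^ d := by
      rw [Finset.sum_const, card_cell, nsmul_eq_mul, mul_one]; push_cast; rfl
    have a7 := mul_le_mul_of_nonneg_right (mul_le_mul_of_nonneg_right hmr (hMp x)) hΞ0
    rw [a6]
    linarith
  have hsum := Finset.sum_le_sum hcell
  simp only [Finset.sum_add_distrib, ← Finset.mul_sum] at hsum
  have b1 : ∑ x ∈ bx d Nc, ∑ w ∈ cell m (ctr r g x), EE w ≤ en τ E0 V ω F φ k := G.sum_small_le hEE0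
  have b2 : ∑ x ∈ bx d Nc, ∑ w ∈ cell m (ctr r g x), ‖φ w - f w‖ ≤ ρ * k * (k:ℝ) ^ d :=
    (G.sum_small_le fun w => norm_nonneg _).trans hρ
  have b3 : ∑ x ∈ bx d Nc, ∑ _w ∈ cell m (ctr r g x), (1:ℝ) ≤ (k:ℝ) ^ d := by
    refine (G.sum_small_le (f := fun _ => (1:ℝ)) fun w => zero_le_one).trans (le_of_eq ?_)
    rw [Finset.sum_const, card_bx, nsmul_eq_mul, mul_one]; push_cast; rfl
  have hkd : 0 < (k:ℝ) ^ d := by positivity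
  have hρ0 : 0 ≤ ρ := by
    have : 0 ≤ ρ * k * (k:ℝ) ^ d := (Finset.sum_nonneg fun _ _ => norm_nonneg _).trans hρ
    by_contra hc
    push Not at hc
    have : ρ * (k * (k:ℝ) ^ d) < 0 := mul_neg_of_neg_of_pos hc (by positivity)
    linarith
  have b4 : (r:ℝ)⁻¹ * ∑ x ∈ bx d Nc, ∑ w ∈ cell m (ctr r g x), ‖φ w - f w‖ ≤ 2 * Nc * ρ * (k:ℝ) ^ d := by
    have c1 : (k:ℝ) ≤ r * (2 * Nc) := by
      have : k ≤ r * (2 * Nc) := by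
        have e1 := G.rk
        have e2 := Nat.le_mul_of_pos_left Nc G.rpos
        calc k ≤ r * Nc + Nc := e1
          _ ≤ r * Nc + r * Nc := Nat.add_le_add_left e2 _
          _ = r * (2 * Nc) := by ring
      exact_mod_cast this
    rw [inv_mul_le_iff₀ hr]
    refine b2.trans ?_
    have := mul_le_mul_of_nonneg_left c1 (by positivity : 0 ≤ ρ * (k:ℝ) ^ d)
    linarith
  have b5 : ((r:ℝ)⁻¹) ^ p * ∑ x ∈ bx d Nc, ∑ w ∈ cell m (ctr r g x),
      ‖(f w - ψ w) - (f (y x) - ψ (y x))‖ ^ p ≤ 2 ^ d * d ^ p * η * (k:ℝ) ^ d := by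
    have hη0 : 0 ≤ gp k p (fun z => f z - ψ z) := gp_nonneg _ _ _
    have c1 : ((r:ℝ)⁻¹) ^ p * ((d:ℝ) * m) ^ p ≤ (d:ℝ) ^ p := by
      rw [← Real.mul_rpow hri.le (by positivity)]
      refine Real.rpow_le_rpow (by positivity) ?_ (by linarith)
      rw [inv_mul_le_iff₀ hr, mul_comm (r:ℝ)]
      exact mul_le_mul_of_nonneg_left hmr' (Nat.cast_nonneg _)
    have hrp : 0 ≤ ((r:ℝ)⁻¹) ^ p := Real.rpow_nonneg hri.le _
    have hdp : (0:ℝ) ≤ (d:ℝ) ^ p := Real.rpow_nonneg (Nat.cast_nonneg _) _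
    calc _ ≤ ((r:ℝ)⁻¹) ^ p * (2 ^ d * ((d * m) ^ p * gp k p (fun z => f z - ψ z))) :=
          mul_le_mul_of_nonneg_left hy hrp
      _ = 2 ^ d * ((((r:ℝ)⁻¹) ^ p * (d * m) ^ p) * gp k p (fun z => f z - ψ z)) := by ring
      _ ≤ 2 ^ d * ((d:ℝ) ^ p * (η * (k:ℝ) ^ d)) := by
          refine mul_le_mul_of_nonneg_left ?_ (by positivity)
          exact mul_le_mul c1 hη hη0 hdp
      _ = _ := by ring
  have d1 := mul_le_mul_of_nonneg_left b1 (by positivity : 0 ≤ 1 + Kc2 E0 F p c₁ / N)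
  have d1' := mul_le_mul_of_nonneg_left hen (by positivity : 0 ≤ Kc2 E0 F p c₁ / N)
  rw [← Finset.mul_sum] at hslope
  have d2 := mul_le_mul_of_nonneg_left hslope hΞ0
  have d3 := mul_le_mul_of_nonneg_left b4 (Real.rpow_nonneg hMx0 (p - 1))
  have d4 := mul_le_mul_of_nonneg_left hslope (by positivity : 0 ≤ t + 2 * d * σ)
  have d5 := mul_le_mul_of_nonneg_left b5 (Real.rpow_nonneg ht.le (1 - p))
  have d6 := mul_le_mul_of_nonneg_left (add_le_add (add_le_add d3 d4) d5) hΘ0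
  have d7 := mul_le_mul_of_nonneg_left b3 hε1
  linarith
end


lemma exists_small {C ε : ℝ} (hC : 0 ≤ C) (hε : 0 < ε) : ∃ x : ℝ, 0 < x ∧ x ≤ 1 ∧ C * x ≤ ε := by
  refine ⟨min 1 (ε / (C + 1)), by positivity, min_le_left _ _, ?_⟩
  have h1 : C * min 1 (ε / (C + 1)) ≤ C * (ε / (C + 1)) :=
    mul_le_mul_of_nonneg_left (min_le_right _ _) hC
  have h2 : C * (ε / (C + 1)) ≤ ε := by
    rw [← mul_div_assoc, div_le_iff₀ (by positivity)]
    nlinarith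
  linarith

lemma exists_large (C : ℝ) {ε : ℝ} (hε : 0 < ε) (N0 : ℕ) : ∃ N : ℕ, N0 ≤ N ∧ C / N ≤ ε := by
  have h1 : Tendsto (fun N : ℕ => C / (N:ℝ)) atTop (𝓝 0) := tendsto_const_div_atTop_nhds_zero_nat C
  obtain ⟨N, h2, h3⟩ := ((h1.eventually (ge_mem_nhds hε)).and (eventually_ge_atTop N0)).exists
  exact ⟨N, h3, h2⟩

lemma trunc_tendsto {P : Measure Ω} {g : Ω → ℝ} (hg : Integrable g P) :
    Tendsto (fun K : ℕ => ∫ ω, (if (K:ℝ) < g ω then g ω else 0) ∂P) atTop (𝓝 0) := by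
  have h := tendsto_integral_of_dominated_convergence (μ := P)
    (F := fun (K : ℕ) ω => if (K:ℝ) < g ω then g ω else 0) (f := fun _ => (0:ℝ)) (fun ω => ‖g ω‖) ?_
    hg.norm ?_ ?_
  · simpa using h
  · intro K
    have : NullMeasurableSet {ω | (K:ℝ) < g ω} P :=
      nullMeasurableSet_lt aemeasurable_const hg.aemeasurable
    have h2 := hg.aestronglyMeasurable.indicator₀ this
    refine h2.congr (Eventually.of_forall fun ω => ?_)
    simp [Set.indicator]
  · intro K
    refine Eventually.of_forall fun ω => ?_
    by_cases hc : (K:ℝ) < g ω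
    · simp only [hc, if_true]; exact le_rfl
    · simp only [hc, if_false, norm_zero]; exact norm_nonneg _
  · refine Eventually.of_forall fun ω => ?_
    refine tendsto_const_nhds.congr' ?_
    obtain ⟨K0, hK0⟩ := exists_nat_ge (g ω)
    filter_upwards [eventually_ge_atTop K0] with K hK
    have : ¬ (K:ℝ) < g ω := not_lt.2 (hK0.trans (by exact_mod_cast hK))
    simp only [this, if_false]

/-- linear map with given columns -/
def ofCols (D : Fin d → Rn n) : Rd d →L[ℝ] Rn n :=
  ∑ j, (EuclideanSpace.proj j : Rd d →L[ℝ] ℝ).smulRight (D j)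

lemma ofCols_apply (D : Fin d → Rn n) (j : Fin d) : ofCols D (toRd (stdb j : Zd d)) = D j := by
  unfold ofCols
  rw [ContinuousLinearMap.sum_apply]
  simp [toRd_apply, stdb, Pi.single_apply]

section
variable {P : Measure Ω} {τ : Zd d → Ω → Ω} {E0 : Finset (Zd d)} {p c₁ : ℝ}
    {V : Zd d → Ω → Rn n → ℝ} {lam : Zd d → Ω → ℝ}

lemma exists_slopes {k Nc T R0 r g m h : ℕ} (G : Grd k Nc T R0 r g m h) {ψ : Zd d → Rn n} {σ Λ : ℝ}
    {S : Set (Rd d →L[ℝ] Rn n)}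
    (hS : closedBall (0 : Rd d →L[ℝ] Rn n) (d * Λ) ⊆ ⋃ A ∈ S, ball A (σ / 2))
    (hsup : ∀ z j, ‖ψ (z + stdb j) - ψ z‖ ≤ Λ)
    (hosc : ∀ (z y : Zd d) (j : Fin d), (∀ i, |y i| ≤ (2 * r + R0 : ℕ)) →
      ‖(ψ (z + y + stdb j) - ψ (z + y)) - (ψ (z + stdb j) - ψ z)‖ ≤ σ / 2) :
    ∃ A : Zd d → Rd d →L[ℝ] Rn n, (∀ x, A x ∈ S) ∧ ∀ x z j,
      dist z (ctr r g x) ≤ ((2 * r + R0 : ℕ):ℝ) →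
      ‖ψ (z + stdb j) - ψ z - A x (toRd (stdb j))‖ ≤ σ := by
  have h1 : ∀ x : Zd d, ∃ A ∈ S, ‖ofCols (fun j => ψ (ctr r g x + stdb j) - ψ (ctr r g x)) - A‖ ≤ σ / 2 := by
    intro x
    have h2 : ofCols (fun j => ψ (ctr r g x + stdb j) - ψ (ctr r g x)) ∈
        closedBall (0 : Rd d →L[ℝ] Rn n) (d * Λ) := by
      rw [mem_closedBall_zero_iff]
      refine (opNorm_le_sum _).trans ?_
      refine (Finset.sum_le_card_nsmul _ _ Λ fun j _ => ?_).trans (le_of_eq (by simp))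
      rw [ofCols_apply]
      exact hsup _ _
    have h3 := hS h2
    rw [mem_iUnion₂] at h3
    obtain ⟨A, hA, h4⟩ := h3
    exact ⟨A, hA, by rw [← dist_eq_norm]; exact (mem_ball.1 h4).le⟩
  choose A hAS hA using h1
  refine ⟨A, hAS, fun x z j hz => ?_⟩
  have h5 := hosc (ctr r g x) (z - ctr r g x) j (fun i => by
    have h6 := (dist_le_pi_dist z (ctr r g x) i).trans hz
    rw [Int.dist_eq, ← Int.cast_sub, ← Int.cast_abs] at h6
    exact_mod_cast h6)
  rw [add_sub_cancel] at h5
  have h7 := (ContinuousLinearMap.le_opNorm (ofCols (fun j => ψ (ctr r g x + stdb j) - ψ (ctr r g x)) - A x)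
    (toRd (stdb j)))
  rw [norm_toRd_stdb, mul_one, ContinuousLinearMap.sub_apply, ofCols_apply] at h7
  have h8 := hA x
  calc ‖ψ (z + stdb j) - ψ z - A x (toRd (stdb j))‖ =
      ‖((ψ (z + stdb j) - ψ z) - (ψ (ctr r g x + stdb j) - ψ (ctr r g x))) +
        ((ψ (ctr r g x + stdb j) - ψ (ctr r g x)) - A x (toRd (stdb j)))‖ := by congr 1; abel
    _ ≤ σ / 2 + σ / 2 := (norm_add_le _ _).trans (add_le_add h5 (h7.trans h8))
    _ = σ := by ring

lemma tendsto_m {Nc T : ℕ} (hNc : 0 < Nc) (hT : 4 ≤ T) :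
    Tendsto (fun k : ℕ => k / Nc - 2 * (k / Nc / T)) atTop atTop := by
  have h1 : Tendsto (fun k : ℕ => k / Nc) atTop atTop := Nat.tendsto_div_const_atTop hNc.ne'
  have h2 : Tendsto (fun k : ℕ => k / Nc / 2) atTop atTop :=
    (Nat.tendsto_div_const_atTop (by norm_num : (2:ℕ) ≠ 0)).comp h1
  refine tendsto_atTop_mono (fun k => ?_) h2
  have : k / Nc / T ≤ k / Nc / 4 := Nat.div_le_div_left hT (by norm_num)
  omega

set_option maxHeartbeats 1000000 in
lemma Hyp.step (H : Hyp P τ E0 p c₁ V lam) (F : Rd d →L[ℝ] Rn n) {C0 : ℝ} (hC0 : 0 ≤ C0) {ε : ℝ}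
    (hε : 0 < ε) : ∃ η : ℝ, 0 < η ∧ ∀ q : ℕ, 0 < q → ∃ ρ : ℝ, 0 < ρ ∧
      WHP P (fun k ω => ∀ φ f : Zd d → Rn n, Per k f →
        en τ E0 V ω F φ k ≤ (k:ℝ) ^ d * W0 P τ E0 V F →
        ∑ z ∈ bx d k, ‖φ z - f z‖ ≤ ρ * k * (k:ℝ) ^ d → gp k p f ≤ C0 * (k:ℝ) ^ d →
        gp k p (fun z => f z - Tm (k / q) f z) ≤ η * (k:ℝ) ^ d →
        (k:ℝ) ^ d * W0 P τ E0 V F ≤ en τ E0 V ω F φ k + ε * (k:ℝ) ^ d) := by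
  have hp := H.hp
  have hK1 := H.Kc1_nonneg F
  have hK2 := H.Kc2_nonneg F
  have hW := H.W0_nonneg F
  have hCMn := CM_nonneg d p
  set e : ℝ := (E0.card:ℝ) with he
  have he0 : 0 ≤ e := Nat.cast_nonneg _
  set k1 := Kc1 E0 F p c₁ with hk1
  set k2 := Kc2 E0 F p c₁ with hk2
  set W := W0 P τ E0 V F with hWd
  set B : ℝ := CM d p * (1 + C0) with hB
  have hB0 : 0 ≤ B := by positivity
  obtain ⟨R0, hR0p, hR0⟩ : ∃ R0 : ℕ, 0 < R0 ∧ irange d E0 ≤ R0 :=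
    ⟨⌈irange d E0⌉₊ + 1, Nat.succ_pos _, (Nat.le_ceil _).trans (by exact_mod_cast Nat.le_succ _)⟩
  have hCU := H.CU_nonneg F R0
  set cu := CU P E0 lam p c₁ F R0 with hcu
  set L : ℝ := Lbd P E0 lam + 1 with hL
  have hL0 : 0 ≤ L := by have := H.one_le_Lbd; rw [hL]; linarith
  set δ : ℝ := ε / 9 with hδ
  have hδ0 : 0 < δ := by positivity
  obtain ⟨N, hN, hNδ⟩ := exists_large (k2 * W + B * e * k2 * L) hδ0 1
  obtain ⟨ε', hε'0, -, hε'⟩ := exists_small (C := B * e * k1) (by positivity) hδ0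
  obtain ⟨Kn, hKn⟩ : ∃ K : ℕ, ∀ b ∈ E0, ∫ ω, (if (K:ℝ) < lam b ω then lam b ω else 0) ∂P < ε' := by
    have : ∀ b ∈ E0, ∀ᶠ K : ℕ in atTop, ∫ ω, (if (K:ℝ) < lam b ω then lam b ω else 0) ∂P < ε' :=
      fun b hb => (trunc_tendsto (H.lamint b hb)).eventually (gt_mem_nhds hε'0)
    exact ((Filter.eventually_all_finset E0).2 this).exists
  set K : ℝ := (Kn:ℝ) with hK
  have hK0 : 0 ≤ K := Nat.cast_nonneg _
  obtain ⟨T, hT4, hTδ⟩ := exists_large (B * e * k1 * ((1 + K) * (4 * d)) + e * cu * (4 * d * 2 ^ d) * B) hδ0 4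
  have hT0 : (0:ℝ) < T := by exact_mod_cast (by omega : 0 < T)
  set Θ : ℝ := k1 * e * (1 + K) * 8 * 2 ^ N * T with hΘ
  have hΘ0 : 0 ≤ Θ := by positivity
  obtain ⟨t, ht0, -, htδ⟩ := exists_small (C := Θ * B) (by positivity) hδ0
  have htp : 0 < t ^ (1 - p) := Real.rpow_pos_of_pos ht0 _
  have hdp : (0:ℝ) ≤ (d:ℝ) ^ p := Real.rpow_nonneg (Nat.cast_nonneg _) _
  obtain ⟨η, hη0, -, hηδ⟩ := exists_small (C := Θ * (t ^ (1 - p) * (2 ^ d * d ^ p))) (by positivity) hδ0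
  refine ⟨η, hη0, fun q hq => ?_⟩
  set Λ : ℝ := (2 * q) ^ d * (1 + C0) with hΛ
  have hΛ0 : 0 ≤ Λ := by positivity
  obtain ⟨σ, hσ0, hσ1, hσδ⟩ := exists_small (C := Θ * (2 * d * B) + 24 * d * T) (by positivity)
    (lt_min hδ0 zero_lt_one)
  have hσT : 24 * d * T * σ ≤ 1 := by
    have h1 := hσδ.trans (min_le_right _ _)
    have : 0 ≤ Θ * (2 * d * B) * σ := by positivity
    linarith
  have hσδ' : Θ * (2 * d * B) * σ ≤ δ := by
    have h1 := hσδ.trans (min_le_left _ _)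
    have : 0 ≤ 24 * d * T * σ := by positivity
    linarith
  obtain ⟨Nc, hNc1, hNcσ⟩ := exists_large (24 * q * Λ * d) (half_pos hσ0) 1
  have hNc : 0 < Nc := hNc1
  have hNcR : (0:ℝ) < Nc := by exact_mod_cast hNc
  have : ProperSpace (Rd d →L[ℝ] Rn n) := FiniteDimensional.proper ℝ _
  obtain ⟨S, hSb, hSf, hSc⟩ := (isCompact_closedBall (0 : Rd d →L[ℝ] Rn n) (d * Λ)).finite_cover_balls
    (half_pos hσ0)
  set Mx : ℝ := 1 + d * Λ with hMx
  have hMx0 : 0 ≤ Mx := by positivity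
  obtain ⟨ρ, hρ0, -, hρδ⟩ := exists_small (C := Θ * (Mx ^ (p - 1) * (2 * Nc))) (by positivity) hδ0
  refine ⟨ρ, hρ0, ?_⟩
  have hm := tendsto_m hNc hT4
  -- the good events
  have g1 : WHP P (fun k ω => ∀ x ∈ bx d Nc, ∀ A ∈ hSf.toFinset,
      ∫ ω, Xr τ E0 V (F + A) (k / Nc - 2 * (k / Nc / T)) ω ∂P - δ <
        Xr τ E0 V (F + A) (k / Nc - 2 * (k / Nc / T)) (τ (ctr (k / Nc) (k / Nc / T) x) ω)) := by
    refine WHP.finset _ fun x _ => WHP.finset _ fun A _ => ?_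
    refine H.whp_shift (Q := fun m ω => ∫ ω, Xr τ E0 V (F + A) m ω ∂P - δ < Xr τ E0 V (F + A) m ω) ?_ hm _
    have := H.Xr_prob (F + A) hδ0
    unfold WHP
    simpa only [not_lt] using this
  have g2 : WHP P (fun k ω => ∀ x ∈ bx d Nc, ∀ b ∈ E0,
      ∑ z ∈ bx d (k / Nc - 2 * (k / Nc / T)), lam b (τ z (τ (ctr (k / Nc) (k / Nc / T) x) ω)) ≤
        L * ((k / Nc - 2 * (k / Nc / T) : ℕ):ℝ) ^ d) := by
    refine WHP.finset _ fun x _ => WHP.finset _ fun b hb => ?_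
    refine H.whp_shift (Q := fun m ω => ∑ z ∈ bx d m, lam b (τ z ω) ≤ L * (m:ℝ) ^ d) ?_ hm _
    exact H.whp_sum_le (lam b) (H.lamint b hb) (by have := H.le_Lbd hb; rw [hL]; linarith)
  have g3 : WHP P (fun k ω => ∀ x ∈ bx d Nc, ∀ b ∈ E0,
      ∑ z ∈ bx d (k / Nc - 2 * (k / Nc / T)), (if K < lam b (τ z (τ (ctr (k / Nc) (k / Nc / T) x) ω)) then
        lam b (τ z (τ (ctr (k / Nc) (k / Nc / T) x) ω)) else 0) ≤
        ε' * ((k / Nc - 2 * (k / Nc / T) : ℕ):ℝ) ^ d) := by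
    refine WHP.finset _ fun x _ => WHP.finset _ fun b hb => ?_
    refine H.whp_shift (Q := fun m ω => ∑ z ∈ bx d m,
      (if K < lam b (τ z ω) then lam b (τ z ω) else 0) ≤ ε' * (m:ℝ) ^ d) ?_ hm _
    refine H.whp_sum_le (fun ω => if K < lam b ω then lam b ω else 0) ?_ (hKn b hb)
    have h2 := (H.lamint b hb).indicator (measurableSet_lt measurable_const (H.lammeas b hb) :
      MeasurableSet {ω | K < lam b ω})
    refine h2.congr (Eventually.of_forall fun ω => ?_)
    simp [Set.indicator]
  refine ((g1.and g2).and g3).mono ?_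
  filter_upwards [Grd.ex hNc hT4 hR0p, eventually_ge_atTop q] with k G hkq
  rintro ω ⟨⟨e1, e2⟩, e3⟩ φ f hf hen hρk hgf hgη
  set r := k / Nc
  set g := r / T
  set m := r - 2 * g
  have hk0 : (0:ℝ) < k := by exact_mod_cast G.kpos
  have hkd : 0 < (k:ℝ) ^ d := by positivity
  obtain ⟨hl, -⟩ := scale_ge hq hkq
  obtain ⟨A, hAS, hA⟩ := exists_slopes G (ψ := Tm (k / q) f) (Λ := Λ) hSc
    (fun z j => (tm_grad H.hd hq hkq hp.le hf hgf j).1 z) (fun z y j hy => by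
      refine ((tm_grad H.hd hq hkq hp.le hf hgf j).2 z y _ hy).trans (le_trans ?_ hNcσ)
      rw [← hΛ, div_le_div_iff₀ hk0 hNcR]
      have h1 : (2 * r + R0) * Nc ≤ 3 * k := by
        have a1 : 2 * r + R0 ≤ 3 * r := by have := G.Rg; have := G.rg4; omega
        calc (2 * r + R0) * Nc ≤ 3 * r * Nc := Nat.mul_le_mul_right _ a1
          _ = 3 * (r * Nc) := by ring
          _ ≤ 3 * k := Nat.mul_le_mul_left _ G.kr
      have h2 : ((2 * r + R0 : ℕ):ℝ) * Nc ≤ 3 * k := by exact_mod_cast h1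
      have h3 := mul_le_mul_of_nonneg_left h2 (by positivity : 0 ≤ 8 * q * Λ * d)
      linarith)
  have hψ : gp k p (Tm (k / q) f) ≤ C0 * (k:ℝ) ^ d := (tm_gp_le G.kpos hp.le hf hl).trans hgf
  have key := H.det F G hR0 hσ0.le hσ1 hσT (φ := φ) hf (hf.tm (k / q)) A (fun x _ => hA x) hN hK0 hL0 hε'0.le
    hδ0.le ht0 hMx0 (fun x _ => by
      have := hSb (hAS x)
      rw [mem_closedBall_zero_iff] at this
      rw [hMx]; linarith) (B := B) (by
      have := mul_le_mul_of_nonneg_left hψ hCMn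
      rw [hB]; linarith) ω hen hρk hgη
    (fun x hx => e1 x hx (A x) (hSf.mem_toFinset.2 (hAS x))) e2 e3
  refine key.trans ?_
  have hNR : (0:ℝ) < N := by exact_mod_cast hN
  have i1 : k2 / N * W + B * (e * (k2 / N * L)) ≤ δ := le_trans (le_of_eq (by field_simp)) hNδ
  have i2 : B * (e * (k1 * ((1 + K) * (4 * d / T)))) + e * cu * (4 * d * 2 ^ d / T) * B ≤ δ :=
    le_trans (le_of_eq (by field_simp)) hTδ
  have hfin : k2 / N * W + δ + B * (e * (k2 / N * L + k1 * ((1 + K) * (4 * d / T) + ε'))) +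
      Θ * (Mx ^ (p - 1) * (2 * Nc * ρ) + (t + 2 * d * σ) * B + t ^ (1 - p) * (2 ^ d * d ^ p * η)) +
      e * cu * (4 * d * 2 ^ d / T) * B ≤ ε := by
    have h9 : ε = 9 * δ := by rw [hδ]; ring
    linarith
  have := mul_le_mul_of_nonneg_left hfin hkd.le
  linarith
end


/-- iterated smoothing -/
def chain (l : ℕ → ℕ) (f : Zd d → Rn n) : ℕ → Zd d → Rn n
  | 0 => f
  | j + 1 => Tm (l j) (chain l f j)

lemma chain_per {k : ℕ} {f : Zd d → Rn n} (hf : Per k f) (l : ℕ → ℕ) (j : ℕ) :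
    Per k (chain l f j) := by
  induction j with
  | zero => exact hf
  | succ j ih => exact ih.tm _

lemma chain_gp {k : ℕ} (hk : 0 < k) {p : ℝ} (hp : 1 ≤ p) {f : Zd d → Rn n} (hf : Per k f)
    {l : ℕ → ℕ} (hl : ∀ j, 0 < l j) (j : ℕ) : gp k p (chain l f j) ≤ gp k p f := by
  induction j with
  | zero => exact le_rfl
  | succ j ih => exact (tm_gp_le hk hp (chain_per hf l j) (hl j)).trans ih

lemma chain_l1 {k : ℕ} (hk : 0 < k) {f : Zd d → Rn n} (hf : Per k f)
    {l : ℕ → ℕ} (hl : ∀ j, 0 < l j) {M : ℝ} (j : ℕ) (hM : ∀ i < j, (l i : ℝ) ≤ M) :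
    ∑ z ∈ bx d k, ‖f z - chain l f j z‖ ≤ j * (2 * d * M * gp k 1 f) := by
  induction j with
  | zero => simp [chain]
  | succ j ih =>
    have h1 := ih fun i hi => hM i (by omega)
    have h2 := l1_tm hk (chain_per hf l j) (hl j)
    have h3 := chain_gp hk le_rfl hf hl j
    have h4 := hM j (by omega)
    have h5 : 2 * d * (l j : ℝ) * gp k 1 (chain l f j) ≤ 2 * d * M * gp k 1 f := by
      have := gp_nonneg k 1 (chain l f j)
      have hM0 : 0 ≤ M := (Nat.cast_nonneg _).trans h4
      gcongr
    have h6 : ∑ z ∈ bx d k, ‖f z - chain l f (j+1) z‖ ≤ ∑ z ∈ bx d k, ‖f z - chain l f j z‖ +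
        ∑ z ∈ bx d k, ‖chain l f j z - Tm (l j) (chain l f j) z‖ := by
      rw [← Finset.sum_add_distrib]
      refine Finset.sum_le_sum fun z _ => ?_
      exact norm_sub_le_norm_sub_add_norm_sub _ _ _
    push_cast
    linarith

lemma chain_pigeon {k : ℕ} {p B : ℝ} {f : Zd d → Rn n} (hB : gp k p f ≤ B)
    (l : ℕ → ℕ) {I : ℕ} (hI : 0 < I) :
    ∃ j < I, gp k p (chain l f j) - gp k p (chain l f (j+1)) ≤ B / I := by
  have hI' : (0:ℝ) < I := by exact_mod_cast hI
  have h := Finset.sum_range_sub' (fun j => gp k p (chain l f j)) I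
  have h0 := gp_nonneg k p (chain l f I)
  obtain ⟨j, hj, hj2⟩ := Finset.exists_le_of_sum_le (s := Finset.range I)
    (f := fun j => gp k p (chain l f j) - gp k p (chain l f (j+1))) (g := fun _ => B / I)
    ⟨0, Finset.mem_range.2 hI⟩ (by
      rw [h, Finset.sum_const, Finset.card_range, nsmul_eq_mul, mul_div_cancel₀ _ hI'.ne']
      have : chain l f 0 = f := rfl
      rw [this]; linarith)
  exact ⟨j, Finset.mem_range.1 hj, hj2⟩

section
variable {P : Measure Ω} {τ : Zd d → Ω → Ω} {E0 : Finset (Zd d)} {p c₁ : ℝ}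
    {V : Zd d → Ω → Rn n → ℝ} {lam : Zd d → Ω → ℝ}

lemma Hyp.whp_lower (H : Hyp P τ E0 p c₁ V lam) (F : Rd d →L[ℝ] Rn n) {ε : ℝ} (hε : 0 < ε) :
    WHP P (fun k ω => ∀ φ : Zd d → Rn n, Per k φ →
      (k:ℝ) ^ d * W0 P τ E0 V F ≤ en τ E0 V ω F φ k + ε * (k:ℝ) ^ d) := by
  have hp := H.hp
  obtain ⟨C0, hC0, hstart⟩ := H.start F
  obtain ⟨η, hη, hstep⟩ := H.step F hC0 hε
  choose! ρ hρ hwhp using hstep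
  obtain ⟨η', hη'0, -, hη'⟩ := exists_small (C := 2 * C0) (ε := η / 2) (by positivity) (by positivity)
  obtain ⟨C, hC, hUC⟩ := unif_conv (n := n) hp hη'0
  obtain ⟨I, hI, hI2⟩ := exists_large (C / 2 * C0) (ε := η / 2) (by positivity) 1
  have hnx : ∀ q : ℕ, ∃ q' : ℕ, 0 < q → q ≤ q' ∧ (I + 1) * (2 * d * C0) / q' ≤ ρ q := by
    intro q
    by_cases hq : 0 < q
    · obtain ⟨N, hN, hN2⟩ := exists_large ((I + 1) * (2 * d * C0)) (hρ q hq) q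
      exact ⟨N, fun _ => ⟨hN, hN2⟩⟩
    · exact ⟨0, fun h => absurd h hq⟩
  choose nx hnx using hnx
  set Q : ℕ → ℕ := fun i => nx^[i] 1 with hQ
  have hQs : ∀ i, Q (i+1) = nx (Q i) := fun i => Function.iterate_succ_apply' nx i 1
  have hQ0 : ∀ i, 0 < Q i := by
    intro i
    induction i with
    | zero => exact Nat.one_pos
    | succ i ih => rw [hQs]; exact ih.trans_le (hnx _ ih).1
  have hQm : Monotone Q := monotone_nat_of_le_succ fun i => by rw [hQs]; exact (hnx _ (hQ0 i)).1
  have hall := (hstart (Q I) (hQ0 I)).and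
    (WHP.finset (Finset.range I) (fun i _ => hwhp (Q i) (hQ0 i)))
  refine hall.mono ?_
  filter_upwards [eventually_ge_atTop (Q I)] with k hkQ ω hω φ hφ
  by_cases hen : en τ E0 V ω F φ k ≤ (k:ℝ) ^ d * W0 P τ E0 V F
  swap
  · push Not at hen
    have : 0 ≤ ε * (k:ℝ) ^ d := by positivity
    linarith
  have hk : 0 < k := (hQ0 I).trans_le hkQ
  have hkd : (0:ℝ) < (k:ℝ) ^ d := by positivity
  obtain ⟨hg0, hg1⟩ := hω.1 φ hφ hen
  set f := Av (bx d (k / Q I)) φ with hf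
  have hfP : Per k f := hφ.av _
  set l : ℕ → ℕ := fun j => k / Q (I - 1 - j) with hl
  have hl0 : ∀ j, 0 < l j := fun j =>
    Nat.div_pos ((hQm (by omega : I - 1 - j ≤ I)).trans hkQ) (hQ0 _)
  obtain ⟨j, hj, hgap⟩ := chain_pigeon hg0 l (I := I) (by omega)
  have hs := hω.2 (I - 1 - j) (Finset.mem_range.2 (by omega)) φ (chain l f j)
    (chain_per hfP l j) hen
  have hgj : gp k p (chain l f j) ≤ C0 * (k:ℝ) ^ d := (chain_gp hk hp.le hfP hl0 j).trans hg0
  refine hs ?_ hgj ?_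
  · set q := Q (I - 1 - j) with hq
    have hq1 : nx q = Q (I - j) := by
      rw [hq, ← hQs]; congr 1; omega
    obtain ⟨-, hn2⟩ := hnx q (hQ0 _)
    rw [hq1] at hn2
    have hQpos : (0:ℝ) < Q (I - j) := by exact_mod_cast hQ0 _
    have hdiv : ∀ m, I - j ≤ m → ((k / Q m : ℕ) : ℝ) ≤ k / Q (I - j) := by
      intro m hm
      refine (Nat.cast_div_le).trans ?_
      have : (Q (I - j) : ℝ) ≤ Q m := by exact_mod_cast hQm hm
      gcongr
    have hlI : 0 < k / Q I := Nat.div_pos hkQ (hQ0 _)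
    have a1 := l1_av hk hφ (bx_nonempty (d := d) hlI) (fun y hy => bx_abs_le hy)
    have a2 := chain_l1 hk hfP hl0 (M := k / Q (I - j)) j (fun i hi => hdiv _ (by omega))
    have a3 : gp k 1 f ≤ C0 * (k:ℝ) ^ d := (av_gp_le hk le_rfl hφ (bx_nonempty hlI)).trans hg1
    have a4 : ∑ z ∈ bx d k, ‖φ z - chain l f j z‖ ≤ ∑ z ∈ bx d k, ‖φ z - f z‖ +
        ∑ z ∈ bx d k, ‖f z - chain l f j z‖ := by
      rw [← Finset.sum_add_distrib]
      exact Finset.sum_le_sum fun z _ => norm_sub_le_norm_sub_add_norm_sub _ _ _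
    have b1 : d * ((k / Q I : ℕ):ℝ) * gp k 1 φ ≤
        2 * d * (k / Q (I - j)) * (C0 * (k:ℝ) ^ d) := by
      have := hdiv I (by omega)
      have h0 := gp_nonneg k 1 φ
      have : d * ((k / Q I : ℕ):ℝ) ≤ 2 * d * (k / Q (I - j)) := by
        have h3 : (d:ℝ) * ((k / Q I : ℕ):ℝ) ≤ d * (k / Q (I - j)) := by gcongr
        have h4 : (0:ℝ) ≤ d * (k / Q (I - j)) := by positivity
        linarith
      gcongr
    have b2 : (j:ℝ) * (2 * d * (k / Q (I - j)) * gp k 1 f) ≤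
        I * (2 * d * (k / Q (I - j)) * (C0 * (k:ℝ) ^ d)) := by
      have hjI : (j:ℝ) ≤ I := by exact_mod_cast hj.le
      have h0 := gp_nonneg k 1 f
      gcongr
    have b3 : (I + 1) * (2 * d * (k / Q (I - j)) * (C0 * (k:ℝ) ^ d)) ≤
        ρ q * k * (k:ℝ) ^ d := by
      have : (I + 1) * (2 * d * (k / Q (I - j)) * (C0 * (k:ℝ) ^ d)) =
        ((I + 1) * (2 * d * C0) / Q (I - j)) * k * (k:ℝ) ^ d := by ring
      rw [this]
      gcongr
    linarith
  · have h1 := smooth_gap hk hp hη'0.le hC hUC (chain_per hfP l j) (hl0 j)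
    refine h1.trans ?_
    have h2 : 2 * η' * gp k p (chain l f j) ≤ η / 2 * (k:ℝ) ^ d := by
      have : 2 * η' * gp k p (chain l f j) ≤ 2 * η' * (C0 * (k:ℝ) ^ d) := by gcongr
      have h3 : (2 * C0 * η') * (k:ℝ) ^ d ≤ η / 2 * (k:ℝ) ^ d := by gcongr
      linarith
    have h3 : C / 2 * (gp k p (chain l f j) - gp k p (chain l f (j+1))) ≤ η / 2 * (k:ℝ) ^ d := by
      have h4 := mul_le_mul_of_nonneg_left hgap (by positivity : 0 ≤ C / 2)
      have h5 := mul_le_mul_of_nonneg_right hI2 hkd.le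
      have h6 : C / 2 * (C0 * (k:ℝ) ^ d / I) = C / 2 * C0 / I * (k:ℝ) ^ d := by ring
      linarith
    have h7 : chain l f (j+1) = Tm (l j) (chain l f j) := rfl
    rw [h7] at h3
    linarith

lemma Hyp.main (H : Hyp P τ E0 p c₁ V lam) (F : Rd d →L[ℝ] Rn n) :
    Tendsto (fun k : ℕ => ∫ ω, Wper τ E0 V k ω F ∂P) atTop (𝓝 (W0 P τ E0 V F)) := by
  refine H.reduce F fun ε hε => ?_
  refine tendsto_of_tendsto_of_tendsto_of_le_of_le' tendsto_const_nhds
    (H.whp_lower F (half_pos hε)) (Eventually.of_forall fun _ => zero_le) ?_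
  filter_upwards [eventually_gt_atTop 0] with k hk
  refine measure_mono fun ω hω hcon => ?_
  have hkd : (0:ℝ) < (k:ℝ) ^ d := by positivity
  have : W0 P τ E0 V F - ε / 2 ≤ Wper τ E0 V k ω F := by
    refine H.le_Wper ω F k _ fun φ hφ => ?_
    have := hcon φ hφ
    rw [le_inv_mul_iff₀ hkd]
    linarith
  simp only [Set.mem_ofPred_eq] at hω
  linarith
end


lemma final_aux (P : Measure Ω) [IsProbabilityMeasure P] {g : Ω → ℝ} (hg : Measurable g)
    (hg0 : ∀ ω, 0 ≤ g ω) {f : Ω → ℝ} (hf : Measurable f) (hf0 : ∀ ω, 0 ≤ f ω)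
    (hfg : ∀ᵐ ω ∂P, f ω ≤ 1 + g ω) (h : ∫⁻ ω, ENNReal.ofReal (g ω) ∂P < ⊤) : Integrable f P := by
  have hgi : Integrable g P := by
    refine ⟨hg.aestronglyMeasurable, ?_⟩
    rw [hasFiniteIntegral_iff_ofReal (Eventually.of_forall hg0)]
    exact h
  refine Integrable.mono' ((integrable_const (1:ℝ)).add hgi) hf.aestronglyMeasurable ?_
  filter_upwards [hfg] with ω hω
  rw [Real.norm_of_nonneg (hf0 ω)]
  exact hω

lemma final_pos (P : Measure Ω) {g : Ω → ℝ} (hg : Measurable g) {β : ℝ} (hβ : 0 < β)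
    (h : ∫⁻ ω, ENNReal.ofReal (g ω) ^ (-β) ∂P < ⊤) : ∀ᵐ ω ∂P, 0 < g ω := by
  filter_upwards [ae_lt_top ((hg.ennreal_ofReal).pow_const (-β)) h.ne] with ω hω
  by_contra hcon
  push Not at hcon
  rw [ENNReal.ofReal_of_nonpos hcon, ENNReal.zero_rpow_of_neg (by linarith)] at hω
  exact lt_irrefl _ hω

lemma final_mu (P : Measure Ω) [IsProbabilityMeasure P] {g : Ω → ℝ} (hg : Measurable g)
    (hg0 : ∀ ω, 0 ≤ g ω) {β s : ℝ} (hs : 0 < s) (hβ : s ≤ β)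
    (h : ∫⁻ ω, ENNReal.ofReal (g ω) ^ (-β) ∂P < ⊤) : Integrable (fun ω => g ω ^ (-s)) P := by
  have hpos := final_pos P hg (by linarith) h
  refine final_aux P (g := fun ω => g ω ^ (-β)) (hg.pow_const _)
    (fun ω => Real.rpow_nonneg (hg0 ω) _) (hg.pow_const _)
    (fun ω => Real.rpow_nonneg (hg0 ω) _) ?_ ?_
  · filter_upwards [hpos] with ω hω
    have hb := Real.rpow_nonneg hω.le (-β)
    rcases le_total 1 (g ω) with h1 | h1
    · have := Real.rpow_le_one_of_one_le_of_nonpos h1 (by linarith : -s ≤ 0)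
      linarith
    · have := Real.rpow_le_rpow_of_exponent_ge hω h1 (by linarith : -β ≤ -s)
      linarith
  · refine lt_of_eq_of_lt (lintegral_congr_ae ?_) h
    filter_upwards [hpos] with ω hω
    rw [ENNReal.ofReal_rpow_of_pos hω]



/-- periodic cell formula, Lemma 3.2/"Whomper" of the paper:
`W₀(F) = lim_k E[W^(k)(·;F)]`. -/
theorem periodic_cell_formula
    {d n : ℕ} (hd : 2 ≤ d) (hn : 1 ≤ n)
    {Ω : Type*} [MeasurableSpace Ω] (P : Measure Ω) [IsProbabilityMeasure P]
    (τ : Zd d → Ω → Ω) (hτ0 : τ 0 = id)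
    (hτadd : ∀ x y : Zd d, τ (x + y) = τ x ∘ τ y)
    (hτmp : ∀ z : Zd d, MeasurePreserving (τ z) P P)
    (hτerg : ∀ B : Set Ω, MeasurableSet B → (∀ z : Zd d, τ z ⁻¹' B = B) → P B = 0 ∨ P B = 1)
    (E0 : Finset (Zd d)) (hE00 : (0 : Zd d) ∉ E0) (hE0b : ∀ i : Fin d, stdb i ∈ E0)
    (p c₁ : ℝ) (hp : 1 < p) (hc₁ : 0 < c₁)
    (V : Zd d → Ω → Rn n → ℝ)
    (hVmeas : ∀ b ∈ E0, Measurable fun q : Ω × Rn n => V b q.1 q.2)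
    (hVcont : ∀ b ∈ E0, ∀ ω : Ω, Continuous (V b ω))
    (hVnn : ∀ b ∈ E0, ∀ (ω : Ω) (r : Rn n), 0 ≤ V b ω r)
    (lam : Zd d → Ω → ℝ)
    (hlammeas : ∀ b ∈ E0, Measurable (lam b))
    (hlamnn : ∀ b ∈ E0, ∀ ω : Ω, 0 ≤ lam b ω)
    (hgrowth : ∀ b ∈ E0, ∀ (ω : Ω) (r : Rn n),
      lam b ω * (‖r‖ ^ p / c₁ - c₁) ≤ V b ω r ∧ V b ω r ≤ c₁ * (1 + lam b ω * (‖r‖ ^ p + 1)))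
    (α β : ℝ) (hα : 1 ≤ α) (hβ : 1 / (p - 1) ≤ β)
    (hmomα : ∀ b ∈ E0, ∫⁻ ω, ENNReal.ofReal (lam b ω ^ α) ∂P < ⊤)
    (hmomβ : ∀ i : Fin d, ∫⁻ ω, ENNReal.ofReal (lam (stdb i) ω) ^ (-β) ∂P < ⊤)
    (h2T : (1 < α ∧ 1 / α + 1 / β ≤ p / (d : ℝ)) ∨
      (n = 1 ∧ ∃ q c₂ : ℝ, 1 < q ∧ q < p ∧ ∃ f : Zd d → Ω → Rn n → ℝ,
        ∀ b ∈ E0, ∀ ω : Ω,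
          (∀ r : Rn n, 0 ≤ f b ω r) ∧
          ConvexOn ℝ Set.univ (fun r : Rn n => V b ω r + f b ω r) ∧
          (∀ r : Rn n, f b ω r ≤ c₂ * (1 + lam b ω * (‖r‖ ^ q + 1)))))
    (F : Rd d →L[ℝ] Rn n) :
    Tendsto (fun k : ℕ => ∫ ω, Wper τ E0 V k ω F ∂P) atTop (𝓝 (W0 P τ E0 V F)) := by
  have hp1 : 0 < 1 / (p - 1) := by
    have : 0 < p - 1 := by linarith
    positivity
  have H : Hyp P τ E0 p c₁ V lam :=
    { hd := by omega
      prob := inferInstance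
      τ0 := hτ0
      τadd := hτadd
      τmp := hτmp
      erg := hτerg
      E00 := hE00
      E0b := hE0b
      hp := hp
      hc₁ := hc₁
      Vmeas := hVmeas
      Vcont := hVcont
      Vnn := hVnn
      lammeas := hlammeas
      lamnn := hlamnn
      lo := fun b hb ω r => (hgrowth b hb ω r).1
      hi := fun b hb ω r => (hgrowth b hb ω r).2
      lamint := fun b hb => final_aux P (g := fun ω => lam b ω ^ α) ((hlammeas b hb).pow_const _)
        (fun ω => Real.rpow_nonneg (hlamnn b hb ω) _) (hlammeas b hb) (hlamnn b hb)
        (Eventually.of_forall fun ω => le_one_add_rpow hα (hlamnn b hb ω)) (hmomα b hb)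
      muint := fun i => final_mu P (hlammeas _ (hE0b i)) (hlamnn _ (hE0b i)) hp1 hβ (hmomβ i)
      lampos := fun i => final_pos P (hlammeas _ (hE0b i)) (lt_of_lt_of_le hp1 hβ) (hmomβ i) }
  exact H.main F

end StochHom
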